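/- arXiv:math/0509036 — 2 statements merged into one kernel-verified Lean document; each statement's English description precedes it below -/
import Mathlib

section
/- Let G be a finitely presented group and let p be a prime. Suppose that limsup_{n→∞} (log a_{p^n}^{⊳⊳}(G))/p^n > 0, where a_{p^n}^{⊳⊳}(G) is the number of subnormal subgroups of G of index exactly p^n (this condition is equivalent to the pro-p completion of G having exponential subgroup growth). Then G has an infinite strictly nested sequence of subnormal subgroups, each with index a power of p, with respect to which G has Property (τ). -/
open scoped TensorProduct

/-- mod p homology dimension -/
noncomputable def dp (p : ℕ) (G : Type*) [Group G] : ℕ :=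
  Module.finrank (ZMod p) (ZMod p ⊗[ℤ] Additive (Abelianization G))

def IsSubnormal {G : Type*} [Group G] (H : Subgroup G) : Prop :=
  ∃ (n : ℕ) (c : ℕ → Subgroup G), c 0 = H ∧ c n = ⊤ ∧
    ∀ i < n, c i ≤ c (i + 1) ∧ ∀ g ∈ c (i + 1), ∀ x ∈ c i, g * x * g⁻¹ ∈ c i

def IsFinitelyPresented (G : Type*) [Group G] : Prop :=
  ∃ (n : ℕ) (R : Finset (FreeGroup (Fin n))) (f : FreeGroup (Fin n) →* G),
    Function.Surjective f ∧ f.ker = Subgroup.normalClosure (R : Set (FreeGroup (Fin n)))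

def IsLarge (G : Type*) [Group G] : Prop :=
  ∃ H : Subgroup G, H.FiniteIndex ∧ ∃ f : H →* FreeGroup (Fin 2), Function.Surjective f

def schreierBoundary (G : Type*) [Group G] (S : Set G) (H : Subgroup G)
    (A : Set (G ⧸ H)) : Set (G × (G ⧸ H)) :=
  {e | e.1 ∈ S ∧ ((e.2 ∈ A) ≠ (e.1 • e.2 ∈ A))}

noncomputable def cheeger (G : Type*) [Group G] (S : Set G) (H : Subgroup G) : ℝ :=
  sInf {r : ℝ | ∃ A : Set (G ⧸ H), A.Nonempty ∧
    2 * (Nat.card A : ℝ) ≤ (Nat.card (G ⧸ H) : ℝ) ∧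
    r = (Nat.card (schreierBoundary G S H A) : ℝ) / (Nat.card A : ℝ)}

def PropertyTau (G : Type*) [Group G] {ι : Type*} (Gs : ι → Subgroup G) : Prop :=
  ∃ S : Finset G, Subgroup.closure (S : Set G) = ⊤ ∧
    ∃ ε : ℝ, 0 < ε ∧ ∀ i, ε ≤ cheeger G (S : Set G) (Gs i)

def LinearGrowthModP (p : ℕ) {G : Type*} [Group G] (Gs : ℕ → Subgroup G) : Prop :=
  ∃ c : ℝ, 0 < c ∧ ∀ i, c ≤ (dp p ↥(Gs i) : ℝ) / ((Gs i).index : ℝ)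

/-- `a_m^{⊳⊳}(G)`: the number of subnormal subgroups of `G` of index exactly `m`. -/
noncomputable def subnormalCount (G : Type*) [Group G] (m : ℕ) : ℕ :=
  Nat.card {H : Subgroup G // IsSubnormal H ∧ H.index = m}

namespace Lack

/-! ## Boundaries and expansion in abstract graphs -/

/-- number of boundary edges: the edge `(i, y)` joins `y` and `a i y` -/
noncomputable def bd {ι Y : Type*} (a : ι → Y → Y) (A : Set Y) : ℕ :=
  Set.ncard {e : ι × Y | ¬ (e.2 ∈ A ↔ a e.1 e.2 ∈ A)}

/-- expansion with constant `δ` -/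
def Expand {ι Y : Type*} (a : ι → Y → Y) (δ : ℝ) : Prop :=
  ∀ A : Set Y, 2 * A.ncard ≤ Nat.card Y → δ * A.ncard ≤ bd a A

end Lack

namespace Lack

/-! ## Hilbert space lemmas -/

section Hilbert
variable {E : Type*} [NormedAddCommGroup E] [InnerProductSpace ℝ E]


/-- real inequality used for two almost orthogonal projections -/
theorem almost_orth (a b v : E) (ha : (inner ℝ a v) = (inner ℝ a a)) (hb : (inner ℝ b v) = (inner ℝ b b))
    (hab : |(inner ℝ a b)| ≤ 1 / 16 * (‖a‖ * ‖b‖)) :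
    - (2 / 15) * ((inner ℝ (v - a) (v - a)) + (inner ℝ (v - b) (v - b))) ≤ (inner ℝ (v - a) (v - b)) := by
  have ha' : (inner ℝ v a) = (inner ℝ a a) := by rw [real_inner_comm]; exact ha
  have hb' : (inner ℝ v b) = (inner ℝ b b) := by rw [real_inner_comm]; exact hb
  have hba : (inner ℝ b a) = (inner ℝ a b) := real_inner_comm _ _
  simp only [inner_sub_left, inner_sub_right, ha, hb, ha', hb']
  have hcs : (inner ℝ (a + b) v) * (inner ℝ (a + b) v) ≤ (inner ℝ (a + b) (a + b)) * (inner ℝ v v) := real_inner_mul_inner_self_le _ _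
  simp only [inner_add_left, inner_add_right, ha, hb, hba] at hcs
  set A := (inner ℝ a a) with hA
  set B := (inner ℝ b b) with hB
  set N := (inner ℝ v v) with hN
  set C := (inner ℝ a b) with hC
  have hA0 : 0 ≤ A := real_inner_self_nonneg
  have hB0 : 0 ≤ B := real_inner_self_nonneg
  have hN0 : 0 ≤ N := real_inner_self_nonneg
  have hAB : |C| ≤ 1 / 32 * (A + B) := by
    refine hab.trans ?_
    have h1 : A = ‖a‖ ^ 2 := real_inner_self_eq_norm_sq a
    have h2 : B = ‖b‖ ^ 2 := real_inner_self_eq_norm_sq b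
    rw [h1, h2]
    nlinarith [sq_nonneg (‖a‖ - ‖b‖)]
  have hC1 := abs_le.1 hAB
  have hs : A + B ≤ 17 / 16 * N := by
    by_contra hcon
    push Not at hcon
    have hpos : 0 < A + B := by linarith
    have : (A + B) * (A + B) ≤ (17 / 16 * (A + B)) * N := by
      nlinarith
    nlinarith
  nlinarith

/-- A pair of projections, commuting with a third one `Z`, which commute on the range of `Z` and
are nearly orthogonal on the kernel of `Z`. -/
theorem pair_bound (X Y Z : E →ₗ[ℝ] E)
    (hX : X.IsSymmetric) (hY : Y.IsSymmetric) (hZ : Z.IsSymmetric)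
    (hXX : ∀ v, X (X v) = X v) (hYY : ∀ v, Y (Y v) = Y v) (hZZ : ∀ v, Z (Z v) = Z v)
    (hXZ : ∀ v, X (Z v) = Z (X v)) (hYZ : ∀ v, Y (Z v) = Z (Y v))
    (hcomm : ∀ v, Z v = v → X (Y v) = Y (X v))
    (q : ℝ) (hq : 256 ≤ q)
    (hYXY : ∀ v, Z v = 0 → q • Y (X (Y v)) = Y v) (v : E) :
    - (2 / 15) * ((inner ℝ (v - X v) (v - X v)) + (inner ℝ (v - Y v) (v - Y v))) ≤ (inner ℝ (v - X v) (v - Y v)) := by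
  set v0 := Z v with hv0
  set v1 := v - Z v with hv1
  have hv : v = v0 + v1 := by simp [hv0, hv1]
  have hZ0 : Z v0 = v0 := hZZ v
  have hZ1 : Z v1 = 0 := by simp [hv1, hZZ]
  -- general orthogonality
  have orth : ∀ a b : E, Z a = a → Z b = 0 → (inner ℝ a b) = 0 := by
    intro a b ha hb
    rw [← ha, hZ, hb, inner_zero_right]
  have orth' : ∀ a b : E, Z a = a → Z b = 0 → (inner ℝ b a) = 0 := by
    intro a b ha hb
    rw [real_inner_comm]; exact orth a b ha hb
  have hX0 : Z (v0 - X v0) = v0 - X v0 := by rw [map_sub, ← hXZ, hZ0]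
  have hY0 : Z (v0 - Y v0) = v0 - Y v0 := by rw [map_sub, ← hYZ, hZ0]
  have hX1 : Z (v1 - X v1) = 0 := by rw [map_sub, ← hXZ, hZ1]; simp
  have hY1 : Z (v1 - Y v1) = 0 := by rw [map_sub, ← hYZ, hZ1]; simp
  have eX : v - X v = (v0 - X v0) + (v1 - X v1) := by
    conv_lhs => rw [hv]
    rw [map_add]; abel
  have eY : v - Y v = (v0 - Y v0) + (v1 - Y v1) := by
    conv_lhs => rw [hv]
    rw [map_add]; abel
  rw [eX, eY]
  simp only [inner_add_left, inner_add_right, orth _ _ hX0 hX1, orth _ _ hX0 hY1,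
    orth _ _ hY0 hY1, orth' _ _ hX0 hX1, orth' _ _ hY0 hX1, orth' _ _ hY0 hY1]
  have h0 : 0 ≤ (inner ℝ (v0 - X v0) (v0 - Y v0)) := by
    have hXv : Z (X v0) = X v0 := by rw [← hXZ, hZ0]
    have hYv : Z (Y v0) = Y v0 := by rw [← hYZ, hZ0]
    have : (inner ℝ (v0 - X v0) (v0 - Y v0)) = (inner ℝ (v0 - X v0 - Y v0 + X (Y v0)) (v0 - X v0 - Y v0 + X (Y v0))) := by
      have e1 := hcomm v0 hZ0
      have a1 : (inner ℝ (X v0) (X v0)) = (inner ℝ v0 (X v0)) := by rw [hX, hXX]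
      have a2 : (inner ℝ (Y v0) (Y v0)) = (inner ℝ v0 (Y v0)) := by rw [hY, hYY]
      have a3 : (inner ℝ (X v0) v0) = (inner ℝ v0 (X v0)) := real_inner_comm _ _
      have a4 : (inner ℝ (Y v0) v0) = (inner ℝ v0 (Y v0)) := real_inner_comm _ _
      have b1 : (inner ℝ (X v0) (Y v0)) = (inner ℝ v0 (X (Y v0))) := by rw [hX]
      have b2 : (inner ℝ (Y v0) (X v0)) = (inner ℝ v0 (X (Y v0))) := by rw [hY, ← e1]
      have b3 : (inner ℝ (X (Y v0)) v0) = (inner ℝ v0 (X (Y v0))) := real_inner_comm _ _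
      have b4 : (inner ℝ (X v0) (X (Y v0))) = (inner ℝ v0 (X (Y v0))) := by rw [hX, hXX]
      have b5 : (inner ℝ (X (Y v0)) (X v0)) = (inner ℝ v0 (X (Y v0))) := by rw [real_inner_comm]; exact b4
      have b6 : (inner ℝ (Y v0) (X (Y v0))) = (inner ℝ v0 (X (Y v0))) := by rw [e1, hY, hYY]
      have b7 : (inner ℝ (X (Y v0)) (Y v0)) = (inner ℝ v0 (X (Y v0))) := by rw [real_inner_comm]; exact b6
      have b8 : (inner ℝ (X (Y v0)) (X (Y v0))) = (inner ℝ v0 (X (Y v0))) := by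
        rw [hX, hXX, b6]
      simp only [inner_add_left, inner_add_right, inner_sub_left, inner_sub_right,
        a1, a2, a3, a4, b1, b2, b3, b4, b5, b6, b7, b8]
      ring
    rw [this]; exact real_inner_self_nonneg
  have h1 : - (2 / 15) * ((inner ℝ (v1 - X v1) (v1 - X v1)) + (inner ℝ (v1 - Y v1) (v1 - Y v1)))
      ≤ (inner ℝ (v1 - X v1) (v1 - Y v1)) := by
    apply almost_orth
    · rw [hX, hX, hXX, ← hX, real_inner_comm]
    · rw [hY, hY, hYY, ← hY, real_inner_comm]
    · have e1 : (inner ℝ (X v1) (Y v1)) = (inner ℝ (X v1) (X (Y v1))) := by rw [hX, hX, hXX]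
      have e2 : q * (inner ℝ (X (Y v1)) (X (Y v1))) = (inner ℝ (Y v1) (Y v1)) := by
        have : (inner ℝ (X (Y v1)) (X (Y v1))) = (inner ℝ (Y (X (Y v1))) v1) := by rw [hX, hXX, hY, real_inner_comm]
        rw [this, ← real_inner_smul_left, hYXY v1 hZ1, hY v1 v1, hY v1 (Y v1), hYY]
      rw [real_inner_self_eq_norm_sq, real_inner_self_eq_norm_sq] at e2
      have e3 : ‖X (Y v1)‖ ≤ 1 / 16 * ‖Y v1‖ := by
        apply le_of_sq_le_sq _ (by positivity)
        nlinarith [sq_nonneg ‖X (Y v1)‖]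
      rw [e1]
      calc |(inner ℝ (X v1) (X (Y v1)))| ≤ ‖X v1‖ * ‖X (Y v1)‖ := abs_real_inner_le_norm _ _
        _ ≤ ‖X v1‖ * (1 / 16 * ‖Y v1‖) := by gcongr
        _ = _ := by ring
  have p1 : 0 ≤ (inner ℝ (v0 - X v0) (v0 - X v0)) := real_inner_self_nonneg
  have p2 : 0 ≤ (inner ℝ (v0 - Y v0) (v0 - Y v0)) := real_inner_self_nonneg
  nlinarith

theorem gap_of_sq [FiniteDimensional ℝ E] (T : E →ₗ[ℝ] E) (hT : T.IsSymmetric)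
    (hpos : ∀ v, 0 ≤ (inner ℝ (T v) v)) (κ : ℝ) (hκ : 0 < κ)
    (hsq : ∀ v, κ * (inner ℝ (T v) v) ≤ (inner ℝ (T v) (T v))) (x : E) (hx : ∀ w, T w = 0 → (inner ℝ w x) = 0) :
    κ * (inner ℝ x x) ≤ (inner ℝ (T x) x) := by
  have hmem : x ∈ LinearMap.range T := by
    have h1 : x ∈ (LinearMap.ker T)ᗮ := by
      rw [Submodule.mem_orthogonal]
      intro w hw; exact hx w hw
    rwa [← hT.orthogonal_range, Submodule.orthogonal_orthogonal] at h1
  obtain ⟨y, rfl⟩ := hmem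
  -- Cauchy-Schwarz for the form
  set a := (inner ℝ (T y) y) with ha
  set b := (inner ℝ (T y) (T y)) with hb
  set c := (inner ℝ (T (T y)) (T y)) with hc
  have h1 : κ * a ≤ b := hsq y
  have hb0 : 0 ≤ b := real_inner_self_nonneg
  have hc0 : 0 ≤ c := hpos _
  have hcs : ∀ t : ℝ, 0 ≤ a * t ^ 2 - 2 * b * t + c := by
    intro t
    have := hpos (t • y - T y)
    have e : (inner ℝ (T (t • y - T y)) (t • y - T y)) = a * t ^ 2 - 2 * b * t + c := by
      simp only [map_sub, map_smul, inner_sub_left, inner_sub_right, real_inner_smul_left,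
        real_inner_smul_right]
      rw [hT (T y) y]
      simp only [ha, hb, hc]; ring
    rwa [e] at this
  have := hcs κ
  have := hcs 0
  have h2 := hcs κ
  nlinarith [hcs κ]

end Hilbert
end Lack

namespace Lack

section Avg
variable {E : Type*} [NormedAddCommGroup E] [InnerProductSpace ℝ E]
variable {Γ : Type*} [Group Γ] {K : Type*} [Field K] [Fintype K]


/-- averaging over a one-parameter subgroup -/
noncomputable def avg (ρ : Γ →* Module.End ℝ E) (x : K → Γ) : E →ₗ[ℝ] E :=
  ((Fintype.card K : ℝ)⁻¹) • ∑ a, ρ (x a)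

variable (ρ : Γ →* Module.End ℝ E)

theorem avg_apply (x : K → Γ) (v : E) :
    avg ρ x v = ((Fintype.card K : ℝ)⁻¹) • ∑ a, ρ (x a) v := by
  simp [avg, LinearMap.sum_apply]

theorem card_smul_avg (x : K → Γ) (v : E) :
    (Fintype.card K : ℝ) • avg ρ x v = ∑ a, ρ (x a) v := by
  rw [avg_apply, smul_smul, mul_inv_cancel₀, one_smul]
  exact_mod_cast Fintype.card_ne_zero

theorem add_zero_one {x : K → Γ} (hx : ∀ a b, x (a + b) = x a * x b) : x 0 = 1 := by
  have := hx 0 0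
  simpa using this

theorem add_neg_inv {x : K → Γ} (hx : ∀ a b, x (a + b) = x a * x b) (a : K) :
    x (-a) = (x a)⁻¹ := by
  rw [eq_inv_iff_mul_eq_one, ← hx]; simp [add_zero_one hx]

theorem rho_adj (hρ : ∀ g v w, (inner ℝ (ρ g v) (ρ g w)) = (inner ℝ v w))
    (g : Γ) (v w : E) : (inner ℝ (ρ g v) w) = (inner ℝ v (ρ g⁻¹ w)) := by
  have := hρ g v (ρ g⁻¹ w)
  rw [← this, ← Module.End.mul_apply, ← map_mul]
  simp

theorem avg_symm (hρ : ∀ g v w, (inner ℝ (ρ g v) (ρ g w)) = (inner ℝ v w))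
    {x : K → Γ} (hx : ∀ a b, x (a + b) = x a * x b) : (avg ρ x).IsSymmetric := by
  intro v w
  rw [avg_apply, avg_apply, real_inner_smul_left, real_inner_smul_right, sum_inner, inner_sum]
  congr 1
  rw [← Equiv.sum_comp (Equiv.neg K)]
  refine Finset.sum_congr rfl fun a _ => ?_
  rw [rho_adj ρ hρ]
  simp [add_neg_inv hx]

theorem rho_avg {x : K → Γ} (hx : ∀ a b, x (a + b) = x a * x b) (b : K) (v : E) :
    ρ (x b) (avg ρ x v) = avg ρ x v := by
  rw [avg_apply, map_smul, map_sum]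
  congr 1
  conv_rhs => rw [← Equiv.sum_comp (Equiv.addLeft b)]
  refine Finset.sum_congr rfl fun a _ => ?_
  simp [hx]

theorem avg_fix {x : K → Γ} (v : E) (h : ∀ a, ρ (x a) v = v) : avg ρ x v = v := by
  rw [avg_apply, Finset.sum_congr rfl fun a _ => h a]
  simp only [Finset.sum_const, Finset.card_univ]
  rw [← Nat.cast_smul_eq_nsmul ℝ, smul_smul, inv_mul_cancel₀, one_smul]
  exact_mod_cast Fintype.card_ne_zero

theorem avg_avg {x : K → Γ} (hx : ∀ a b, x (a + b) = x a * x b) (v : E) :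
    avg ρ x (avg ρ x v) = avg ρ x v := avg_fix ρ _ fun a => rho_avg ρ hx a v

theorem avg_comm {x z : K → Γ} (h : ∀ a c, x a * z c = z c * x a) (v : E) :
    avg ρ x (avg ρ z v) = avg ρ z (avg ρ x v) := by
  simp only [avg_apply, map_smul, map_sum, Finset.smul_sum]
  rw [Finset.sum_comm]
  refine Finset.sum_congr rfl fun a _ => Finset.sum_congr rfl fun c _ => ?_
  rw [← Module.End.mul_apply, ← Module.End.mul_apply, ← map_mul, ← map_mul, h]

/-- Heisenberg relations for a pair of root subgroups -/
structure Heis (x y z : K → Γ) : Prop where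
  xadd : ∀ a b, x (a + b) = x a * x b
  yadd : ∀ a b, y (a + b) = y a * y b
  zadd : ∀ a b, z (a + b) = z a * z b
  xz : ∀ a c, x a * z c = z c * x a
  yz : ∀ a c, y a * z c = z c * y a
  xy : ∀ a b, x a * y b = y b * x a * z (a * b)

theorem avg_yxy {x y z : K → Γ} (h : Heis x y z) (v : E) (hv : avg ρ z v = 0) :
    (Fintype.card K : ℝ) • avg ρ y (avg ρ x (avg ρ y v)) = avg ρ y v := by
  classical
  set q : ℝ := (Fintype.card K : ℝ) with hq
  have hq0 : q ≠ 0 := by rw [hq]; exact_mod_cast Fintype.card_ne_zero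
  have hz : ∑ c, ρ (z c) v = 0 := by rw [← card_smul_avg, hv, smul_zero]
  -- fixed `a`
  have key : ∀ a : K, avg ρ y (ρ (x a) (avg ρ y v)) = if a = 0 then avg ρ y v else 0 := by
    intro a
    have h1 : ∀ b : K, avg ρ y (ρ (x a) (ρ (y b) v)) = avg ρ y (ρ (x a) (ρ (z (a * b)) v)) := by
      intro b
      rw [← Module.End.mul_apply (ρ (x a)) (ρ (y b)), ← map_mul, h.xy, mul_assoc, map_mul, Module.End.mul_apply,
        map_mul, Module.End.mul_apply]
      rw [avg_apply, avg_apply]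
      congr 1
      rw [← Equiv.sum_comp (Equiv.addRight (-b))]
      refine Finset.sum_congr rfl fun c _ => ?_
      rw [← Module.End.mul_apply (ρ (y _)) (ρ (y b)), ← map_mul, ← h.yadd]
      simp
    have h2 : avg ρ y (ρ (x a) (avg ρ y v))
        = q⁻¹ • avg ρ y (ρ (x a) (∑ b, ρ (z (a * b)) v)) := by
      rw [avg_apply ρ y v, map_smul, map_smul, map_sum, map_sum, map_sum, map_sum]
      congr 1
      exact Finset.sum_congr rfl fun b _ => h1 b
    rw [h2]
    split_ifs with ha
    · subst ha
      simp only [zero_mul, add_zero_one h.zadd, add_zero_one h.xadd, map_one, Module.End.one_apply,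
        Finset.sum_const, Finset.card_univ]
      rw [← Nat.cast_smul_eq_nsmul ℝ, map_smul, smul_smul, inv_mul_cancel₀ hq0, one_smul]
    · have : ∑ b, ρ (z (a * b)) v = ∑ c, ρ (z c) v :=
        Equiv.sum_comp (Equiv.mulLeft₀ a ha) (fun c => ρ (z c) v)
      rw [this, hz]; simp
  rw [avg_apply ρ x, map_smul, map_sum, smul_smul, mul_inv_cancel₀ hq0, one_smul,
    Finset.sum_congr rfl fun a _ => key a]
  simp

theorem heis_bound (hρ : ∀ g v w, (inner ℝ (ρ g v) (ρ g w)) = (inner ℝ v w))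
    {x y z : K → Γ} (h : Heis x y z) (hK : 256 ≤ Fintype.card K) (v : E) :
    - (2 / 15) * ((inner ℝ (v - avg ρ x v) (v - avg ρ x v)) + (inner ℝ (v - avg ρ y v) (v - avg ρ y v)))
      ≤ (inner ℝ (v - avg ρ x v) (v - avg ρ y v)) := by
  refine pair_bound (avg ρ x) (avg ρ y) (avg ρ z) (avg_symm ρ hρ h.xadd) (avg_symm ρ hρ h.yadd)
    (avg_symm ρ hρ h.zadd) (avg_avg ρ h.xadd) (avg_avg ρ h.yadd) (avg_avg ρ h.zadd)
    (avg_comm ρ h.xz) (avg_comm ρ h.yz) ?_ (Fintype.card K) (by exact_mod_cast hK)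
    (avg_yxy ρ h) v
  intro v hv
  have hv' : ∀ c, ρ (z c) v = v := fun c => by rw [← hv]; exact rho_avg ρ h.zadd c v
  simp only [avg_apply, map_smul, map_sum, Finset.smul_sum]
  rw [Finset.sum_comm]
  refine Finset.sum_congr rfl fun a _ => Finset.sum_congr rfl fun c _ => ?_
  rw [← Module.End.mul_apply, ← Module.End.mul_apply, ← map_mul, ← map_mul, h.xy,
    map_mul ρ (y c * x a), Module.End.mul_apply, hv']

theorem three_gap (hρ : ∀ g v w, (inner ℝ (ρ g v) (ρ g w)) = (inner ℝ v w))
    [FiniteDimensional ℝ E] {x₁ x₂ x₃ z₁ z₂ z₃ : K → Γ}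
    (h1 : Heis x₁ x₂ z₁) (h2 : Heis x₂ x₃ z₂) (h3 : Heis x₃ x₁ z₃) (hK : 256 ≤ Fintype.card K)
    (v : E) (hv : ∀ w, (∀ a, ρ (x₁ a) w = w) → (∀ a, ρ (x₂ a) w = w) → (∀ a, ρ (x₃ a) w = w) →
      (inner ℝ w v) = 0) :
    (7 / 15) * (inner ℝ v v) ≤ (inner ℝ (v - avg ρ x₁ v) v) + (inner ℝ (v - avg ρ x₂ v) v) + (inner ℝ (v - avg ρ x₃ v) v) := by
  set T : E →ₗ[ℝ] E := (LinearMap.id - avg ρ x₁) + (LinearMap.id - avg ρ x₂)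
    + (LinearMap.id - avg ρ x₃) with hTdef
  have hT : ∀ v, T v = (v - avg ρ x₁ v) + (v - avg ρ x₂ v) + (v - avg ρ x₃ v) := by
    intro v; simp [hTdef]
  have s1 := avg_symm ρ hρ h1.xadd
  have s2 := avg_symm ρ hρ h2.xadd
  have s3 := avg_symm ρ hρ h3.xadd
  have hTs : T.IsSymmetric :=
    ((LinearMap.IsSymmetric.id.sub s1).add (LinearMap.IsSymmetric.id.sub s2)).add
      (LinearMap.IsSymmetric.id.sub s3)
  have sq : ∀ (x : K → Γ) (hx : ∀ a b, x (a + b) = x a * x b) (v : E),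
      (inner ℝ (v - avg ρ x v) v) = (inner ℝ (v - avg ρ x v) (v - avg ρ x v)) := by
    intro x hx v
    have : (inner ℝ (avg ρ x v) (avg ρ x v)) = (inner ℝ (avg ρ x v) v) := by
      rw [avg_symm ρ hρ hx v v, avg_symm ρ hρ hx, avg_avg ρ hx]
    have h' : (inner ℝ v (avg ρ x v)) = (inner ℝ (avg ρ x v) v) := real_inner_comm _ _
    simp only [inner_sub_left, inner_sub_right, this, h']; ring
  have hTv : ∀ v, (inner ℝ (T v) v) = (inner ℝ (v - avg ρ x₁ v) (v - avg ρ x₁ v)) + (inner ℝ (v - avg ρ x₂ v) (v - avg ρ x₂ v))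
      + (inner ℝ (v - avg ρ x₃ v) (v - avg ρ x₃ v)) := by
    intro v
    rw [hT, inner_add_left, inner_add_left, sq _ h1.xadd, sq _ h2.xadd, sq _ h3.xadd]
  have main := gap_of_sq T hTs ?_ (7 / 15) (by norm_num) ?_ v ?_
  · rw [hT, inner_add_left, inner_add_left] at main
    exact main
  · intro v
    rw [hTv]
    have := @real_inner_self_nonneg E _ _ (v - avg ρ x₁ v)
    have := @real_inner_self_nonneg E _ _ (v - avg ρ x₂ v)
    have := @real_inner_self_nonneg E _ _ (v - avg ρ x₃ v)
    linarith
  · intro v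
    rw [hTv, hT]
    have b1 := heis_bound ρ hρ h1 hK v
    have b2 := heis_bound ρ hρ h2 hK v
    have b3 := heis_bound ρ hρ h3 hK v
    generalize v - avg ρ x₁ v = y1 at *
    generalize v - avg ρ x₂ v = y2 at *
    generalize v - avg ρ x₃ v = y3 at *
    have c1 : (inner ℝ y2 y1) = (inner ℝ y1 y2) := real_inner_comm _ _
    have c2 : (inner ℝ y3 y2) = (inner ℝ y2 y3) := real_inner_comm _ _
    have c3 : (inner ℝ y1 y3) = (inner ℝ y3 y1) := real_inner_comm _ _
    simp only [inner_add_left, inner_add_right, c1, c2, c3]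
    linarith
  · intro w hw
    have e := hTv w
    rw [hw, inner_zero_left] at e
    have p1 := @real_inner_self_nonneg E _ _ (w - avg ρ x₁ w)
    have p2 := @real_inner_self_nonneg E _ _ (w - avg ρ x₂ w)
    have p3 := @real_inner_self_nonneg E _ _ (w - avg ρ x₃ w)
    have q1 : avg ρ x₁ w = w := by
      have : w - avg ρ x₁ w = 0 := inner_self_eq_zero.1 (le_antisymm (by linarith) p1)
      exact (sub_eq_zero.1 this).symm
    have q2 : avg ρ x₂ w = w := by
      have : w - avg ρ x₂ w = 0 := inner_self_eq_zero.1 (le_antisymm (by linarith) p2)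
      exact (sub_eq_zero.1 this).symm
    have q3 : avg ρ x₃ w = w := by
      have : w - avg ρ x₃ w = 0 := inner_self_eq_zero.1 (le_antisymm (by linarith) p3)
      exact (sub_eq_zero.1 this).symm
    refine hv w (fun a => ?_) (fun a => ?_) (fun a => ?_)
    · rw [← q1]; exact rho_avg ρ h1.xadd a w
    · rw [← q2]; exact rho_avg ρ h2.xadd a w
    · rw [← q3]; exact rho_avg ρ h3.xadd a w

end Avg

section Perm
variable {Γ : Type*} [Group Γ] {Ω : Type*} [Fintype Ω] [MulAction Γ Ω]

/-- permutation representation -/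
noncomputable def permRep : Γ →* Module.End ℝ (EuclideanSpace ℝ Ω) where
  toFun g :=
    { toFun := fun f => WithLp.toLp 2 (fun ω => f (g⁻¹ • ω))
      map_add' := fun f f' => by ext; simp
      map_smul' := fun c f => by ext; simp }
  map_one' := by ext; simp
  map_mul' g h := by ext; simp [mul_smul]

@[simp] theorem permRep_apply (g : Γ) (f : EuclideanSpace ℝ Ω) (ω : Ω) :
    permRep g f ω = f (g⁻¹ • ω) := rfl

theorem permRep_inner (g : Γ) (v w : EuclideanSpace ℝ Ω) :
    inner ℝ (permRep g v) (permRep g w) = inner ℝ v w := by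
  simp only [PiLp.inner_apply, permRep_apply]
  exact Equiv.sum_comp (MulAction.toPerm g⁻¹) (fun ω => inner ℝ (v ω) (w ω))

/-- Expansion of finite transitive actions of groups generated by three root subgroups. -/
theorem expand_of_heis {K : Type*} [Field K] [Fintype K] [MulAction.IsPretransitive Γ Ω]
    {x : Fin 3 → K → Γ} {z₁ z₂ z₃ : K → Γ}
    (h1 : Heis (x 0) (x 1) z₁) (h2 : Heis (x 1) (x 2) z₂) (h3 : Heis (x 2) (x 0) z₃)
    (hK : 256 ≤ Fintype.card K)
    (hgen : Subgroup.closure (Set.range fun i : Fin 3 × K => x i.1 i.2) = ⊤) :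
    Expand (fun (i : Fin 3 × K) (ω : Ω) => x i.1 i.2 • ω) 1 := by
  classical
  intro A hA
  have hxadd : ∀ i a b, x i (a + b) = x i a * x i b := by
    intro i; fin_cases i
    exacts [h1.xadd, h2.xadd, h3.xadd]
  rcases A.eq_empty_or_nonempty with rfl | ⟨ω₀, hω₀⟩
  · simp
  set n : ℝ := (Fintype.card Ω : ℝ) with hn
  have hn0 : 0 < n := by
    have : Nonempty Ω := ⟨ω₀⟩
    rw [hn]; exact_mod_cast Fintype.card_pos
  set α : ℝ := A.ncard / n with hα
  have hα2 : α ≤ 1 / 2 := by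
    rw [hα, div_le_iff₀ hn0]
    have : (2 * A.ncard : ℝ) ≤ n := by rw [hn, ← Nat.card_eq_fintype_card]; exact_mod_cast hA
    linarith
  set f : EuclideanSpace ℝ Ω := WithLp.toLp 2 (fun ω => (if ω ∈ A then (1 : ℝ) else 0) - α) with hf
  have hfω : ∀ ω, f ω = (if ω ∈ A then (1 : ℝ) else 0) - α := fun ω => rfl
  have hsum : ∑ ω, (if ω ∈ A then (1 : ℝ) else 0) = A.ncard := by
    rw [Finset.sum_boole, Set.ncard_eq_toFinset_card']
    congr 2; ext; simp
  have hαn : α * n = A.ncard := by rw [hα]; field_simp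
  have hfsum : ∑ ω, f ω = 0 := by
    simp only [hfω, Finset.sum_sub_distrib, hsum, Finset.sum_const, Finset.card_univ, nsmul_eq_mul]
    rw [← hn]; linarith
  have hff : inner ℝ f f = A.ncard * (1 - α) := by
    simp only [PiLp.inner_apply, hfω]
    have : ∀ ω, inner ℝ ((if ω ∈ A then (1 : ℝ) else 0) - α) ((if ω ∈ A then (1 : ℝ) else 0) - α)
        = (1 - 2 * α) * (if ω ∈ A then (1 : ℝ) else 0) + α ^ 2 := by
      intro ω
      simp only [RCLike.inner_apply, conj_trivial]
      split_ifs <;> ring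
    simp only [this, Finset.sum_add_distrib, ← Finset.mul_sum, hsum, Finset.sum_const,
      Finset.card_univ, nsmul_eq_mul]
    rw [← hn]
    nlinarith
  have gap := three_gap permRep permRep_inner h1 h2 h3 hK f ?_
  · -- compute
    have hq : (Fintype.card K : ℝ) ≠ 0 := by exact_mod_cast Fintype.card_ne_zero
    have comp : ∀ i, inner ℝ (f - avg permRep (x i) f) f = (2 * (Fintype.card K : ℝ))⁻¹ *
        ∑ a, ((Set.ncard {ω : Ω | ¬ (ω ∈ A ↔ x i a • ω ∈ A)} : ℕ) : ℝ) := by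
      intro i
      have e1 : ∀ a, inner ℝ (permRep (x i (-a)) f) f
          = inner ℝ f f - 1 / 2 * ((Set.ncard {ω : Ω | ¬ (ω ∈ A ↔ x i a • ω ∈ A)} : ℕ) : ℝ) := by
        intro a
        have e2 : ((Set.ncard {ω : Ω | ¬ (ω ∈ A ↔ x i a • ω ∈ A)} : ℕ) : ℝ)
            = inner ℝ (permRep (x i (-a)) f - f) (permRep (x i (-a)) f - f) := by
          rw [Set.ncard_eq_toFinset_card', Set.toFinset_ofPred, ← Finset.sum_boole,
            PiLp.inner_apply]
          refine Finset.sum_congr rfl fun ω _ => ?_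
          simp only [PiLp.sub_apply, permRep_apply, add_neg_inv (hxadd i), inv_inv, hfω,
            RCLike.inner_apply, conj_trivial]
          by_cases c1 : ω ∈ A <;> by_cases c2 : x i a • ω ∈ A <;> simp [c1, c2] <;> ring
        rw [e2]
        simp only [inner_sub_left, inner_sub_right, permRep_inner]
        rw [real_inner_comm f]; ring
      rw [inner_sub_left, avg_apply, real_inner_smul_left, sum_inner,
        ← Equiv.sum_comp (Equiv.neg K)]
      simp only [Equiv.neg_apply, e1, Finset.sum_sub_distrib, Finset.sum_const, Finset.card_univ,
        nsmul_eq_mul, ← Finset.mul_sum]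
      field_simp
      ring
    rw [comp, comp, comp, hff] at gap
    have hbd : ((bd (fun (i : Fin 3 × K) (ω : Ω) => x i.1 i.2 • ω) A : ℕ) : ℝ)
        = ∑ i : Fin 3, ∑ a, ((Set.ncard {ω : Ω | ¬ (ω ∈ A ↔ x i a • ω ∈ A)} : ℕ) : ℝ) := by
      rw [bd, Set.ncard_eq_toFinset_card', Set.toFinset_ofPred, ← Finset.sum_boole,
        Fintype.sum_prod_type, Fintype.sum_prod_type]
      refine Finset.sum_congr rfl fun i _ => Finset.sum_congr rfl fun a _ => ?_
      rw [Set.ncard_eq_toFinset_card', Set.toFinset_ofPred, ← Finset.sum_boole]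
    rw [hbd, Fin.sum_univ_three, one_mul]
    set S := (∑ a, ((Set.ncard {ω : Ω | ¬ (ω ∈ A ↔ x 0 a • ω ∈ A)} : ℕ) : ℝ))
      + (∑ a, ((Set.ncard {ω : Ω | ¬ (ω ∈ A ↔ x 1 a • ω ∈ A)} : ℕ) : ℝ))
      + (∑ a, ((Set.ncard {ω : Ω | ¬ (ω ∈ A ↔ x 2 a • ω ∈ A)} : ℕ) : ℝ)) with hS
    rw [← mul_add, ← mul_add, ← hS, inv_mul_eq_div, le_div_iff₀ (by positivity)] at gap
    have hK' : (256 : ℝ) ≤ Fintype.card K := by exact_mod_cast hK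
    have hA0 : (0 : ℝ) ≤ A.ncard := by positivity
    nlinarith [mul_nonneg hA0 (by linarith : (0 : ℝ) ≤ 1 / 2 - α),
      mul_nonneg (mul_nonneg hA0 (by linarith : (0 : ℝ) ≤ 1 / 2 - α))
        (by positivity : (0 : ℝ) ≤ Fintype.card K),
      mul_nonneg hA0 (by linarith : (0 : ℝ) ≤ Fintype.card K - 256)]
  · intro w w1 w2 w3
    have hinv : ∀ g : Γ, permRep g w = w := by
      intro g
      have hg : g ∈ Subgroup.closure (Set.range fun i : Fin 3 × K => x i.1 i.2) := by
        rw [hgen]; trivial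
      induction hg using Subgroup.closure_induction with
      | mem y hy =>
        obtain ⟨⟨i, a⟩, rfl⟩ := hy
        fin_cases i
        exacts [w1 a, w2 a, w3 a]
      | one => simp
      | mul y z _ _ hy hz => rw [map_mul, Module.End.mul_apply, hz, hy]
      | inv y _ hy =>
        conv_lhs => rw [← hy]
        rw [← Module.End.mul_apply, ← map_mul]; simp
    have hconst : ∀ ω, w ω = w ω₀ := by
      intro ω
      obtain ⟨g, hg⟩ := MulAction.exists_smul_eq Γ ω ω₀
      have := congrArg (fun u : EuclideanSpace ℝ Ω => u ω₀) (hinv g)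
      simp only [permRep_apply] at this
      rw [← this, ← hg]; simp
    rw [PiLp.inner_apply]
    simp only [hconst, RCLike.inner_apply, conj_trivial]
    rw [← Finset.sum_mul, hfsum, zero_mul]

end Perm
end Lack

namespace Lack

section Lam
open Matrix Polynomial

variable {R : Type*} [CommRing R]

/-- elementary matrices as elements of the special linear group -/
def el (i j : Fin 3) (h : i ≠ j) (c : R) : Matrix.SpecialLinearGroup (Fin 3) R :=
  ⟨Matrix.transvection i j c, Matrix.det_transvection_of_ne i j h c⟩

theorem el_add (i j : Fin 3) (h : i ≠ j) (a b : R) : el i j h (a + b) = el i j h a * el i j h b :=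
  Subtype.ext (Matrix.transvection_mul_transvection_same i j h a b).symm

theorem el_comm (i j k l : Fin 3) (h : i ≠ j) (h' : k ≠ l) (h1 : j ≠ k) (h2 : l ≠ i) (a b : R) :
    el i j h a * el k l h' b = el k l h' b * el i j h a := by
  apply Subtype.ext
  change transvection i j a * transvection k l b = transvection k l b * transvection i j a
  simp only [transvection, mul_add, add_mul, one_mul, mul_one]
  rw [single_mul_single_of_ne _ _ _ _ h1, single_mul_single_of_ne _ _ _ _ h2]
  abel

theorem el_heis (i j k : Fin 3) (h : i ≠ j) (h' : j ≠ k) (h'' : i ≠ k) (a b : R) :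
    el i j h a * el j k h' b = el j k h' b * el i j h a * el i k h'' (a * b) := by
  apply Subtype.ext
  change transvection i j a * transvection j k b
    = transvection j k b * transvection i j a * transvection i k (a * b)
  simp only [transvection, mul_add, add_mul, one_mul, mul_one]
  rw [single_mul_single_of_ne _ _ _ _ h''.symm, single_mul_single_same]
  rw [zero_mul, single_mul_single_of_ne _ _ _ _ h''.symm, single_mul_single_of_ne _ _ _ _ h.symm]
  abel

theorem el_heis' (i j k : Fin 3) (h : i ≠ j) (h' : j ≠ k) (h'' : i ≠ k) (a b : R) :
    (el j k h' b * el i j h a)⁻¹ * (el i j h a * el j k h' b) = el i k h'' (a * b) := by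
  rw [el_heis i j k h h' h'', inv_mul_cancel_left]

variable {K : Type*} [Field K]

/-- the generators -/
noncomputable def lgen (i : Fin 3) (a : K) : Matrix.SpecialLinearGroup (Fin 3) K[X] :=
  match i with
  | 0 => el 0 1 (by decide) (C a)
  | 1 => el 1 2 (by decide) (C a)
  | 2 => el 2 0 (by decide) (X * C a)

variable (K) in
/-- the group -/
noncomputable def Lam : Subgroup (Matrix.SpecialLinearGroup (Fin 3) K[X]) :=
  Subgroup.closure (Set.range fun i : Fin 3 × K => lgen i.1 i.2)

/-- generators in the subgroup -/
noncomputable def lx (i : Fin 3) (a : K) : Lam K :=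
  ⟨lgen i a, Subgroup.subset_closure ⟨(i, a), rfl⟩⟩

theorem lx_gen : Subgroup.closure (Set.range fun i : Fin 3 × K => lx (K := K) i.1 i.2) = ⊤ := by
  have := Subgroup.closure_closure_coe_preimage
    (k := (Set.range fun i : Fin 3 × K => lgen (K := K) i.1 i.2))
  refine Eq.trans ?_ this
  congr 1
  ext ⟨y, hy⟩
  constructor
  · rintro ⟨i, hi⟩
    exact ⟨i, congrArg Subtype.val hi⟩
  · rintro ⟨i, hi⟩
    exact ⟨i, Subtype.ext hi⟩

theorem lx0 (a : K) :
    (lx 0 a : Matrix.SpecialLinearGroup (Fin 3) K[X]) = el 0 1 (by decide) (C a) := rfl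

theorem lx1 (a : K) :
    (lx 1 a : Matrix.SpecialLinearGroup (Fin 3) K[X]) = el 1 2 (by decide) (C a) := rfl

theorem lx2 (a : K) :
    (lx 2 a : Matrix.SpecialLinearGroup (Fin 3) K[X]) = el 2 0 (by decide) (X * C a) := rfl

/-- commutator -/
noncomputable def lz (i : Fin 3) (a : K) : Lam K :=
  (lx (i + 1) 1 * lx i a)⁻¹ * (lx i a * lx (i + 1) 1)

theorem lz0 (a : K) : (lz 0 a : Matrix.SpecialLinearGroup (Fin 3) K[X]) = el 0 2 (by decide) (C a) := by
  have := el_heis' (R := K[X]) 0 1 2 (by decide) (by decide) (by decide) (C a) (C 1)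
  rw [map_one, mul_one] at this
  rw [← this, ← map_one C]
  rfl

theorem lz1 (a : K) :
    (lz 1 a : Matrix.SpecialLinearGroup (Fin 3) K[X]) = el 1 0 (by decide) (X * C a) := by
  have := el_heis' (R := K[X]) 1 2 0 (by decide) (by decide) (by decide) (C a) (X * C 1)
  rw [show C a * (X * C 1) = X * C a by rw [map_one]; ring] at this
  rw [← this]
  rfl

theorem lz2 (a : K) :
    (lz 2 a : Matrix.SpecialLinearGroup (Fin 3) K[X]) = el 2 1 (by decide) (X * C a) := by
  have := el_heis' (R := K[X]) 2 0 1 (by decide) (by decide) (by decide) (X * C a) (C 1)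
  rw [show X * C a * C 1 = X * C a by rw [map_one]; ring] at this
  rw [← this]
  rfl

theorem lheis0 : Heis (lx (K := K) 0) (lx 1) (lz 0) where
  xadd a b := Subtype.ext (by
    rw [Subgroup.coe_mul, lx0, lx0, lx0, ← el_add, map_add])
  yadd a b := Subtype.ext (by
    rw [Subgroup.coe_mul, lx1, lx1, lx1, ← el_add, map_add])
  zadd a b := Subtype.ext (by
    rw [Subgroup.coe_mul, lz0, lz0, lz0, ← el_add, map_add])
  xz a b := Subtype.ext (by
    rw [Subgroup.coe_mul, Subgroup.coe_mul, lz0]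
    exact el_comm 0 1 0 2 (by decide) (by decide) (by decide) (by decide) _ _)
  yz a b := Subtype.ext (by
    rw [Subgroup.coe_mul, Subgroup.coe_mul, lz0]
    exact el_comm 1 2 0 2 (by decide) (by decide) (by decide) (by decide) _ _)
  xy a b := Subtype.ext (by
    rw [Subgroup.coe_mul, Subgroup.coe_mul, Subgroup.coe_mul, lz0, map_mul]
    exact el_heis 0 1 2 (by decide) (by decide) (by decide) _ _)

theorem lheis1 : Heis (lx (K := K) 1) (lx 2) (lz 1) where
  xadd a b := Subtype.ext (by
    rw [Subgroup.coe_mul, lx1, lx1, lx1, ← el_add, map_add])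
  yadd a b := Subtype.ext (by
    rw [Subgroup.coe_mul, lx2, lx2, lx2, ← el_add, map_add, mul_add])
  zadd a b := Subtype.ext (by
    rw [Subgroup.coe_mul, lz1, lz1, lz1, ← el_add, map_add, mul_add])
  xz a b := Subtype.ext (by
    rw [Subgroup.coe_mul, Subgroup.coe_mul, lz1]
    exact el_comm 1 2 1 0 (by decide) (by decide) (by decide) (by decide) _ _)
  yz a b := Subtype.ext (by
    rw [Subgroup.coe_mul, Subgroup.coe_mul, lz1]
    exact el_comm 2 0 1 0 (by decide) (by decide) (by decide) (by decide) _ _)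
  xy a b := Subtype.ext (by
    rw [Subgroup.coe_mul, Subgroup.coe_mul, Subgroup.coe_mul, lz1, lx1, lx2, map_mul,
      show X * (C a * C b) = C a * (X * C b) by ring]
    exact el_heis 1 2 0 (by decide) (by decide) (by decide) _ _)

theorem lheis2 : Heis (lx (K := K) 2) (lx 0) (lz 2) where
  xadd a b := Subtype.ext (by
    rw [Subgroup.coe_mul, lx2, lx2, lx2, ← el_add, map_add, mul_add])
  yadd a b := Subtype.ext (by
    rw [Subgroup.coe_mul, lx0, lx0, lx0, ← el_add, map_add])
  zadd a b := Subtype.ext (by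
    rw [Subgroup.coe_mul, lz2, lz2, lz2, ← el_add, map_add, mul_add])
  xz a b := Subtype.ext (by
    rw [Subgroup.coe_mul, Subgroup.coe_mul, lz2]
    exact el_comm 2 0 2 1 (by decide) (by decide) (by decide) (by decide) _ _)
  yz a b := Subtype.ext (by
    rw [Subgroup.coe_mul, Subgroup.coe_mul, lz2]
    exact el_comm 0 1 2 1 (by decide) (by decide) (by decide) (by decide) _ _)
  xy a b := Subtype.ext (by
    rw [Subgroup.coe_mul, Subgroup.coe_mul, Subgroup.coe_mul, lz2, lx2, lx0, map_mul, ← mul_assoc]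
    exact el_heis 2 0 1 (by decide) (by decide) (by decide) _ _)

theorem el_pow_mem (m : ℕ) : el 0 1 (by decide) (X ^ m) ∈ Lam K := by
  induction m with
  | zero =>
    have := (lx (K := K) 0 1).2
    rw [lx0, map_one] at this
    rwa [pow_zero]
  | succ m ih =>
    have h1 : el 0 2 (by decide) (X ^ m) ∈ Lam K := by
      have h12 : el 1 2 (by decide) (C 1) ∈ Lam K := (lx (K := K) 1 1).2
      have := el_heis' (R := K[X]) 0 1 2 (by decide) (by decide) (by decide) (X ^ m) (C 1)
      rw [show X ^ m * C 1 = (X ^ m : K[X]) by simp] at this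
      rw [← this]
      exact mul_mem (inv_mem (mul_mem h12 ih)) (mul_mem ih h12)
    have h21 : el 2 1 (by decide) (X * C 1) ∈ Lam K := by
      rw [← lz2]; exact (lz 2 1).2
    have := el_heis' (R := K[X]) 0 2 1 (by decide) (by decide) (by decide) (X ^ m) (X * C 1)
    rw [show X ^ m * (X * C 1) = (X ^ (m + 1) : K[X]) by simp [pow_succ]] at this
    rw [← this]
    exact mul_mem (inv_mem (mul_mem h21 h1)) (mul_mem h1 h21)

/-- reduction mod `X^n` -/
noncomputable def lred (K : Type*) [Field K] (n : ℕ) :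
    Lam K →* Matrix.SpecialLinearGroup (Fin 3) (AdjoinRoot (X ^ n : K[X])) :=
  (Matrix.SpecialLinearGroup.map (AdjoinRoot.mk (X ^ n : K[X]))).comp (Lam K).subtype

/-- congruence subgroups -/
noncomputable def LamN (K : Type*) [Field K] (n : ℕ) : Subgroup (Lam K) := (lred K n).ker

theorem mem_LamN (n : ℕ) (g : Lam K) :
    g ∈ LamN K n ↔ ∀ i j, (X ^ n : K[X]) ∣
      ((g : Matrix.SpecialLinearGroup (Fin 3) K[X]) : Matrix (Fin 3) (Fin 3) K[X]) i j - (1 : Matrix (Fin 3) (Fin 3) K[X]) i j := by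
  rw [LamN, MonoidHom.mem_ker, Matrix.SpecialLinearGroup.ext_iff]
  refine forall_congr' fun i => forall_congr' fun j => ?_
  rw [← AdjoinRoot.mk_eq_mk]
  change AdjoinRoot.mk _ _ = (1 : Matrix (Fin 3) (Fin 3) (AdjoinRoot (X ^ n : K[X]))) i j ↔ _
  rw [Matrix.one_apply, Matrix.one_apply]
  split_ifs <;> simp

theorem LamN_lt (n : ℕ) : LamN K (n + 1) < LamN K n := by
  refine lt_of_le_of_ne ?_ ?_
  · intro g hg
    rw [mem_LamN] at hg ⊢
    exact fun i j => (pow_dvd_pow X n.le_succ).trans (hg i j)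
  · intro h
    have h1 : (⟨_, el_pow_mem n⟩ : Lam K) ∈ LamN K n := by
      rw [mem_LamN]
      intro i j
      change _ ∣ (transvection 0 1 (X ^ n) : Matrix (Fin 3) (Fin 3) K[X]) i j - _
      rw [transvection, Matrix.add_apply, add_sub_cancel_left, Matrix.single_apply]
      split_ifs <;> simp
    rw [← h, mem_LamN] at h1
    have h2 := h1 0 1
    change _ ∣ (transvection 0 1 (X ^ n) : Matrix (Fin 3) (Fin 3) K[X]) 0 1 - _ at h2
    rw [transvection, Matrix.add_apply, add_sub_cancel_left, Matrix.single_apply] at h2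
    simp only [and_self, if_true] at h2
    rw [pow_dvd_pow_iff X_ne_zero not_isUnit_X] at h2
    omega

theorem Lam_tri (g : Matrix.SpecialLinearGroup (Fin 3) K[X]) (hg : g ∈ Lam K) :
    (∀ i j, j < i → ((g : Matrix (Fin 3) (Fin 3) K[X]) i j).coeff 0 = 0) ∧ ∀ i, ((g : Matrix (Fin 3) (Fin 3) K[X]) i i).coeff 0 = 1 := by
  let f : Matrix.SpecialLinearGroup (Fin 3) K[X] →* Matrix.SpecialLinearGroup (Fin 3) K :=
    Matrix.SpecialLinearGroup.map (Polynomial.constantCoeff)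
  have hf : ∀ (g : Matrix.SpecialLinearGroup (Fin 3) K[X]) i j, ((f g : Matrix.SpecialLinearGroup (Fin 3) K) : Matrix (Fin 3) (Fin 3) K) i j = ((g : Matrix (Fin 3) (Fin 3) K[X]) i j).coeff 0 := fun g i j => rfl
  simp only [← hf]
  let U : Subgroup (Matrix.SpecialLinearGroup (Fin 3) K) :=
    { carrier := {g | (g : Matrix (Fin 3) (Fin 3) K) 1 0 = 0 ∧ (g : Matrix (Fin 3) (Fin 3) K) 2 0 = 0 ∧
        (g : Matrix (Fin 3) (Fin 3) K) 2 1 = 0 ∧ (g : Matrix (Fin 3) (Fin 3) K) 0 0 = 1 ∧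
        (g : Matrix (Fin 3) (Fin 3) K) 1 1 = 1 ∧ (g : Matrix (Fin 3) (Fin 3) K) 2 2 = 1}
      one_mem' := by simp
      mul_mem' := by
        rintro a b ⟨a1, a2, a3, a4, a5, a6⟩ ⟨b1, b2, b3, b4, b5, b6⟩
        simp [Matrix.mul_apply, Fin.sum_univ_three, *]
      inv_mem' := by
        rintro a ⟨a1, a2, a3, a4, a5, a6⟩
        simp only [Set.mem_ofPred_eq, Matrix.SpecialLinearGroup.coe_inv, Matrix.adjugate_fin_three]
        simp [*] }
  have hU : Lam K ≤ U.comap f := by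
    rw [Lam, Subgroup.closure_le]
    rintro _ ⟨⟨i, a⟩, rfl⟩
    change f (lgen i a) ∈ U
    fin_cases i
    · change f (el 0 1 (by decide) (C a)) ∈ U
      refine ⟨?_, ?_, ?_, ?_, ?_, ?_⟩ <;> rw [hf] <;>
        simp [el, transvection, Matrix.single_apply, Matrix.one_apply]
    · change f (el 1 2 (by decide) (C a)) ∈ U
      refine ⟨?_, ?_, ?_, ?_, ?_, ?_⟩ <;> rw [hf] <;>
        simp [el, transvection, Matrix.single_apply, Matrix.one_apply]
    · change f (el 2 0 (by decide) (X * C a)) ∈ U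
      refine ⟨?_, ?_, ?_, ?_, ?_, ?_⟩ <;> rw [hf] <;>
        simp [el, transvection, Matrix.single_apply, Matrix.one_apply]
  obtain ⟨a1, a2, a3, a4, a5, a6⟩ := hU hg
  constructor
  · intro i j hij
    fin_cases i <;> fin_cases j <;> first | exact absurd hij (by decide) | assumption
  · intro i
    fin_cases i <;> assumption

theorem Lam_nil (g : Matrix.SpecialLinearGroup (Fin 3) K[X]) (hg : g ∈ Lam K) :
    ∃ M : Matrix (Fin 3) (Fin 3) K[X], ((g : Matrix (Fin 3) (Fin 3) K[X]) - 1) ^ 3 = (X : K[X]) • M := by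
  obtain ⟨h1, h2⟩ := Lam_tri g hg
  have h : ∀ i j, X ∣ (((g : Matrix (Fin 3) (Fin 3) K[X]) - 1) ^ 3 : Matrix (Fin 3) (Fin 3) K[X]) i j := by
    have k : (((g : Matrix (Fin 3) (Fin 3) K[X]) - 1).map (Polynomial.constantCoeff (R := K))) ^ 3 = 0 := by
      have e : ∀ i j, j ≤ i → ((g : Matrix (Fin 3) (Fin 3) K[X]) - 1).map (Polynomial.constantCoeff (R := K)) i j = 0 := by
        intro i j hij
        rw [Matrix.map_apply, Matrix.sub_apply, map_sub]
        rcases hij.lt_or_eq with h | h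
        · rw [Matrix.one_apply_ne h.ne', map_zero, sub_zero]; exact h1 i j h
        · subst h
          rw [Matrix.one_apply_eq, map_one, sub_eq_zero]; exact h2 _
      generalize ((g : Matrix (Fin 3) (Fin 3) K[X]) - 1).map (Polynomial.constantCoeff (R := K)) = N at e
      have e00 := e 0 0 (by decide)
      have e11 := e 1 1 (by decide)
      have e22 := e 2 2 (by decide)
      have e10 := e 1 0 (by decide)
      have e20 := e 2 0 (by decide)
      have e21 := e 2 1 (by decide)
      ext i j
      fin_cases i <;> fin_cases j <;>
        simp [pow_succ, Matrix.mul_apply, Fin.sum_univ_three, *]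
    intro i j
    rw [X_dvd_iff]
    have := congrFun (congrFun k i) j
    rw [← RingHom.mapMatrix_apply, ← map_pow] at this
    exact this
  choose M hM using h
  exact ⟨Matrix.of M, by ext1 i j; rw [hM]; rfl⟩

theorem LamN_pow (p : ℕ) [Fact p.Prime] [CharP K p] (n : ℕ) (g : Lam K) :
    g ^ (p ^ (3 * n)) ∈ LamN K n := by
  obtain ⟨M, hM⟩ := Lam_nil g.1 g.2
  have hle : 3 * n ≤ p ^ (3 * n) := (Nat.lt_pow_self (Fact.out : p.Prime).one_lt).le
  obtain ⟨d, hd⟩ := Nat.exists_eq_add_of_le hle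
  rw [mem_LamN]
  intro i j
  have key : ((g.1 ^ (p ^ (3 * n)) : Matrix.SpecialLinearGroup (Fin 3) K[X]) : Matrix (Fin 3) (Fin 3) K[X]) - 1 = (X ^ n : K[X]) • (M ^ n * ((g.1 : Matrix (Fin 3) (Fin 3) K[X]) - 1) ^ d) := by
    have : ((g.1 ^ (p ^ (3 * n)) : Matrix.SpecialLinearGroup (Fin 3) K[X]) : Matrix (Fin 3) (Fin 3) K[X]) = (((g.1 : Matrix (Fin 3) (Fin 3) K[X]) - 1) + 1) ^ (p ^ (3 * n)) := by simp
    rw [this, add_pow_char_pow_of_commute _ _ (Commute.one_right _), one_pow,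
      add_sub_cancel_right, hd, pow_add, pow_mul, hM, _root_.smul_pow, smul_mul_assoc]
  have := congrFun (congrFun key i) j
  rw [Matrix.sub_apply] at this
  rw [SubmonoidClass.coe_pow, this]
  exact Dvd.intro _ rfl

theorem LamN_finite [Finite K] (n : ℕ) : Finite (Lam K ⧸ LamN K n) := by
  have : Module.Finite K (AdjoinRoot (X ^ n : K[X])) := (monic_X_pow n).finite_adjoinRoot
  have : Finite (AdjoinRoot (X ^ n : K[X])) := Module.finite_of_finite K
  have : Finite (Matrix.SpecialLinearGroup (Fin 3) (AdjoinRoot (X ^ n : K[X]))) :=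
    Subtype.finite
  exact Finite.of_equiv _ (QuotientGroup.quotientKerEquivRange (lred K n)).toEquiv.symm

end Lam

/-- A finitely generated group with an infinite chain of normal subgroups of `p`-power index
and uniform expansion. -/
theorem exists_tau_group (p : ℕ) [hp : Fact p.Prime] :
    ∃ (L : Type) (_ : Group L) (ι : Type) (_ : Finite ι) (s : ι → L) (N : ℕ → Subgroup L),
      Subgroup.closure (Set.range s) = ⊤ ∧ (∀ n, (N n).Normal) ∧ (∀ n, N (n + 1) < N n) ∧
      (∀ n, ∃ k, (N n).index = p ^ k) ∧
      ∀ n, Expand (fun (i : ι) (y : L ⧸ N n) => s i • y) 1 := by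
  classical
  let K := GaloisField p 8
  have : Finite K := inferInstance
  have : Fintype K := Fintype.ofFinite K
  have hcard : 256 ≤ Fintype.card K := by
    rw [← Nat.card_eq_fintype_card, GaloisField.card p 8 (by norm_num)]
    calc 256 = 2 ^ 8 := by norm_num
      _ ≤ p ^ 8 := Nat.pow_le_pow_left hp.out.two_le 8
  have hN : ∀ n, (LamN K n).Normal := fun n => by unfold LamN; infer_instance
  refine ⟨Lam K, inferInstance, Fin 3 × K, inferInstance, fun i => lx i.1 i.2, LamN K,
    lx_gen, hN, LamN_lt, fun n => ?_, fun n => ?_⟩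
  · have := hN n
    have := LamN_finite (K := K) n
    have hP : IsPGroup p (Lam K ⧸ LamN K n) := by
      intro g
      refine ⟨3 * n, ?_⟩
      induction g using QuotientGroup.induction_on with
      | H g =>
        rw [← QuotientGroup.mk_pow, QuotientGroup.eq_one_iff]
        exact LamN_pow p n g
    exact IsPGroup.iff_card.1 hP
  · have := LamN_finite (K := K) n
    have : Fintype (Lam K ⧸ LamN K n) := Fintype.ofFinite _
    exact expand_of_heis lheis0 lheis1 lheis2 hcard lx_gen

end Lack

namespace Lack

theorem ncard_sigma {α β : Type*} [Fintype α] [Finite β] (S : Set (α × β)) :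
    S.ncard = ∑ a, {b | (a, b) ∈ S}.ncard := by
  rw [← Nat.card_coe_set_eq]
  simp only [← Nat.card_coe_set_eq]
  rw [← Nat.card_sigma]
  exact Nat.card_congr
    { toFun := fun x => ⟨x.1.1, ⟨x.1.2, x.2⟩⟩
      invFun := fun x => ⟨(x.1, x.2.1), x.2.2⟩
      left_inv := fun _ => rfl
      right_inv := fun _ => rfl }

/-- number of points moved across `A` by `f` -/
noncomputable def mv {Y : Type*} (f : Y → Y) (A : Set Y) : ℕ :=
  Set.ncard {y | ¬ (y ∈ A ↔ f y ∈ A)}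

theorem bd_eq_sum {ι Y : Type*} [Fintype ι] [Finite Y] (a : ι → Y → Y) (A : Set Y) :
    bd a A = ∑ i, mv (a i) A := by
  rw [bd, ncard_sigma]; rfl

theorem bd_compl {ι Y : Type*} (a : ι → Y → Y) (A : Set Y) : bd a Aᶜ = bd a A := by
  unfold bd; congr 1; ext e; simp only [Set.mem_ofPred_eq, Set.mem_compl_iff]; tauto

section
variable {G : Type*} [Group G] {Y : Type*} [MulAction G Y] [Finite Y]

theorem mv_mul (g h : G) (A : Set Y) :
    mv (fun y => (g * h) • y) A ≤ mv (fun y => g • y) A + mv (fun y => h • y) A := by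
  unfold mv
  have h1 : {y : Y | ¬ (h • y ∈ A ↔ g • h • y ∈ A)}.ncard
      = {y : Y | ¬ (y ∈ A ↔ g • y ∈ A)}.ncard :=
    Set.ncard_preimage_of_injective_subset_range (f := fun y : Y => h • y)
      (s := {y : Y | ¬ (y ∈ A ↔ g • y ∈ A)}) (MulAction.injective h) (by rw [(MulAction.surjective h).range_eq]; exact Set.subset_univ _)
  rw [← h1]
  refine le_trans (Set.ncard_le_ncard ?_ (Set.toFinite _)) (Set.ncard_union_le _ _)
  intro y hy
  simp only [Set.mem_ofPred_eq, Set.mem_union, mul_smul] at *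
  tauto

theorem mv_inv (g : G) (A : Set Y) :
    mv (fun y => g⁻¹ • y) A = mv (fun y => g • y) A := by
  unfold mv
  have h1 : {y : Y | ¬ (g • y ∈ A ↔ g⁻¹ • g • y ∈ A)}.ncard
      = {y : Y | ¬ (y ∈ A ↔ g⁻¹ • y ∈ A)}.ncard :=
    Set.ncard_preimage_of_injective_subset_range (f := fun y : Y => g • y)
      (s := {y : Y | ¬ (y ∈ A ↔ g⁻¹ • y ∈ A)}) (MulAction.injective g) (by rw [(MulAction.surjective g).range_eq]; exact Set.subset_univ _)
  rw [← h1]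
  congr 1
  ext y
  simp only [inv_smul_smul, Set.mem_ofPred_eq]
  tauto
end

/-- word lemma -/
theorem word {G : Type*} [Group G] {ι : Type*} [Finite ι] (s : ι → G)
    (hs : Subgroup.closure (Set.range s) = ⊤) (g : G) :
    ∃ W : ℕ, ∀ (H : Subgroup G) [Finite (G ⧸ H)] (A : Set (G ⧸ H)),
      mv (fun y : G ⧸ H => g • y) A ≤ W * bd (fun i (y : G ⧸ H) => s i • y) A := by
  have := Fintype.ofFinite ι
  have hg : g ∈ Subgroup.closure (Set.range s) := by rw [hs]; trivial
  induction hg using Subgroup.closure_induction with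
  | mem x hx =>
    obtain ⟨i, rfl⟩ := hx
    refine ⟨1, fun H _ A => ?_⟩
    rw [bd_eq_sum, one_mul]
    exact Finset.single_le_sum (f := fun i => mv (fun y : G ⧸ H => s i • y) A)
      (fun _ _ => Nat.zero_le _) (Finset.mem_univ i)
  | one => exact ⟨0, fun H _ A => by simp [mv]⟩
  | mul x y _ _ hx hy =>
    obtain ⟨a, ha⟩ := hx
    obtain ⟨b, hb⟩ := hy
    refine ⟨a + b, fun H _ A => ?_⟩
    rw [add_mul]
    exact (mv_mul x y A).trans (add_le_add (ha H A) (hb H A))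
  | inv x _ hx =>
    obtain ⟨a, ha⟩ := hx
    exact ⟨a, fun H _ A => by rw [mv_inv]; exact ha H A⟩

theorem word_fin {G : Type*} [Group G] {ι : Type*} [Finite ι] (s : ι → G)
    (hs : Subgroup.closure (Set.range s) = ⊤) {κ : Type*} [Finite κ] (g : κ → G) :
    ∃ W : ℕ, ∀ (j : κ) (H : Subgroup G) [Finite (G ⧸ H)] (A : Set (G ⧸ H)),
      mv (fun y : G ⧸ H => g j • y) A ≤ W * bd (fun i (y : G ⧸ H) => s i • y) A := by
  have := Fintype.ofFinite κ
  choose W hW using fun j => word s hs (g j)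
  refine ⟨∑ j, W j, fun j H _ A => (hW j H A).trans (Nat.mul_le_mul_right _ ?_)⟩
  exact Finset.single_le_sum (f := W) (fun _ _ => Nat.zero_le _) (Finset.mem_univ j)

theorem tau_of_expand {G : Type*} [Group G] {ι : Type*} [Finite ι] (s : ι → G)
    (hs : Subgroup.closure (Set.range s) = ⊤) (Gs : ℕ → Subgroup G)
    (hfin : ∀ i, Finite (G ⧸ Gs i)) (hne : ∀ i, Gs i ≠ ⊤) (δ : ℝ) (hδ : 0 < δ)
    (h : ∀ n, Expand (fun i (y : G ⧸ Gs n) => s i • y) δ) : PropertyTau G Gs := by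
  classical
  have hS : (Set.range s).Finite := Set.finite_range s
  refine ⟨hS.toFinset, by simpa using hs, δ / (Nat.card ι + 1), by positivity, fun n => ?_⟩
  have := hfin n
  rw [cheeger]
  apply le_csInf
  · refine ⟨_, {QuotientGroup.mk 1}, Set.singleton_nonempty _, ?_, rfl⟩
    rw [Nat.card_coe_set_eq, Set.ncard_singleton]
    have : 1 < Nat.card (G ⧸ Gs n) := by
      have h1 : Nat.card (G ⧸ Gs n) ≠ 1 := fun h => hne n (Subgroup.index_eq_one.1 h)
      have h0 : 0 < Nat.card (G ⧸ Gs n) := Nat.card_pos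
      omega
    have : (2 : ℝ) ≤ Nat.card (G ⧸ Gs n) := by exact_mod_cast this
    push_cast; linarith
  · rintro r ⟨A, hA, hA2, rfl⟩
    simp only [Nat.card_coe_set_eq] at *
    have hApos : 0 < A.ncard := (Set.ncard_pos).2 hA
    have hApos' : (0 : ℝ) < A.ncard := by exact_mod_cast hApos
    have hE := h n A (by exact_mod_cast hA2)
    have hb : bd (fun i (y : G ⧸ Gs n) => s i • y) A
        ≤ Nat.card ι * (schreierBoundary G (hS.toFinset : Set G) (Gs n) A).ncard := by
      have hfinite : (schreierBoundary G (hS.toFinset : Set G) (Gs n) A).Finite := by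
        refine Set.Finite.subset (s := (hS.toFinset : Set G) ×ˢ Set.univ)
          (Set.Finite.prod (Finset.finite_toSet _) Set.finite_univ) ?_
        intro e he
        exact ⟨he.1, trivial⟩
      have := hfinite.to_subtype
      rw [bd, ← Nat.card_coe_set_eq, ← Nat.card_coe_set_eq, ← Nat.card_prod]
      refine Nat.card_le_card_of_injective
        (fun e => (e.1.1, ⟨(s e.1.1, e.1.2), ⟨by simp, fun hh => e.2 (iff_of_eq hh)⟩⟩)) ?_
      rintro ⟨⟨i, y⟩, hi⟩ ⟨⟨j, z⟩, hj⟩ heq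
      have e1 := congrArg Prod.fst heq
      have e2 := congrArg (fun z => z.2.1.2) heq
      simp only at e1 e2
      subst e1 e2
      rfl
    rw [div_le_div_iff₀ (by positivity) hApos']
    have hb' : ((bd (fun i (y : G ⧸ Gs n) => s i • y) A : ℕ) : ℝ)
        ≤ Nat.card ι * (schreierBoundary G (hS.toFinset : Set G) (Gs n) A).ncard := by
      exact_mod_cast hb
    have : (0 : ℝ) ≤ (schreierBoundary G (hS.toFinset : Set G) (Gs n) A).ncard := by positivity
    linarith

/-- transfer of expansion from a quotient of a finite index subgroup -/
theorem transfer {G : Type*} [Group G] {ι : Type*} [Finite ι] (s : ι → G)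
    (hs : Subgroup.closure (Set.range s) = ⊤) (H' : Subgroup G) [Finite (G ⧸ H')]
    {L : Type*} [Group L] (ψ : H' →* L) (hψ : Function.Surjective ψ)
    {κ : Type*} [Finite κ] (t : κ → L) (N : ℕ → Subgroup L) (hfin : ∀ n, Finite (L ⧸ N n))
    (hE : ∀ n, Expand (fun i (y : L ⧸ N n) => t i • y) 1) :
    ∃ δ : ℝ, 0 < δ ∧ ∀ n, Finite (G ⧸ ((N n).comap ψ).map H'.subtype) ∧
      Expand (fun i (y : G ⧸ ((N n).comap ψ).map H'.subtype) => s i • y) δ := by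
  classical
  have := Fintype.ofFinite κ
  have := Fintype.ofFinite (G ⧸ H')
  choose hl hhl using hψ
  obtain ⟨W₁, hW₁⟩ := word_fin s hs (κ := (G ⧸ H') × κ)
    (fun j => j.1.out * (hl (t j.2) : G) * (j.1.out)⁻¹)
  obtain ⟨W₂, hW₂⟩ := word_fin s hs (κ := (G ⧸ H') × (G ⧸ H'))
    (fun j => j.1.out * (j.2.out)⁻¹)
  set m := Fintype.card (G ⧸ H') with hm
  set C : ℕ := Fintype.card κ * W₁ with hC
  refine ⟨((m * (C + W₂) + 1 : ℕ) : ℝ)⁻¹, by positivity, fun n => ?_⟩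
  have := hfin n
  set Hn := ((N n).comap ψ).map H'.subtype with hHn
  have memHn : ∀ h : H', (h : G) ∈ Hn ↔ ψ h ∈ N n := by
    intro h
    rw [hHn, Subgroup.mem_map]
    constructor
    · rintro ⟨x, hx, hxh⟩
      have : x = h := Subtype.ext hxh
      rw [← this]; exact hx
    · intro hh; exact ⟨h, hh, rfl⟩
  have hHnle : Hn ≤ H' := by
    rw [hHn]; rintro _ ⟨x, _, rfl⟩; exact x.2
  let j0 : L ⧸ N n → G ⧸ Hn := fun x => QuotientGroup.mk (hl x.out : G)
  have hj0 : ∀ h : H', j0 (QuotientGroup.mk (ψ h)) = QuotientGroup.mk (h : G) := by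
    intro h
    have : ((hl (QuotientGroup.mk (s := N n) (ψ h)).out)⁻¹ * h : H').1 ∈ Hn := by
      rw [memHn, map_mul, map_inv, hhl, ← QuotientGroup.eq]
      exact Quotient.out_eq _
    exact QuotientGroup.eq.2 this
  have hj0s : ∀ (h : H') (x : L ⧸ N n), j0 (ψ h • x) = (h : G) • j0 x := by
    intro h x
    induction x using QuotientGroup.induction_on with
    | H l =>
      rw [← hhl l, hj0]
      have := hj0 (h * hl l)
      rw [map_mul] at this
      exact this
  let e : (G ⧸ H') × (L ⧸ N n) → G ⧸ Hn := fun x => x.1.out • j0 x.2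
  have einj : Function.Injective e := by
    rintro ⟨a, x⟩ ⟨b, y⟩ hab
    obtain ⟨l, rfl⟩ := QuotientGroup.mk_surjective x
    obtain ⟨l', rfl⟩ := QuotientGroup.mk_surjective y
    rw [← hhl l, ← hhl l'] at hab ⊢
    simp only [e, hj0] at hab
    have h1 : (a.out * (hl l : G))⁻¹ * (b.out * (hl l' : G)) ∈ Hn := QuotientGroup.eq.1 hab
    have h2 : a = b := by
      have h3 : (a.out)⁻¹ * b.out ∈ H' := by
        have := H'.mul_mem (H'.mul_mem (hl l).2 (hHnle h1)) (H'.inv_mem (hl l').2)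
        convert this using 1
        group
      have := QuotientGroup.eq.2 h3
      rwa [QuotientGroup.out_eq', QuotientGroup.out_eq'] at this
    subst h2
    have h4 : ((hl l)⁻¹ * hl l' : H').1 ∈ Hn := by
      convert h1 using 1
      simp [mul_assoc]
    rw [memHn, map_mul, map_inv] at h4
    rw [QuotientGroup.eq.2 h4]
  have esurj : Function.Surjective e := by
    intro y
    obtain ⟨g, rfl⟩ := QuotientGroup.mk_surjective y
    have hh : ((QuotientGroup.mk (s := H') g).out)⁻¹ * g ∈ H' := by
      rw [← QuotientGroup.eq]; exact Quotient.out_eq _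
    refine ⟨(QuotientGroup.mk g, QuotientGroup.mk (ψ ⟨_, hh⟩)), ?_⟩
    simp only [e, hj0]
    change QuotientGroup.mk _ = _
    congr 1
    simp
  have hfinG : Finite (G ⧸ Hn) := Finite.of_surjective e esurj
  refine ⟨hfinG, ?_⟩
  intro B hB
  set x := bd (fun i (y : G ⧸ Hn) => s i • y) B with hx
  let Bj : (G ⧸ H') → Set (L ⧸ N n) := fun j => {y | e (j, y) ∈ B}
  have hcardB : B.ncard = ∑ j, (Bj j).ncard := by
    rw [← Set.ncard_preimage_of_injective_subset_range (f := e) einj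
      (by rw [esurj.range_eq]; exact Set.subset_univ _), ncard_sigma]
    rfl
  have hcardG : Nat.card (G ⧸ Hn) = m * Nat.card (L ⧸ N n) := by
    rw [← Nat.card_congr (Equiv.ofBijective e ⟨einj, esurj⟩), Nat.card_prod,
      Nat.card_eq_fintype_card]
  -- boundary of slices
  have hbdj : ∀ j, bd (fun i (y : L ⧸ N n) => t i • y) (Bj j) ≤ C * x := by
    intro j
    rw [bd_eq_sum]
    calc ∑ i, mv (fun y : L ⧸ N n => t i • y) (Bj j) ≤ ∑ i : κ, W₁ * x := by
          refine Finset.sum_le_sum fun i _ => le_trans ?_ (hW₁ (j, i) Hn B)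
          rw [mv, mv]
          refine Set.ncard_le_ncard_of_injOn (fun y => e (j, y)) ?_ ?_ (Set.toFinite _)
          · intro y hy
            simp only [Set.mem_ofPred_eq, Bj, e] at hy ⊢
            rw [← hhl (t i), hj0s] at hy
            rwa [mul_smul, mul_smul, inv_smul_smul]
          · intro y _ z _ hyz
            simpa using einj hyz
      _ = C * x := by simp [hC, mul_assoc]
  have hsymm : ∀ j l, (Bj j).ncard ≤ (Bj l).ncard + W₂ * x := by
    intro j l
    have h1 : (Bj j \ Bj l).ncard ≤ W₂ * x := by
      refine le_trans ?_ (hW₂ (l, j) Hn B)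
      rw [mv]
      refine Set.ncard_le_ncard_of_injOn (fun y => e (j, y)) ?_ ?_ (Set.toFinite _)
      · rintro y ⟨hy1, hy2⟩
        simp only [Set.mem_ofPred_eq, Bj, e] at hy1 hy2 ⊢
        rw [mul_smul, inv_smul_smul]
        tauto
      · intro y _ z _ hyz
        simpa using einj hyz
    have h2 : (Bj j).ncard ≤ (Bj j \ Bj l ∪ Bj l).ncard := by
      apply Set.ncard_le_ncard _ (Set.toFinite _)
      intro y hy
      by_cases h : y ∈ Bj l
      · exact Or.inr h
      · exact Or.inl ⟨hy, h⟩
    have h3 := Set.ncard_union_le (Bj j \ Bj l) (Bj l)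
    omega
  have hdich : ∀ j, (Bj j).ncard ≤ C * x ∨ Nat.card (L ⧸ N n) ≤ (Bj j).ncard + C * x := by
    intro j
    have hc := Set.ncard_add_ncard_compl (Bj j)
    by_cases h : 2 * (Bj j).ncard ≤ Nat.card (L ⧸ N n)
    · left
      have := hE n _ h
      rw [one_mul] at this
      exact (by exact_mod_cast this : (Bj j).ncard ≤ _).trans (hbdj j)
    · right
      have := hE n (Bj j)ᶜ (by omega)
      rw [one_mul, bd_compl] at this
      have := (by exact_mod_cast this : (Bj j)ᶜ.ncard ≤ _).trans (hbdj j)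
      omega
  have final : B.ncard ≤ m * (C + W₂) * x := by
    by_cases hall : ∀ j, (Bj j).ncard ≤ C * x
    · rw [hcardB]
      calc ∑ j, (Bj j).ncard ≤ ∑ j : G ⧸ H', C * x := Finset.sum_le_sum fun j _ => hall j
        _ = m * (C * x) := by simp [hm]
        _ ≤ _ := by
          rw [mul_assoc m]
          exact Nat.mul_le_mul_left _ (Nat.mul_le_mul_right _ (Nat.le_add_right _ _))
    · push Not at hall
      obtain ⟨j, hj⟩ := hall
      have hj' := (hdich j).resolve_left (by omega)
      have h1 : ∀ l, Nat.card (L ⧸ N n) ≤ (Bj l).ncard + (C + W₂) * x := by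
        intro l
        have := hsymm j l
        rw [add_mul]; omega
      have h2 : m * Nat.card (L ⧸ N n) ≤ B.ncard + m * ((C + W₂) * x) := by
        rw [hcardB]
        calc m * Nat.card (L ⧸ N n) = ∑ l : G ⧸ H', Nat.card (L ⧸ N n) := by simp [hm]
          _ ≤ ∑ l, ((Bj l).ncard + (C + W₂) * x) := Finset.sum_le_sum fun l _ => h1 l
          _ = _ := by rw [Finset.sum_add_distrib]; simp [hm]
      rw [← hcardG] at h2
      rw [mul_assoc]
      omega
  rw [inv_mul_le_iff₀ (by positivity)]
  have : B.ncard ≤ (m * (C + W₂) + 1) * x := final.trans (Nat.mul_le_mul_right _ (by omega))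
  exact_mod_cast this

end Lack

namespace Lack

section
variable {G : Type*} [Group G]

/-- `H` is normal of index `p` in `K` -/
def Step (p : ℕ) (K H : Subgroup G) : Prop :=
  H ≤ K ∧ H.relIndex K = p ∧ ∀ g ∈ K, ∀ x ∈ H, g * x * g⁻¹ ∈ H

/-- iterated steps -/
def PS (p : ℕ) : Subgroup G → Subgroup G → Prop := Relation.ReflTransGen (Step p)

/-- mod `p` first cohomology rank -/
noncomputable def D (p : ℕ) (H : Subgroup G) [Fact p.Prime] : ℕ :=
  Module.finrank (ZMod p) (Additive H →+ ZMod p)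

variable {p : ℕ}

theorem PS.le {K H : Subgroup G} (h : PS p K H) : H ≤ K := by
  induction h with
  | refl => exact le_rfl
  | tail _ h ih => exact h.1.trans ih

theorem PS.relIndex {K H : Subgroup G} (h : PS p K H) : ∃ k, H.relIndex K = p ^ k := by
  induction h with
  | refl => exact ⟨0, by simp⟩
  | @tail M H hKM hMH ih =>
    obtain ⟨k, hk⟩ := ih
    refine ⟨k + 1, ?_⟩
    rw [← Subgroup.relIndex_mul_relIndex H M K hMH.1 (PS.le hKM), hk, hMH.2.1, pow_succ, mul_comm]

theorem PS.index {H : Subgroup G} (h : PS p ⊤ H) : ∃ k, H.index = p ^ k := by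
  obtain ⟨k, hk⟩ := h.relIndex
  exact ⟨k, by rw [← hk, Subgroup.relIndex_top_right]⟩

theorem PS.subnormal {H : Subgroup G} (h : PS p ⊤ H) : IsSubnormal H := by
  induction h with
  | refl => exact ⟨0, fun _ => ⊤, rfl, rfl, fun i hi => absurd hi (Nat.not_lt_zero i)⟩
  | @tail M H hKM hMH ih =>
    obtain ⟨n, c, h0, hn, hc⟩ := ih
    refine ⟨n + 1, fun i => Nat.casesOn i H c, rfl, hn, ?_⟩
    intro i hi
    cases i with
    | zero =>
      change H ≤ c 0 ∧ ∀ g ∈ c 0, _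
      rw [h0]; exact ⟨hMH.1, hMH.2.2⟩
    | succ i => exact hc i (by omega)

theorem PS_of_normal [hp : Fact p.Prime] (n : ℕ) : ∀ (K H : Subgroup G), H ≤ K →
    (∀ g ∈ K, ∀ x ∈ H, g * x * g⁻¹ ∈ H) → H.relIndex K = p ^ n → PS p K H := by
  induction n with
  | zero =>
    intro K H hle _ hidx
    rw [pow_zero, Subgroup.relIndex_eq_one] at hidx
    rw [le_antisymm hle hidx]
    exact Relation.ReflTransGen.refl
  | succ n ih =>
    intro K H hle hnorm hidx
    have hN : (H.subgroupOf K).Normal := by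
      refine ⟨fun x hx g => ?_⟩
      exact hnorm g g.2 x hx
    have hcard : Nat.card (K ⧸ H.subgroupOf K) = p ^ (n + 1) := hidx
    have hfin : Finite (K ⧸ H.subgroupOf K) :=
      Nat.finite_of_card_ne_zero (by rw [hcard]; exact pow_ne_zero _ hp.out.ne_zero)
    obtain ⟨Q, hQ⟩ := Sylow.exists_subgroup_card_pow_prime (G := K ⧸ H.subgroupOf K) p (n := n)
      (by rw [hcard]; exact pow_dvd_pow p n.le_succ)
    have hQi : Q.index = p := by
      have := Q.card_mul_index
      rw [hQ, hcard, pow_succ] at this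
      exact Nat.eq_of_mul_eq_mul_left (pow_pos hp.out.pos n) this
    have hQn : Q.Normal := by
      apply Subgroup.normal_of_index_eq_minFac_card
      rw [hQi, hcard, Nat.pow_minFac (by omega), hp.out.minFac_eq]
    set M' : Subgroup K := Q.comap (QuotientGroup.mk' (H.subgroupOf K)) with hM'
    have hM'i : M'.index = p := by
      rw [hM', Subgroup.index_comap_of_surjective _ (QuotientGroup.mk'_surjective _), hQi]
    have hM'n : M'.Normal := hQn.comap _
    set M : Subgroup G := M'.map K.subtype with hM
    have hmem : ∀ x : K, (x : G) ∈ M ↔ x ∈ M' := by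
      intro x
      rw [hM, Subgroup.mem_map]
      constructor
      · rintro ⟨y, hy, hyx⟩
        have : y = x := Subtype.ext hyx
        rwa [← this]
      · intro h; exact ⟨x, h, rfl⟩
    have hMK : M ≤ K := by rintro _ ⟨x, _, rfl⟩; exact x.2
    have hHM : H ≤ M := by
      intro x hx
      rw [hmem ⟨x, hle hx⟩, hM', Subgroup.mem_comap]
      have : QuotientGroup.mk' (H.subgroupOf K) ⟨x, hle hx⟩ = 1 :=
        (QuotientGroup.eq_one_iff _).2 hx
      rw [this]; exact Q.one_mem
    have hMi : M.relIndex K = p := by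
      rw [← hM'i, Subgroup.relIndex]
      congr 1
      ext x
      exact hmem x
    have hstep : Step p K M := by
      refine ⟨hMK, hMi, fun g hg x hx => ?_⟩
      have hx' := (hmem ⟨x, hMK hx⟩).1 hx
      exact (hmem (⟨g, hg⟩ * ⟨x, hMK hx⟩ * ⟨g, hg⟩⁻¹)).2 (hM'n.conj_mem _ hx' ⟨g, hg⟩)
    refine Relation.ReflTransGen.head hstep (ih M H hHM (fun g hg => hnorm g (hMK hg)) ?_)
    have := Subgroup.relIndex_mul_relIndex H M K hHM hMK
    rw [hMi, hidx, pow_succ] at this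
    exact Nat.eq_of_mul_eq_mul_right hp.out.pos this

theorem PS_of_subnormal [hp : Fact p.Prime] {H : Subgroup G} (h : IsSubnormal H) {k : ℕ}
    (hk : H.index = p ^ k) : PS p ⊤ H := by
  obtain ⟨n, c, h0, hn, hc⟩ := h
  have hmono : ∀ i ≤ n, H ≤ c i := by
    intro i
    induction i with
    | zero => intro _; rw [h0]
    | succ i ih => intro hi; exact (ih (by omega)).trans (hc i (by omega)).1
  have key : ∀ j ≤ n, PS p ⊤ (c (n - j)) := by
    intro j
    induction j with
    | zero => intro _; rw [Nat.sub_zero, hn]; exact Relation.ReflTransGen.refl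
    | succ j ih =>
      intro hj
      have hi := hc (n - (j + 1)) (by omega)
      rw [show n - (j + 1) + 1 = n - j by omega] at hi
      have h1 : (c (n - (j + 1))).relIndex (c (n - j)) ∣ p ^ k := by
        rw [← hk]
        exact (Dvd.intro _ (Subgroup.relIndex_mul_index hi.1)).trans
          (Subgroup.index_dvd_of_le (hmono _ (by omega)))
      obtain ⟨m, _, hm⟩ := (Nat.dvd_prime_pow hp.out).1 h1
      exact Relation.ReflTransGen.trans (ih (by omega)) (PS_of_normal m _ _ hi.1 hi.2 hm)
  have := key n le_rfl
  rwa [Nat.sub_self, h0] at this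

theorem finite_hom (p : ℕ) [Fact p.Prime] (K : Type*) [Group K] [hK : Group.FG K] :
    Finite (Additive K →+ ZMod p) := by
  obtain ⟨S, hS, hfin⟩ := Group.fg_iff.1 hK
  have := hfin.to_subtype
  refine Finite.of_injective (fun f : Additive K →+ ZMod p => fun s : S => f (Additive.ofMul s.1)) ?_
  intro f g hfg
  apply AddMonoidHom.toMultiplicativeRight.injective
  refine MonoidHom.eq_of_eqOn_dense hS fun x hx => ?_
  exact congrFun hfg ⟨x, hx⟩

theorem finite_of_PS [hp : Fact p.Prime] {H : Subgroup G} (h : PS p ⊤ H) : H.FiniteIndex := by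
  obtain ⟨k, hk⟩ := h.index
  exact ⟨by rw [hk]; exact pow_ne_zero _ hp.out.ne_zero⟩

theorem card_hom [hp : Fact p.Prime] (K : Subgroup G) [Group.FG K] :
    Nat.card (Additive K →+ ZMod p) = p ^ D p K := by
  have := finite_hom p K
  rw [D, Module.natCard_eq_pow_finrank (K := ZMod p), Nat.card_zmod]

theorem Step.hom [hp : Fact p.Prime] {K H : Subgroup G} (h : Step p K H) :
    ∃ f : Additive K →+ ZMod p, ∀ x : K, f (Additive.ofMul x) = 0 ↔ (x : G) ∈ H := by
  have hN : (H.subgroupOf K).Normal := ⟨fun x hx g => h.2.2 g g.2 x hx⟩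
  have e : (K ⧸ H.subgroupOf K) ≃* Multiplicative (ZMod p) :=
    mulEquivOfPrimeCardEq (p := p) h.2.1 (Nat.card_zmod p)
  let φ : K →* Multiplicative (ZMod p) := e.toMonoidHom.comp (QuotientGroup.mk' (H.subgroupOf K))
  refine ⟨AddMonoidHom.toMultiplicativeRight.symm φ, fun x => ?_⟩
  have : AddMonoidHom.toMultiplicativeRight.symm φ (Additive.ofMul x) = 0 ↔ φ x = 1 := Iff.rfl
  rw [this]
  change e (QuotientGroup.mk x) = 1 ↔ _
  rw [map_eq_one_iff e e.injective, QuotientGroup.eq_one_iff]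
  exact Subgroup.mem_subgroupOf

/-- subnormal subgroups of index `p^n` -/
abbrev XX (G : Type*) [Group G] (p n : ℕ) := {H : Subgroup G // IsSubnormal H ∧ H.index = p ^ n}

theorem XX_step [hp : Fact p.Prime] {n : ℕ} (H : XX G p (n + 1)) :
    ∃ K : XX G p n, Step p K.1 H.1 := by
  have h1 := PS_of_subnormal H.2.1 H.2.2
  rcases Relation.ReflTransGen.cases_tail h1 with h | ⟨K, hK, hs⟩
  · have h2 := H.2.2
    rw [h, Subgroup.index_top] at h2
    exact absurd h2.symm (Nat.one_lt_pow (by omega) hp.out.one_lt).ne'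
  · refine ⟨⟨K, PS.subnormal hK, ?_⟩, hs⟩
    have := Subgroup.relIndex_mul_index hs.1
    rw [hs.2.1, H.2.2, pow_succ, mul_comm] at this
    exact Nat.eq_of_mul_eq_mul_right hp.out.pos this

theorem XX_fg [hp : Fact p.Prime] [Group.FG G] {n : ℕ} (K : XX G p n) : Group.FG K.1 := by
  have := finite_of_PS (PS_of_subnormal K.2.1 K.2.2)
  infer_instance

theorem XX_inj [hp : Fact p.Prime] (n : ℕ) :
    ∃ F : XX G p (n + 1) → (Σ K : XX G p n, (Additive K.1 →+ ZMod p)), Function.Injective F := by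
  choose K hK using fun H : XX G p (n + 1) => XX_step H
  choose f hf using fun H => (hK H).hom
  refine ⟨fun H => ⟨K H, f H⟩, ?_⟩
  intro H H' heq
  apply Subtype.ext
  have : ∀ (a b : Σ K : XX G p n, (Additive K.1 →+ ZMod p)), a = b → ∀ x : G,
      (∃ h : x ∈ a.1.1, a.2 (Additive.ofMul ⟨x, h⟩) = 0) →
      (∃ h : x ∈ b.1.1, b.2 (Additive.ofMul ⟨x, h⟩) = 0) := by
    rintro a _ rfl x h; exact h
  have key : ∀ (H : XX G p (n + 1)) (x : G),
      (∃ h : x ∈ (K H).1, f H (Additive.ofMul ⟨x, h⟩) = 0) ↔ x ∈ H.1 := by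
    intro H x
    constructor
    · rintro ⟨h, h'⟩; exact (hf H ⟨x, h⟩).1 h'
    · intro h; exact ⟨(hK H).1 h, (hf H ⟨x, _⟩).2 h⟩
  ext x
  rw [← key H, ← key H']
  exact ⟨this _ _ heq x, this _ _ heq.symm x⟩

theorem XX_finite [hp : Fact p.Prime] [Group.FG G] (n : ℕ) : Finite (XX G p n) := by
  induction n with
  | zero =>
    have : Subsingleton (XX G p 0) := by
      refine ⟨fun a b => Subtype.ext ?_⟩
      have ha := Subgroup.index_eq_one.1 (a.2.2.trans (pow_zero p))
      have hb := Subgroup.index_eq_one.1 (b.2.2.trans (pow_zero p))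
      rw [ha, hb]
    infer_instance
  | succ n ih =>
    obtain ⟨F, hF⟩ := XX_inj (G := G) (p := p) n
    have : ∀ K : XX G p n, Finite (Additive K.1 →+ ZMod p) := fun K =>
      have := XX_fg K
      finite_hom p K.1
    exact Finite.of_injective F hF

theorem XX_card_le [hp : Fact p.Prime] [Group.FG G] (n : ℕ) (d : ℝ)
    (hd : ∀ K : XX G p n, (D p K.1 : ℝ) ≤ d) :
    (Nat.card (XX G p (n + 1)) : ℝ) ≤ Nat.card (XX G p n) * (p : ℝ) ^ d := by
  have := XX_finite (G := G) (p := p) n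
  have := Fintype.ofFinite (XX G p n)
  have hfin : ∀ K : XX G p n, Finite (Additive K.1 →+ ZMod p) := fun K =>
    have := XX_fg K
    finite_hom p K.1
  obtain ⟨F, hF⟩ := XX_inj (G := G) (p := p) n
  have h1 := Nat.card_le_card_of_injective F hF
  rw [Nat.card_sigma] at h1
  have h2 : ((∑ K : XX G p n, Nat.card (Additive K.1 →+ ZMod p) : ℕ) : ℝ)
      ≤ Nat.card (XX G p n) * (p : ℝ) ^ d := by
    push_cast
    calc ∑ K : XX G p n, (Nat.card (Additive K.1 →+ ZMod p) : ℝ)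
        ≤ ∑ K : XX G p n, (p : ℝ) ^ d := by
          refine Finset.sum_le_sum fun K _ => ?_
          have := XX_fg K
          rw [card_hom, Nat.cast_pow, ← Real.rpow_natCast]
          exact Real.rpow_le_rpow_of_exponent_le (by exact_mod_cast hp.out.one_lt.le) (hd K)
      _ = _ := by simp
  exact le_trans (by exact_mod_cast h1) h2

theorem growth [hp : Fact p.Prime] [Group.FG G]
    (h : 0 < Filter.limsup
      (fun n : ℕ => Real.log (subnormalCount G (p ^ n)) / (p : ℝ) ^ n) Filter.atTop) :
    ∃ c : ℝ, 0 < c ∧ ∀ N : ℕ, ∃ H : Subgroup G, PS p ⊤ H ∧ N ≤ H.index ∧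
      c * H.index ≤ D p H := by
  set L := Filter.limsup
      (fun n : ℕ => Real.log (subnormalCount G (p ^ n)) / (p : ℝ) ^ n) Filter.atTop with hL
  have hp1 : (1 : ℝ) < p := by exact_mod_cast hp.out.one_lt
  have hp2 : (2 : ℝ) ≤ p := by exact_mod_cast hp.out.two_le
  have hlog : 0 < Real.log p := Real.log_pos hp1
  refine ⟨L / (4 * Real.log p), by positivity, ?_⟩
  by_contra hcon
  push Not at hcon
  obtain ⟨N, hN⟩ := hcon
  have hD : ∀ n, N ≤ n → ∀ K : XX G p n, (D p K.1 : ℝ) ≤ L / (4 * Real.log p) * (p : ℝ) ^ n := by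
    intro n hn K
    have := hN K.1 (PS_of_subnormal K.2.1 K.2.2)
      (by rw [K.2.2]; exact hn.trans (Nat.lt_pow_self hp.out.one_lt).le)
    rw [K.2.2] at this
    push_cast at this
    exact this.le
  set a : ℕ → ℝ := fun n => Real.log (Nat.card (XX G p n)) with ha
  have ha0 : ∀ n, 0 ≤ a n := fun n => Real.log_natCast_nonneg _
  have hstep : ∀ n, N ≤ n → a (n + 1) ≤ a n + L / 4 * (p : ℝ) ^ n := by
    intro n hn
    have h1 := XX_card_le n _ (hD n hn)
    have hpos : 0 ≤ L / 4 * (p : ℝ) ^ n := by positivity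
    rcases Nat.eq_zero_or_pos (Nat.card (XX G p (n + 1))) with h0 | h0
    · have : a (n + 1) = 0 := by simp [ha, h0]
      rw [this]
      linarith [ha0 n]
    · have h0' : (0 : ℝ) < Nat.card (XX G p (n + 1)) := by exact_mod_cast h0
      have h2 : (Nat.card (XX G p n) : ℝ) ≠ 0 := by
        intro hz
        rw [hz, zero_mul] at h1
        linarith
      have h3 := Real.log_le_log h0' h1
      rw [Real.log_mul h2 (by positivity), Real.log_rpow (by linarith)] at h3
      refine h3.trans (le_of_eq ?_)
      simp only [ha]
      field_simp
  have hbound : ∀ m, a (N + m) ≤ a N + L / 4 * (p : ℝ) ^ (N + m) := by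
    intro m
    induction m with
    | zero => simp only [add_zero]; have : 0 ≤ L / 4 * (p : ℝ) ^ N := by positivity
              linarith
    | succ m ih =>
      have h1 := hstep (N + m) (by omega)
      rw [← add_assoc, pow_succ]
      have h2 : 0 ≤ L / 4 * (p : ℝ) ^ (N + m) := by positivity
      nlinarith
  have hlim : L ≤ L / 2 := by
    rw [hL]
    refine Filter.limsup_le_of_le ?_ ?_
    · refine Filter.IsBoundedUnder.isCoboundedUnder_le ⟨0,
        Filter.eventually_map.2 (Filter.Eventually.of_forall fun n => ?_)⟩
      change (0 : ℝ) ≤ _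
      exact div_nonneg (Real.log_natCast_nonneg _) (by positivity)
    · rw [← hL]
      have ht : Filter.Tendsto (fun n : ℕ => a N / (p : ℝ) ^ n) Filter.atTop (nhds 0) :=
        tendsto_const_nhds.div_atTop (tendsto_pow_atTop_atTop_of_one_lt hp1)
      filter_upwards [Filter.eventually_ge_atTop N,
        ht.eventually (gt_mem_nhds (by positivity : 0 < L / 4))] with n hn hn'
      obtain ⟨m, rfl⟩ := Nat.exists_eq_add_of_le hn
      have hpp : (0 : ℝ) < (p : ℝ) ^ (N + m) := by positivity
      have h1 := hbound m
      rw [div_lt_iff₀ hpp] at hn'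
      rw [div_le_iff₀ hpp]
      change a (N + m) ≤ _
      linarith
  linarith

/-- the property propagated along the chain -/
def Good (p : ℕ) [Fact p.Prime] (c : ℝ) (K : Subgroup G) : Prop :=
  ∀ N : ℕ, ∃ H : Subgroup G, PS p K H ∧ N ≤ H.index ∧ c * H.index ≤ D p H

theorem finite_steps [hp : Fact p.Prime] (K : Subgroup G) [Group.FG K] :
    {H : Subgroup G | Step p K H}.Finite := by
  have := finite_hom p K
  choose f hf using fun H : {H : Subgroup G | Step p K H} => Step.hom H.2
  have : Finite {H : Subgroup G | Step p K H} := by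
    refine Finite.of_injective f ?_
    intro H H' heq
    apply Subtype.ext
    ext x
    constructor
    · intro hx
      have := (hf H ⟨x, H.2.1 hx⟩).2 hx
      rw [heq] at this
      exact (hf H' _).1 this
    · intro hx
      have := (hf H' ⟨x, H'.2.1 hx⟩).2 hx
      rw [← heq] at this
      exact (hf H _).1 this
  exact Set.toFinite _

theorem Good.next [hp : Fact p.Prime] [Group.FG G] {c : ℝ} {K : Subgroup G} (hK : PS p ⊤ K)
    (h : Good p c K) : ∃ K', Step p K K' ∧ Good p c K' := by
  have := finite_of_PS hK
  by_contra hcon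
  push Not at hcon
  have hcon' : ∀ K', Step p K K' → ∃ N : ℕ, ∀ H : Subgroup G, PS p K' H → N ≤ H.index →
      (D p H : ℝ) < c * H.index := by
    intro K' hK'
    have := hcon K' hK'
    unfold Good at this
    push Not at this
    exact this
  choose! N hN using hcon'
  have hfin := finite_steps (p := p) K
  obtain ⟨B, hB⟩ := (hfin.image N).bddAbove
  obtain ⟨H, hH, hHi, hHD⟩ := h (max B (K.index + 1))
  rcases Relation.ReflTransGen.cases_head hH with heq | ⟨K', hs, hr⟩
  · rw [← heq] at hHi
    have := le_max_right B (K.index + 1)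
    omega
  · have h1 : N K' ≤ B := hB ⟨K', hs, rfl⟩
    have h2 := hN K' hs H hr (h1.trans ((le_max_left _ _).trans hHi))
    linarith

theorem chain [hp : Fact p.Prime] [Group.FG G] {c : ℝ} (h : Good (G := G) p c ⊤) :
    ∃ K : ℕ → Subgroup G, K 0 = ⊤ ∧ ∀ i, PS p ⊤ (K i) ∧ Good p c (K i) ∧ Step p (K i) (K (i + 1)) := by
  choose! f hf hf' using fun (K : Subgroup G) (hK : PS p ⊤ K) (h : Good p c K) => Good.next hK h
  let K : ℕ → Subgroup G := fun i => Nat.rec ⊤ (fun _ K => f K) i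
  have hK : ∀ i, PS p ⊤ (K i) ∧ Good p c (K i) := by
    intro i
    induction i with
    | zero => exact ⟨Relation.ReflTransGen.refl, h⟩
    | succ i ih => exact ⟨Relation.ReflTransGen.tail ih.1 (hf _ ih.1 ih.2), hf' _ ih.1 ih.2⟩
  exact ⟨K, rfl, fun i => ⟨(hK i).1, (hK i).2, hf _ (hK i).1 (hK i).2⟩⟩

end
end Lack

namespace Lack

theorem ncard_preimage_fiber {X Y : Type*} [Finite X] [Finite Y] (π : Y → X) (m : ℕ)
    (hm : ∀ x, {y | π y = x}.ncard = m) (B : Set X) : (π ⁻¹' B).ncard = m * B.ncard := by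
  classical
  have := Fintype.ofFinite X
  have := Fintype.ofFinite Y
  rw [Set.ncard_eq_toFinset_card' (π ⁻¹' B), Set.ncard_eq_toFinset_card' B,
    Finset.card_eq_sum_card_fiberwise (f := π) (t := B.toFinset)]
  · rw [mul_comm, ← smul_eq_mul, ← Finset.sum_const]
    refine Finset.sum_congr rfl fun x hx => ?_
    rw [← hm x, Set.ncard_eq_toFinset_card']
    congr 1
    ext y
    simp only [Set.mem_toFinset] at hx
    simp only [Finset.mem_filter, Set.mem_toFinset, Set.mem_preimage, Set.mem_ofPred_eq]
    constructor
    · exact fun h => h.2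
    · rintro rfl; exact ⟨hx, rfl⟩
  · intro y hy
    simpa using hy

theorem ncard_fiber_le {X Y : Type*} [Finite X] [Finite Y] (π : Y → X) (S : Set Y) (B : Set X)
    (t : ℝ) (ht : ∀ x ∈ B, ({y | π y = x ∧ y ∈ S}.ncard : ℝ) ≤ t) (hS : ∀ y ∈ S, π y ∈ B) :
    (S.ncard : ℝ) ≤ t * B.ncard := by
  classical
  have := Fintype.ofFinite X
  have := Fintype.ofFinite Y
  rw [Set.ncard_eq_toFinset_card' S, Set.ncard_eq_toFinset_card' B,
    Finset.card_eq_sum_card_fiberwise (f := π) (t := B.toFinset)]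
  · push_cast
    rw [mul_comm, ← nsmul_eq_mul, ← Finset.sum_const]
    refine Finset.sum_le_sum fun x hx => ?_
    refine le_trans (le_of_eq ?_) (ht x (by simpa using hx))
    rw [Set.ncard_eq_toFinset_card']
    congr 2
    ext y
    simp [and_comm]
  · intro y hy
    simpa using hS y (by simpa using hy)

theorem fiber_prod {ι X Y : Type*} (π : Y → X) (m : ℕ)
    (hm : ∀ x, {y | π y = x}.ncard = m) (e : ι × X) :
    {f : ι × Y | (f.1, π f.2) = e}.ncard = m := by
  obtain ⟨i, x⟩ := e
  rw [← hm x, ← Set.ncard_image_of_injective (f := fun y : Y => (i, y)) {y | π y = x}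
    (fun _ _ h => by simpa using h)]
  congr 1
  ext ⟨j, y⟩
  simp only [Prod.mk.injEq, Set.mem_ofPred_eq, Set.mem_image]
  constructor
  · rintro ⟨rfl, rfl⟩; exact ⟨y, rfl, rfl, rfl⟩
  · rintro ⟨y', rfl, rfl, rfl⟩; exact ⟨rfl, rfl⟩

theorem bd_submod {ι Y : Type*} [Finite ι] [Finite Y] (a : ι → Y → Y) (A B : Set Y) :
    bd a (A ∪ B) + bd a (A ∩ B) ≤ bd a A + bd a B := by
  unfold bd
  rw [← Set.ncard_union_add_ncard_inter _ _ (Set.toFinite _) (Set.toFinite _),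
    ← Set.ncard_union_add_ncard_inter {e : ι × Y | ¬ (e.2 ∈ A ↔ a e.1 e.2 ∈ A)} _
      (Set.toFinite _) (Set.toFinite _)]
  refine add_le_add (Set.ncard_le_ncard ?_ (Set.toFinite _))
    (Set.ncard_le_ncard ?_ (Set.toFinite _))
  · intro e he
    simp only [Set.mem_union, Set.mem_inter_iff, Set.mem_ofPred_eq] at *
    tauto
  · intro e he
    simp only [Set.mem_union, Set.mem_inter_iff, Set.mem_ofPred_eq] at *
    tauto

theorem bd_image {ι Y : Type*} (a : ι → Y → Y) (d : Equiv.Perm Y)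
    (hd : ∀ i y, d (a i y) = a i (d y)) (A : Set Y) : bd a (d '' A) = bd a A := by
  unfold bd
  rw [← Set.ncard_image_of_injective (f := fun e : ι × Y => (e.1, d e.2))
    {e | ¬ (e.2 ∈ A ↔ a e.1 e.2 ∈ A)} (fun e f h => by
      simp only [Prod.mk.injEq, EmbeddingLike.apply_eq_iff_eq] at h
      exact Prod.ext h.1 h.2)]
  congr 1
  ext ⟨i, y⟩
  simp only [Set.mem_ofPred_eq, Set.mem_image]
  constructor
  · intro h
    refine ⟨(i, d.symm y), ?_, by simp⟩
    intro h'
    apply h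
    have e1 : (∃ x ∈ A, d x = y) ↔ d.symm y ∈ A :=
      ⟨by rintro ⟨x, hx, rfl⟩; simpa using hx, fun h => ⟨_, h, by simp⟩⟩
    have e2 : (∃ x ∈ A, d x = a i y) ↔ a i (d.symm y) ∈ A := by
      have : d (a i (d.symm y)) = a i y := by rw [hd]; simp
      constructor
      · rintro ⟨x, hx, hx'⟩
        rw [← this] at hx'
        rwa [← d.injective hx']
      · intro h; exact ⟨_, h, this⟩
    rw [e1, e2]; exact h'
  · rintro ⟨⟨j, z⟩, hz, h⟩
    simp only [Prod.mk.injEq] at h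
    obtain ⟨rfl, rfl⟩ := h
    intro h'
    apply hz
    simp only [EmbeddingLike.apply_eq_iff_eq, exists_eq_right, ← hd] at h'
    exact h'

theorem drop_abs {ι X Y : Type*} [Finite ι] [Finite X] [Finite Y] (a : ι → Y → Y) (b : ι → X → X)
    (π : Y → X) (hπ : ∀ i y, π (a i y) = b i (π y)) (m : ℕ) (hm0 : 0 < m)
    (hm : ∀ x, {y | π y = x}.ncard = m) (Δ : Set (Equiv.Perm Y))
    (hΔ : ∀ d ∈ Δ, ∀ i y, d (a i y) = a i (d y))
    (htr : ∀ y y', π y = π y' → ∃ d ∈ Δ, d y = y') (δ : ℝ) (hX : Expand b δ)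
    (hY : ¬ Expand a δ) :
    ∃ A : Set Y, Nat.card Y ≤ 4 * A.ncard ∧ 2 * A.ncard ≤ Nat.card Y ∧
      (bd a A : ℝ) < δ * A.ncard := by
  unfold Expand at hY
  push Not at hY
  obtain ⟨A₀, hA₀, hA₀'⟩ := hY
  let F : Set Y → ℝ := fun A => bd a A - δ * A.ncard
  let S : Set (Set Y) := {A | 2 * A.ncard ≤ Nat.card Y}
  have hSf : S.Finite := Set.toFinite _
  obtain ⟨A₁, hA₁S, hA₁⟩ := Set.exists_min_image S F hSf ⟨A₀, hA₀⟩
  let T : Set (Set Y) := {A | A ∈ S ∧ F A = F A₁}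
  obtain ⟨A, ⟨hAS, hAF⟩, hAmax⟩ := Set.exists_max_image T (fun A => A.ncard) (Set.toFinite _)
    ⟨A₁, hA₁S, rfl⟩
  have hmin : ∀ B ∈ S, F A ≤ F B := fun B hB => hAF ▸ hA₁ B hB
  have hneg : F A < 0 := lt_of_le_of_lt (hmin A₀ hA₀) (by simp only [F]; linarith)
  by_cases h4 : Nat.card Y ≤ 4 * A.ncard
  · exact ⟨A, h4, hAS, by simp only [F] at hneg; linarith⟩
  exfalso
  push Not at h4
  have hinv : ∀ d ∈ Δ, d '' A ⊆ A := by
    intro d hd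
    have hc : (d '' A).ncard = A.ncard := Set.ncard_image_of_injective _ d.injective
    have hui := Set.ncard_union_add_ncard_inter A (d '' A) (Set.toFinite _) (Set.toFinite _)
    have hsub := bd_submod a A (d '' A)
    rw [bd_image a d (hΔ d hd)] at hsub
    have hF : F (A ∪ d '' A) + F (A ∩ d '' A) ≤ 2 * F A := by
      simp only [F]
      have h1 : ((A ∪ d '' A).ncard : ℝ) + (A ∩ d '' A).ncard = 2 * A.ncard := by
        have : (A ∪ d '' A).ncard + (A ∩ d '' A).ncard = 2 * A.ncard := by omega
        exact_mod_cast this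
      have h2 : (bd a (A ∪ d '' A) : ℝ) + bd a (A ∩ d '' A) ≤ 2 * bd a A := by
        have : bd a (A ∪ d '' A) + bd a (A ∩ d '' A) ≤ 2 * bd a A := by omega
        exact_mod_cast this
      linear_combination h2 - δ * h1
    have hUS : A ∪ d '' A ∈ S := by
      change 2 * (A ∪ d '' A).ncard ≤ Nat.card Y
      omega
    have hIS : A ∩ d '' A ∈ S := by
      change 2 * (A ∩ d '' A).ncard ≤ Nat.card Y
      have : (A ∩ d '' A).ncard ≤ A.ncard :=
        Set.ncard_le_ncard Set.inter_subset_left (Set.toFinite _)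
      omega
    have hU : A ∪ d '' A ∈ T := by
      refine ⟨hUS, ?_⟩
      have := hmin _ hUS
      have := hmin _ hIS
      rw [← hAF]; linarith
    have h5 := hAmax _ hU
    have h6 : A = A ∪ d '' A :=
      Set.eq_of_subset_of_ncard_le Set.subset_union_left h5 (Set.toFinite _)
    intro z hz
    have h7 : z ∈ A ∪ d '' A := Or.inr hz
    rwa [← h6] at h7
  have hlift : A = π ⁻¹' (π '' A) := by
    apply Set.Subset.antisymm (Set.subset_preimage_image π A)
    rintro y ⟨z, hz, hzy⟩
    obtain ⟨d, hd, rfl⟩ := htr z y hzy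
    exact hinv d hd ⟨z, hz, rfl⟩
  set B := π '' A with hB
  have hAc : A.ncard = m * B.ncard := by rw [hlift]; exact ncard_preimage_fiber π m hm B
  have hYc : Nat.card Y = m * Nat.card X := by
    have := ncard_preimage_fiber π m hm Set.univ
    rwa [Set.preimage_univ, Set.ncard_univ, Set.ncard_univ] at this
  have hbd : bd a A = m * bd b B := by
    unfold bd
    rw [← ncard_preimage_fiber (fun e : ι × Y => (e.1, π e.2)) m (fiber_prod π m hm)]
    congr 1
    ext ⟨i, y⟩
    rw [hlift]
    simp only [Set.mem_preimage, hπ, Set.mem_ofPred_eq]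
  have hBX : 2 * B.ncard ≤ Nat.card X := by
    have h7 : 2 * A.ncard ≤ Nat.card Y := hAS
    rw [hAc, hYc] at h7
    nlinarith
  have h8 := hX B hBX
  simp only [F, hbd, hAc] at hneg
  push_cast at hneg
  have : (0 : ℝ) < m := by exact_mod_cast hm0
  nlinarith

section
variable {G : Type*} [Group G] {ι : Type*}

/-- projection -/
def proj {H K : Subgroup G} (h : H ≤ K) : G ⧸ H → G ⧸ K := Subgroup.quotientMapOfLE h

theorem proj_mk {H K : Subgroup G} (h : H ≤ K) (g : G) :
    proj h (QuotientGroup.mk g) = QuotientGroup.mk g := rfl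

theorem proj_smul {H K : Subgroup G} (h : H ≤ K) (g : G) (y : G ⧸ H) :
    proj h (g • y) = g • proj h y := by
  induction y using QuotientGroup.induction_on with
  | H x => rfl

theorem proj_surj {H K : Subgroup G} (h : H ≤ K) : Function.Surjective (proj h) := by
  intro y
  induction y using QuotientGroup.induction_on with
  | H x => exact ⟨QuotientGroup.mk x, rfl⟩

theorem proj_fiber {H K : Subgroup G} [Finite (G ⧸ H)] (h : H ≤ K) :
    ∃ m, 0 < m ∧ ∀ x, {y | proj h y = x}.ncard = m := by
  refine ⟨{y | proj h y = QuotientGroup.mk 1}.ncard, ?_, ?_⟩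
  · rw [Set.ncard_pos]
    exact ⟨QuotientGroup.mk 1, rfl⟩
  · intro x
    induction x using QuotientGroup.induction_on with
    | H g =>
      rw [← Set.ncard_image_of_injective (f := fun y : G ⧸ H => g • y)
        {y | proj h y = QuotientGroup.mk 1} (MulAction.injective g)]
      congr 1
      ext y
      simp only [Set.mem_ofPred_eq, Set.mem_image]
      constructor
      · intro hy
        refine ⟨g⁻¹ • y, ?_, by simp⟩
        rw [proj_smul, hy]
        change QuotientGroup.mk (g⁻¹ * g) = _
        simp
      · rintro ⟨z, hz, rfl⟩
        rw [proj_smul, hz]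
        change QuotientGroup.mk (g * 1) = _
        simp

/-- deck transformations -/
def deck {H K : Subgroup G} (hn : ∀ g ∈ K, ∀ x ∈ H, g * x * g⁻¹ ∈ H) (k : K) : G ⧸ H → G ⧸ H :=
  Quotient.map' (fun g => g * k) (by
    intro a b hab
    rw [QuotientGroup.leftRel_apply] at hab ⊢
    have := hn (k : G)⁻¹ (K.inv_mem k.2) _ hab
    convert this using 1
    group)

theorem deck_mk {H K : Subgroup G} (hn : ∀ g ∈ K, ∀ x ∈ H, g * x * g⁻¹ ∈ H) (k : K) (g : G) :
    deck hn k (QuotientGroup.mk g) = QuotientGroup.mk (g * k) := rfl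

/-- deck permutations -/
def deckPerm {H K : Subgroup G} (hn : ∀ g ∈ K, ∀ x ∈ H, g * x * g⁻¹ ∈ H) (k : K) :
    Equiv.Perm (G ⧸ H) where
  toFun := deck hn k
  invFun := deck hn k⁻¹
  left_inv := by
    intro y
    induction y using QuotientGroup.induction_on with
    | H g => rw [deck_mk, deck_mk]; simp
  right_inv := by
    intro y
    induction y using QuotientGroup.induction_on with
    | H g => rw [deck_mk, deck_mk]; simp

theorem deckPerm_mk {H K : Subgroup G} (hn : ∀ g ∈ K, ∀ x ∈ H, g * x * g⁻¹ ∈ H) (k : K) (g : G) :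
    deckPerm hn k (QuotientGroup.mk g) = QuotientGroup.mk (g * k) := rfl

theorem deckPerm_smul {H K : Subgroup G} (hn : ∀ g ∈ K, ∀ x ∈ H, g * x * g⁻¹ ∈ H) (k : K) (g : G)
    (y : G ⧸ H) : deckPerm hn k (g • y) = g • deckPerm hn k y := by
  induction y using QuotientGroup.induction_on with
  | H x =>
    rw [deckPerm_mk, MulAction.Quotient.smul_mk, MulAction.Quotient.smul_mk, deckPerm_mk]
    simp only [smul_eq_mul, mul_assoc]

theorem deckPerm_trans {H K : Subgroup G} (hn : ∀ g ∈ K, ∀ x ∈ H, g * x * g⁻¹ ∈ H) (hle : H ≤ K)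
    (y y' : G ⧸ H) (hyy : proj hle y = proj hle y') :
    ∃ d ∈ Set.range (deckPerm hn), d y = y' := by
  obtain ⟨g, rfl⟩ := QuotientGroup.mk_surjective y
  obtain ⟨g', rfl⟩ := QuotientGroup.mk_surjective y'
  rw [proj_mk, proj_mk, QuotientGroup.eq] at hyy
  refine ⟨_, ⟨⟨_, hyy⟩, rfl⟩, ?_⟩
  rw [deckPerm_mk]
  simp

theorem drop {p : ℕ} [Finite ι] (s : ι → G) {H K : Subgroup G} [Finite (G ⧸ H)] [Finite (G ⧸ K)]
    (h : Step p K H) (δ : ℝ) (hX : Expand (fun i (y : G ⧸ K) => s i • y) δ)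
    (hY : ¬ Expand (fun i (y : G ⧸ H) => s i • y) δ) :
    ∃ A : Set (G ⧸ H), Nat.card (G ⧸ H) ≤ 4 * A.ncard ∧ 2 * A.ncard ≤ Nat.card (G ⧸ H) ∧
      (bd (fun i (y : G ⧸ H) => s i • y) A : ℝ) < δ * A.ncard := by
  obtain ⟨m, hm0, hm⟩ := proj_fiber h.1
  exact drop_abs (fun i (y : G ⧸ H) => s i • y) (fun i (y : G ⧸ K) => s i • y) (proj h.1)
    (fun i y => proj_smul h.1 _ _) m hm0 hm (Set.range (deckPerm h.2.2))
    (by rintro _ ⟨k, rfl⟩ i y; exact deckPerm_smul _ _ _ _) (deckPerm_trans h.2.2 h.1) δ hX hY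

theorem expand_triv [Finite ι] (s : ι → G) (hs : Subgroup.closure (Set.range s) = ⊤)
    (H : Subgroup G) [Finite (G ⧸ H)] (δ : ℝ) (hδ : δ * Nat.card (G ⧸ H) ≤ 1) (hδ0 : 0 ≤ δ) :
    Expand (fun i (y : G ⧸ H) => s i • y) δ := by
  intro A hA
  rcases Nat.eq_zero_or_pos (bd (fun i (y : G ⧸ H) => s i • y) A) with h0 | h0
  · have hinv : ∀ (g : G) (y : G ⧸ H), y ∈ A ↔ g • y ∈ A := by
      intro g y
      obtain ⟨W, hW⟩ := word s hs g
      have := hW H A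
      rw [h0, mul_zero, Nat.le_zero, mv, Set.ncard_eq_zero (Set.toFinite _)] at this
      have h2 : y ∉ {y | ¬ (y ∈ A ↔ g • y ∈ A)} := by rw [this]; simp
      simpa using h2
    rcases A.eq_empty_or_nonempty with rfl | ⟨y, hy⟩
    · simp
    · have : A = Set.univ := by
        rw [Set.eq_univ_iff_forall]
        intro z
        obtain ⟨g, rfl⟩ := MulAction.exists_smul_eq G y z
        exact (hinv g y).1 hy
      rw [this, Set.ncard_univ] at hA
      have : 0 < Nat.card (G ⧸ H) := Nat.card_pos
      omega
  · have h1 : A.ncard ≤ Nat.card (G ⧸ H) := Set.ncard_le_card A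
    have h1' : (A.ncard : ℝ) ≤ Nat.card (G ⧸ H) := by exact_mod_cast h1
    have h2 : (1 : ℝ) ≤ bd (fun i (y : G ⧸ H) => s i • y) A := by exact_mod_cast h0
    nlinarith

theorem chain_anti {p : ℕ} {K : ℕ → Subgroup G} (hK : ∀ i, Step p (K i) (K (i + 1))) :
    Antitone K := antitone_nat_of_succ_le fun i => (hK i).1

theorem deep_cut {p : ℕ} [Finite ι] (s : ι → G) (hs : Subgroup.closure (Set.range s) = ⊤)
    {K : ℕ → Subgroup G} (hK : ∀ i, Step p (K i) (K (i + 1))) (hfin : ∀ i, Finite (G ⧸ K i))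
    (hno : ∀ δ : ℝ, 0 < δ → ∃ i, ¬ Expand (fun j (y : G ⧸ K i) => s j • y) δ)
    (δ : ℝ) (hδ : 0 < δ) (J : ℕ) :
    ∃ l, J ≤ l ∧ ∃ A : Set (G ⧸ K l), Nat.card (G ⧸ K l) ≤ 4 * A.ncard ∧
      2 * A.ncard ≤ Nat.card (G ⧸ K l) ∧
      (bd (fun i (y : G ⧸ K l) => s i • y) A : ℝ) ≤ δ * A.ncard := by
  classical
  have hJ0 : 0 < Nat.card (G ⧸ K J) := Nat.card_pos
  set δ' : ℝ := min δ (Nat.card (G ⧸ K J) : ℝ)⁻¹ with hδ'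
  have hδ'0 : 0 < δ' := lt_min hδ (by positivity)
  have hex := hno δ' hδ'0
  have hl := Nat.find_spec hex
  have hmin := fun {m : ℕ} => Nat.find_min hex (m := m)
  generalize Nat.find hex = l at hl hmin
  have hJl : J < l := by
    by_contra hlt
    push Not at hlt
    apply hl
    refine expand_triv s hs _ δ' ?_ hδ'0.le
    have h1 : Nat.card (G ⧸ K l) ≤ Nat.card (G ⧸ K J) :=
      Nat.card_le_card_of_surjective _ (proj_surj (chain_anti hK hlt))
    have h1' : (Nat.card (G ⧸ K l) : ℝ) ≤ Nat.card (G ⧸ K J) := by exact_mod_cast h1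
    calc δ' * Nat.card (G ⧸ K l) ≤ (Nat.card (G ⧸ K J) : ℝ)⁻¹ * Nat.card (G ⧸ K J) := by
          gcongr
          exact min_le_right _ _
      _ = 1 := inv_mul_cancel₀ (by positivity)
  obtain ⟨l, rfl⟩ : ∃ l', l = l' + 1 := ⟨l - 1, by omega⟩
  have hprev := hmin (Nat.lt_succ_self l)
  push Not at hprev
  obtain ⟨A, h1, h2, h3⟩ := drop s (hK l) δ' hprev hl
  refine ⟨l + 1, hJl.le, A, h1, h2, h3.le.trans ?_⟩
  gcongr
  exact min_le_left _ _

end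
end Lack

namespace Lack

section
variable {G : Type*} [Group G] {ι : Type*}

/-- crossing edges of a colouring -/
def crossing (s : ι → G) (H : Subgroup G) (col : G ⧸ H → ℕ) : Set (ι × (G ⧸ H)) :=
  {e | col e.2 ≠ col (s e.1 • e.2)}

/-- colourings with small classes and few crossing edges -/
def Part (s : ι → G) (H : Subgroup G) (ρ ε : ℝ) : Prop :=
  ∃ col : G ⧸ H → ℕ, (∀ c, ({y | col y = c}.ncard : ℝ) ≤ ρ * Nat.card (G ⧸ H)) ∧
    ((crossing s H col).ncard : ℝ) ≤ ε * Nat.card (G ⧸ H)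

theorem card_proj {H K : Subgroup G} [Finite (G ⧸ H)] [Finite (G ⧸ K)] (h : H ≤ K) (m : ℕ)
    (hm : ∀ x, {y | proj h y = x}.ncard = m) : Nat.card (G ⧸ H) = m * Nat.card (G ⧸ K) := by
  have := ncard_preimage_fiber (proj h) m hm Set.univ
  rwa [Set.preimage_univ, Set.ncard_univ, Set.ncard_univ] at this

theorem crossing_lift [Finite ι] (s : ι → G) {H K : Subgroup G} [Finite (G ⧸ H)] [Finite (G ⧸ K)]
    (h : H ≤ K) (m : ℕ)
    (hm : ∀ x, {y | proj h y = x}.ncard = m) (col : G ⧸ K → ℕ) :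
    (crossing s H (fun y => col (proj h y))).ncard = m * (crossing s K col).ncard := by
  rw [← ncard_preimage_fiber (fun e : ι × (G ⧸ H) => (e.1, proj h e.2)) m (fiber_prod (proj h) m hm)]
  congr 1
  ext ⟨i, y⟩
  simp only [crossing, Set.mem_preimage, Set.mem_ofPred_eq, proj_smul]

theorem Part.lift [Finite ι] {s : ι → G} {H K : Subgroup G} [Finite (G ⧸ H)] [Finite (G ⧸ K)]
    (h : H ≤ K) {ρ ε : ℝ} (hP : Part s K ρ ε) : Part s H ρ ε := by
  obtain ⟨col, h1, h2⟩ := hP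
  obtain ⟨m, hm0, hm⟩ := proj_fiber h
  have hc := card_proj h m hm
  refine ⟨fun y => col (proj h y), fun c => ?_, ?_⟩
  · have : {y | col (proj h y) = c}.ncard = m * {y | col y = c}.ncard :=
      ncard_preimage_fiber (proj h) m hm {y | col y = c}
    rw [this, hc]
    push_cast
    have := h1 c
    have hm' : (0:ℝ) ≤ m := by positivity
    nlinarith
  · rw [crossing_lift s h m hm, hc]
    push_cast
    have hm' : (0:ℝ) ≤ m := by positivity
    nlinarith

theorem Part.refine [Finite ι] {s : ι → G} {H K : Subgroup G} [Finite (G ⧸ H)] [Finite (G ⧸ K)]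
    (h : H ≤ K) {ρ ε ε' : ℝ} (hP : Part s K ρ ε) (m : ℕ)
    (hm : ∀ x, {y | proj h y = x}.ncard = m) (A : Set (G ⧸ H))
    (hA1 : ∀ x, ({y | proj h y = x ∧ y ∈ A}.ncard : ℝ) ≤ 4 / 5 * m)
    (hA2 : ∀ x, ({y | proj h y = x ∧ y ∈ Aᶜ}.ncard : ℝ) ≤ 4 / 5 * m)
    (hb : (bd (fun i (y : G ⧸ H) => s i • y) A : ℝ) ≤ ε' * Nat.card (G ⧸ H)) :
    Part s H (4 / 5 * ρ) (ε + ε') := by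
  classical
  obtain ⟨col, h1, h2⟩ := hP
  have hc := card_proj h m hm
  have hm' : (0:ℝ) ≤ m := by positivity
  refine ⟨fun y => 2 * col (proj h y) + if y ∈ A then 1 else 0, fun c => ?_, ?_⟩
  · have key : ∀ B : Set (G ⧸ H), (∀ x, ({y | proj h y = x ∧ y ∈ B}.ncard : ℝ) ≤ 4 / 5 * m) →
        {y | 2 * col (proj h y) + (if y ∈ A then 1 else 0) = c} ⊆ B →
        ({y | 2 * col (proj h y) + (if y ∈ A then 1 else 0) = c}.ncard : ℝ) ≤
          4 / 5 * ρ * Nat.card (G ⧸ H) := by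
      intro B hB hsub
      have := ncard_fiber_le (proj h)
        {y | 2 * col (proj h y) + (if y ∈ A then 1 else 0) = c} {x | col x = c / 2} (4 / 5 * m)
        (by
          intro x _
          refine le_trans ?_ (hB x)
          have hss : {y | proj h y = x ∧
              y ∈ {y | 2 * col (proj h y) + (if y ∈ A then 1 else 0) = c}} ⊆
              {y | proj h y = x ∧ y ∈ B} := fun y hy => ⟨hy.1, hsub hy.2⟩
          exact_mod_cast Set.ncard_le_ncard hss (Set.toFinite _))
        (by
          intro y hy
          simp only [Set.mem_ofPred_eq] at hy ⊢
          split_ifs at hy <;> omega)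
      refine this.trans ?_
      rw [hc]
      push_cast
      have := h1 (c / 2)
      nlinarith
    rcases Nat.even_or_odd c with hce | hco
    · refine key _ hA2 ?_
      intro y hy
      simp only [Set.mem_ofPred_eq] at hy
      intro hyA
      rw [if_pos hyA] at hy
      obtain ⟨r, rfl⟩ := hce
      omega
    · refine key _ hA1 ?_
      intro y hy
      simp only [Set.mem_ofPred_eq] at hy
      by_contra hyA
      rw [if_neg hyA] at hy
      obtain ⟨r, rfl⟩ := hco
      omega
  · have hsub : crossing s H (fun y => 2 * col (proj h y) + if y ∈ A then 1 else 0) ⊆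
        crossing s H (fun y => col (proj h y)) ∪
          {e | ¬ (e.2 ∈ A ↔ s e.1 • e.2 ∈ A)} := by
      rintro ⟨i, y⟩ he
      by_contra hcon
      simp only [crossing, Set.mem_union, Set.mem_ofPred_eq, not_or, not_not] at he hcon
      apply he
      rw [hcon.1]
      simp only [hcon.2]
    have h3 := (Set.ncard_le_ncard hsub (Set.toFinite _)).trans (Set.ncard_union_le _ _)
    rw [crossing_lift s h m hm] at h3
    have h4 : ((crossing s H (fun y => 2 * col (proj h y) + if y ∈ A then 1 else 0)).ncard : ℝ) ≤
      m * (crossing s K col).ncard + bd (fun i (y : G ⧸ H) => s i • y) A := by exact_mod_cast h3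
    refine h4.trans ?_
    rw [add_mul]
    refine add_le_add ?_ hb
    rw [hc]; push_cast
    nlinarith

theorem balance [Finite ι] (s : ι → G) (hs : Subgroup.closure (Set.range s) = ⊤)
    (K : Subgroup G) [Finite (G ⧸ K)] :
    ∃ δ : ℝ, 0 < δ ∧ ∀ (H : Subgroup G) [Finite (G ⧸ H)] (h : H ≤ K) (m : ℕ)
      (_ : ∀ x, {y | proj h y = x}.ncard = m) (A : Set (G ⧸ H)),
      Nat.card (G ⧸ H) ≤ 4 * A.ncard → 2 * A.ncard ≤ Nat.card (G ⧸ H) →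
      (bd (fun i (y : G ⧸ H) => s i • y) A : ℝ) ≤ δ * A.ncard →
      (∀ x, ({y | proj h y = x ∧ y ∈ A}.ncard : ℝ) ≤ 4 / 5 * m) ∧
      (∀ x, ({y | proj h y = x ∧ y ∈ Aᶜ}.ncard : ℝ) ≤ 4 / 5 * m) := by
  obtain ⟨W, hW⟩ := word_fin s hs (fun q : (G ⧸ K) × (G ⧸ K) => q.2.out * q.1.out⁻¹)
  have hn0 : 0 < Nat.card (G ⧸ K) := Nat.card_pos
  have hn0' : (0:ℝ) < Nat.card (G ⧸ K) := by exact_mod_cast hn0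
  refine ⟨(20 * (W + 1) * Nat.card (G ⧸ K) : ℝ)⁻¹, by positivity, ?_⟩
  intro H _ h m hm A hA1 hA2 hb
  have hc := card_proj h m hm
  have low : ∀ (B : Set (G ⧸ H)) (x : G ⧸ K), (B.ncard : ℝ) ≤
      ({y | proj h y = x ∧ y ∈ B}.ncard + W * bd (fun i (y : G ⧸ H) => s i • y) B) *
        Nat.card (G ⧸ K) := by
    intro B x
    rw [← Set.ncard_univ (G ⧸ K)]
    refine ncard_fiber_le (proj h) B Set.univ _ ?_ (fun _ _ => Set.mem_univ _)
    intro z _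
    have h1 := hW (z, x) H B
    set g : G := x.out * z.out⁻¹ with hg
    have hgz : ∀ y, proj h y = z → proj h (g • y) = x := by
      intro y hy
      rw [proj_smul, hy, hg, mul_smul]
      have e1 : z.out⁻¹ • z = QuotientGroup.mk 1 := by
        conv_lhs => rw [← QuotientGroup.out_eq' z]
        rw [MulAction.Quotient.smul_mk]
        simp
      rw [e1, MulAction.Quotient.smul_mk]
      simp
    have hsub : {y | proj h y = z ∧ y ∈ B} ⊆ {y | ¬ (y ∈ B ↔ g • y ∈ B)} ∪
        (fun y => g⁻¹ • y) '' {y | proj h y = x ∧ y ∈ B} := by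
      rintro y ⟨hy, hyB⟩
      by_cases hgy : g • y ∈ B
      · right
        exact ⟨g • y, ⟨hgz y hy, hgy⟩, by simp⟩
      · left
        simp only [Set.mem_ofPred_eq]
        tauto
    have h2 := (Set.ncard_le_ncard hsub (Set.toFinite _)).trans (Set.ncard_union_le _ _)
    rw [Set.ncard_image_of_injective _ (MulAction.injective g⁻¹)] at h2
    have h3 : {y | proj h y = z ∧ y ∈ B}.ncard ≤ {y | proj h y = x ∧ y ∈ B}.ncard +
      W * bd (fun i (y : G ⧸ H) => s i • y) B := by
      have : {y | ¬ (y ∈ B ↔ g • y ∈ B)}.ncard ≤ W * bd (fun i (y : G ⧸ H) => s i • y) B := h1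
      omega
    exact_mod_cast h3
  have hsum : ∀ x, ({y | proj h y = x ∧ y ∈ A}.ncard : ℝ) +
      {y | proj h y = x ∧ y ∈ Aᶜ}.ncard = m := by
    intro x
    have := Set.ncard_inter_add_ncard_sdiff_eq_ncard {y | proj h y = x} A (Set.toFinite _)
    rw [hm x] at this
    exact_mod_cast this
  have hAc : A.ncard + Aᶜ.ncard = Nat.card (G ⧸ H) := Set.ncard_add_ncard_compl A
  have hWb : (W * bd (fun i (y : G ⧸ H) => s i • y) A : ℝ) ≤ m / 20 := by
    have hAm : (A.ncard : ℝ) ≤ m * Nat.card (G ⧸ K) := by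
      have : A.ncard ≤ m * Nat.card (G ⧸ K) := by omega
      exact_mod_cast this
    have hW0 : (0:ℝ) ≤ W := by positivity
    calc (W * bd (fun i (y : G ⧸ H) => s i • y) A : ℝ)
        ≤ W * ((20 * (W + 1) * Nat.card (G ⧸ K) : ℝ)⁻¹ * (m * Nat.card (G ⧸ K))) := by
          refine mul_le_mul_of_nonneg_left (hb.trans ?_) hW0
          gcongr
      _ = (W / (W + 1)) * (m / 20) := by field_simp
      _ ≤ 1 * (m / 20) := by
          gcongr
          rw [div_le_one (by positivity)]
          linarith
      _ = m / 20 := one_mul _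
  have hA1' : (m : ℝ) * Nat.card (G ⧸ K) ≤ 4 * A.ncard := by
    rw [hc] at hA1; exact_mod_cast hA1
  have hA2' : (m : ℝ) * Nat.card (G ⧸ K) ≤ 2 * Aᶜ.ncard := by
    have : m * Nat.card (G ⧸ K) ≤ 2 * Aᶜ.ncard := by omega
    exact_mod_cast this
  constructor
  · intro x
    have h1 := low Aᶜ x
    rw [bd_compl] at h1
    have h2 := hsum x
    have : (m:ℝ) * Nat.card (G ⧸ K) ≤ (2 * ({y | proj h y = x ∧ y ∈ Aᶜ}.ncard + m / 20)) *
        Nat.card (G ⧸ K) := by nlinarith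
    have := le_of_mul_le_mul_right this hn0'
    have : (0:ℝ) ≤ m := by positivity
    linarith
  · intro x
    have h1 := low A x
    have h2 := hsum x
    have : (m:ℝ) * Nat.card (G ⧸ K) ≤ (4 * ({y | proj h y = x ∧ y ∈ A}.ncard + m / 20)) *
        Nat.card (G ⧸ K) := by nlinarith
    have := le_of_mul_le_mul_right this hn0'
    have : (0:ℝ) ≤ m := by positivity
    linarith

theorem partition_pow {p : ℕ} [Finite ι] (s : ι → G) (hs : Subgroup.closure (Set.range s) = ⊤)
    {K : ℕ → Subgroup G} (hK : ∀ i, Step p (K i) (K (i + 1))) (hfin : ∀ i, Finite (G ⧸ K i))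
    (hno : ∀ δ : ℝ, 0 < δ → ∃ i, ¬ Expand (fun j (y : G ⧸ K i) => s j • y) δ) (k : ℕ) :
    ∀ (ε : ℝ), 0 < ε → ∃ l, Part s (K l) ((4 / 5) ^ k) ε := by
  induction k with
  | zero =>
    intro ε hε
    refine ⟨0, fun _ => 0, fun c => ?_, ?_⟩
    · rw [pow_zero, one_mul]
      exact_mod_cast Set.ncard_le_card _
    · simp only [crossing, ne_eq, not_true_eq_false]
      have : {e : ι × (G ⧸ K 0) | False} = ∅ := by ext; simp
      rw [this, Set.ncard_empty, Nat.cast_zero]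
      positivity
  | succ k ih =>
    intro ε hε
    obtain ⟨j, hj⟩ := ih (ε / 2) (by positivity)
    obtain ⟨δ, hδ, hbal⟩ := balance s hs (K j)
    obtain ⟨l, hl, A, hA1, hA2, hA3⟩ := deep_cut s hs hK hfin hno (min δ (ε / 2))
      (lt_min hδ (by positivity)) j
    have hle := chain_anti hK hl
    obtain ⟨m, hm0, hm⟩ := proj_fiber hle
    obtain ⟨h1, h2⟩ := hbal (K l) hle m hm A hA1 hA2 (hA3.trans (by
      gcongr
      exact min_le_left _ _))
    refine ⟨l, ?_⟩
    have := Part.refine hle hj m hm A h1 h2 (ε' := ε / 2) (hA3.trans (by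
      gcongr
      · exact min_le_right _ _
      · exact Set.ncard_le_card A))
    rwa [add_halves, ← pow_succ'] at this

theorem partition {p : ℕ} [Finite ι] (s : ι → G) (hs : Subgroup.closure (Set.range s) = ⊤)
    {K : ℕ → Subgroup G} (hK : ∀ i, Step p (K i) (K (i + 1))) (hfin : ∀ i, Finite (G ⧸ K i))
    (hno : ∀ δ : ℝ, 0 < δ → ∃ i, ¬ Expand (fun j (y : G ⧸ K i) => s j • y) δ)
    (ρ ε : ℝ) (hρ : 0 < ρ) (hε : 0 < ε) :
    ∃ l, ∀ H ≤ K l, Finite (G ⧸ H) → Part s H ρ ε := by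
  obtain ⟨k, hk⟩ := exists_pow_lt_of_lt_one hρ (by norm_num : (4 / 5 : ℝ) < 1)
  obtain ⟨l, hl⟩ := partition_pow s hs hK hfin hno k ε hε
  refine ⟨l, fun H hH _ => ?_⟩
  obtain ⟨col, h1, h2⟩ := hl.lift hH
  exact ⟨col, fun c => (h1 c).trans (by gcongr), h2⟩

end
end Lack

namespace Lack

/-! ## Labelled actions -/

section
universe u
variable {G : Type u} [Group G] {ι : Type}

/-- one labelled permutation -/
def genPerm {V X : Type*} [MulAction G V] (g : G) (θ : V → Equiv.Perm X) : Equiv.Perm (V × X) where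
  toFun y := (g • y.1, θ y.1 y.2)
  invFun y := (g⁻¹ • y.1, (θ (g⁻¹ • y.1)).symm y.2)
  left_inv y := by simp
  right_inv y := by simp

/-- the action of the free group on `V × X` given by a labelling of the edges -/
def lab (f : FreeGroup ι →* G) {V X : Type*} [MulAction G V] (θ : ι → V → Equiv.Perm X) :
    FreeGroup ι →* Equiv.Perm (V × X) :=
  FreeGroup.lift (fun i => genPerm (f (FreeGroup.of i)) (θ i))

variable (f : FreeGroup ι →* G) {V X : Type*} [MulAction G V]

theorem lab_of (θ : ι → V → Equiv.Perm X) (i : ι) (v : V) (x : X) :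
    lab f θ (FreeGroup.of i) (v, x) = (f (FreeGroup.of i) • v, θ i v x) := by
  simp [lab, genPerm]

theorem lab_of_inv (θ : ι → V → Equiv.Perm X) (i : ι) (v : V) (x : X) :
    lab f θ (FreeGroup.of i)⁻¹ (v, x) = ((f (FreeGroup.of i))⁻¹ • v,
      (θ i ((f (FreeGroup.of i))⁻¹ • v)).symm x) := by
  rw [map_inv, Equiv.Perm.inv_eq_iff_eq, lab_of]
  simp

theorem lab_fst (θ : ι → V → Equiv.Perm X) (w : FreeGroup ι) :
    ∀ (v : V) (x : X), (lab f θ w (v, x)).1 = f w • v := by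
  induction w using FreeGroup.induction_on with
  | C1 => intro v x; simp
  | of i => intro v x; rw [lab_of]
  | inv_of i _ => intro v x; rw [lab_of_inv]; simp
  | mul a b ha hb =>
    intro v x
    rw [map_mul, Equiv.Perm.mul_apply, ← Prod.mk.eta (p := lab f θ b (v, x)), ha, hb, map_mul,
      mul_smul]

theorem lab_local (w : FreeGroup ι) : ∃ T : Set G, T.Finite ∧
    ∀ (V : Type u) [MulAction G V] (X : Type) (θ θ' : ι → V → Equiv.Perm X) (v : V),
      (∀ i, ∀ t ∈ T, θ i (t • v) = θ' i (t • v)) → ∀ x, lab f θ w (v, x) = lab f θ' w (v, x) := by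
  induction w using FreeGroup.induction_on with
  | C1 => exact ⟨∅, Set.finite_empty, by simp⟩
  | of i =>
    refine ⟨{1}, Set.finite_singleton _, ?_⟩
    intro V _ X θ θ' v h x
    have := h i 1 rfl
    rw [one_smul] at this
    rw [lab_of, lab_of, this]
  | inv_of i _ =>
    refine ⟨{(f (FreeGroup.of i))⁻¹}, Set.finite_singleton _, ?_⟩
    intro V _ X θ θ' v h x
    rw [lab_of_inv, lab_of_inv, h i _ rfl]
  | mul a b ha hb =>
    obtain ⟨Ta, hTa, ha⟩ := ha
    obtain ⟨Tb, hTb, hb⟩ := hb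
    refine ⟨(fun t => t * f b) '' Ta ∪ Tb, (hTa.image _).union hTb, ?_⟩
    intro V _ X θ θ' v h x
    rw [map_mul, map_mul, Equiv.Perm.mul_apply, Equiv.Perm.mul_apply,
      ← hb V X θ θ' v (fun i t ht => h i t (Or.inr ht)) x,
      ← Prod.mk.eta (p := lab f θ b (v, x)), lab_fst]
    apply ha
    intro i t ht
    have := h i (t * f b) (Or.inl ⟨t, ht, rfl⟩)
    rwa [mul_smul] at this

theorem lab_conj (θ θ' : ι → V → Equiv.Perm X) (β : Equiv.Perm X)
    (h : ∀ i v x, θ' i v (β x) = β (θ i v x)) (w : FreeGroup ι) :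
    ∀ v x, lab f θ' w (v, β x) = ((lab f θ w (v, x)).1, β (lab f θ w (v, x)).2) := by
  induction w using FreeGroup.induction_on with
  | C1 => intro v x; simp
  | of i => intro v x; rw [lab_of, lab_of, h]
  | inv_of i _ =>
    intro v x
    rw [lab_of_inv, lab_of_inv]
    congr 1
    rw [Equiv.symm_apply_eq, h, Equiv.apply_symm_apply]
  | mul a b ha hb =>
    intro v x
    rw [map_mul, map_mul, Equiv.Perm.mul_apply, Equiv.Perm.mul_apply, hb, ha]

/-- labels which act only on the first coordinate -/
theorem lab_prod {Y : Type*} (θ : ι → V → Equiv.Perm X) (w : FreeGroup ι) :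
    ∀ v x (y : Y), lab f (fun i v => (θ i v).prodCongr (Equiv.refl Y)) w (v, (x, y)) =
      ((lab f θ w (v, x)).1, ((lab f θ w (v, x)).2, y)) := by
  induction w using FreeGroup.induction_on with
  | C1 => intro v x y; simp
  | of i => intro v x y; rw [lab_of, lab_of]; rfl
  | inv_of i _ => intro v x y; rw [lab_of_inv, lab_of_inv]; rfl
  | mul a b ha hb =>
    intro v x y
    rw [map_mul, map_mul, Equiv.Perm.mul_apply, Equiv.Perm.mul_apply, hb, ha]

theorem lab_one (w : FreeGroup ι) :
    ∀ v (x : X), lab f (fun _ (_ : V) => (1 : Equiv.Perm X)) w (v, x) = (f w • v, x) := by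
  induction w using FreeGroup.induction_on with
  | C1 => intro v x; simp
  | of i => intro v x; rw [lab_of]; rfl
  | inv_of i _ => intro v x; rw [lab_of_inv, map_inv]; rfl
  | mul a b ha hb =>
    intro v x
    rw [map_mul, Equiv.Perm.mul_apply, hb, ha, map_mul, mul_smul]

/-- crossing by group elements -/
theorem cross_word {ι : Type*} [Finite ι] (s : ι → G) (hs : Subgroup.closure (Set.range s) = ⊤)
    (g : G) : ∃ W : ℕ, ∀ (H : Subgroup G) [Finite (G ⧸ H)] (q : G ⧸ H → ℕ),
      {v | q v ≠ q (g • v)}.ncard ≤ W * (crossing s H q).ncard := by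
  have hg : g ∈ Subgroup.closure (Set.range s) := by rw [hs]; trivial
  induction hg using Subgroup.closure_induction with
  | mem x hx =>
    obtain ⟨i, rfl⟩ := hx
    refine ⟨1, fun H _ q => ?_⟩
    rw [one_mul, ← Set.ncard_image_of_injective (f := fun v : G ⧸ H => (i, v))
      {v | q v ≠ q (s i • v)} (fun _ _ h => by simpa using h)]
    refine Set.ncard_le_ncard ?_ (Set.toFinite _)
    rintro _ ⟨v, hv, rfl⟩
    exact hv
  | one => exact ⟨0, fun H _ q => by simp⟩
  | mul x y _ _ hx hy =>
    obtain ⟨W, hW⟩ := hx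
    obtain ⟨W', hW'⟩ := hy
    refine ⟨W + W', fun H _ q => ?_⟩
    have hsub : {v | q v ≠ q ((x * y) • v)} ⊆
        (fun v => y⁻¹ • v) '' {v | q v ≠ q (x • v)} ∪ {v | q v ≠ q (y • v)} := by
      intro v hv
      by_cases h : q v = q (y • v)
      · left
        refine ⟨y • v, ?_, by simp⟩
        simp only [Set.mem_ofPred_eq, mul_smul] at hv ⊢
        rwa [← h]
      · right; exact h
    refine ((Set.ncard_le_ncard hsub (Set.toFinite _)).trans (Set.ncard_union_le _ _)).trans ?_
    rw [Set.ncard_image_of_injective _ (MulAction.injective _), add_mul]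
    exact add_le_add (hW H q) (hW' H q)
  | inv x _ hx =>
    obtain ⟨W, hW⟩ := hx
    refine ⟨W, fun H _ q => le_trans ?_ (hW H q)⟩
    rw [← Set.ncard_image_of_injective {v | q v ≠ q (x • v)} (MulAction.injective x)]
    refine Set.ncard_le_ncard ?_ (Set.toFinite _)
    intro v hv
    refine ⟨x⁻¹ • v, ?_, by simp⟩
    simp only [Set.mem_ofPred_eq, smul_inv_smul] at hv ⊢
    exact hv.symm

/-- refine a colouring to connected components -/
theorem components {ι : Type*} (s : ι → G) (H : Subgroup G) [Finite (G ⧸ H)] (ρ ε : ℝ)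
    (h : Part s H ρ ε) : ∃ q : G ⧸ H → ℕ,
      (∀ c, ({y | q y = c}.ncard : ℝ) ≤ ρ * Nat.card (G ⧸ H)) ∧
      ((crossing s H q).ncard : ℝ) ≤ ε * Nat.card (G ⧸ H) ∧
      ∀ S : G ⧸ H → G ⧸ H → Prop, Equivalence S →
        (∀ i v, q v = q (s i • v) → S v (s i • v)) → ∀ u v, q u = q v → S u v := by
  obtain ⟨col, h1, h2⟩ := h
  let r : G ⧸ H → G ⧸ H → Prop := fun u v => ∃ i, v = s i • u ∧ col u = col v
  let st : Setoid (G ⧸ H) := Relation.EqvGen.setoid r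
  obtain ⟨n, ⟨e⟩⟩ := Finite.exists_equiv_fin (Quotient st)
  let q : G ⧸ H → ℕ := fun v => e (Quotient.mk st v)
  have hq : ∀ u v, q u = q v ↔ Relation.EqvGen r u v := by
    intro u v
    simp only [q, Fin.val_inj, EmbeddingLike.apply_eq_iff_eq, Quotient.eq]
    rfl
  have hcol : ∀ u v, q u = q v → col u = col v := by
    intro u v huv
    rw [hq] at huv
    induction huv with
    | rel u v h => exact h.choose_spec.2
    | refl => rfl
    | symm _ _ _ ih => exact ih.symm
    | trans _ _ _ _ _ ih1 ih2 => exact ih1.trans ih2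
  have hcr : ∀ i v, q v = q (s i • v) ↔ col v = col (s i • v) :=
    fun i v => ⟨hcol _ _, fun h => (hq _ _).2 (Relation.EqvGen.rel _ _ ⟨i, rfl, h⟩)⟩
  refine ⟨q, fun c => ?_, ?_, ?_⟩
  · rcases Set.eq_empty_or_nonempty {y | q y = c} with h0 | ⟨y, hy⟩
    · rw [h0, Set.ncard_empty]
      refine le_trans ?_ (h1 0)
      simp
    · refine le_trans ?_ (h1 (col y))
      have : {y | q y = c} ⊆ {z | col z = col y} := fun z hz =>
        hcol _ _ (Eq.trans hz (Eq.symm hy))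
      exact_mod_cast Set.ncard_le_ncard this (Set.toFinite _)
  · have : crossing s H q = crossing s H col := by
      ext ⟨i, v⟩
      simp only [crossing, Set.mem_ofPred_eq, ne_eq, hcr]
    rwa [this]
  · intro S hS hSe u v huv
    rw [hq] at huv
    induction huv with
    | rel u v h =>
      obtain ⟨i, rfl, h⟩ := h
      exact hSe i u ((hcr i u).2 h)
    | refl => exact hS.refl _
    | symm _ _ _ ih => exact hS.symm ih
    | trans _ _ _ _ _ ih1 ih2 => exact hS.trans ih1 ih2

end
end Lack

namespace Lack

section
universe u
variable {G : Type u} [Group G] {ι : Type}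

/-- generators -/
def gens (f : FreeGroup ι →* G) : ι → G := fun i => f (FreeGroup.of i)

/-- additive labelling -/
def addLab {p : ℕ} {V : Type*} (φ : ι × V → ZMod p) : ι → V → Equiv.Perm (ZMod p) :=
  fun i v => Equiv.addRight (φ (i, v))

/-- cocycles -/
def Coc (f : FreeGroup ι →* G) (R : Set (FreeGroup ι)) {p : ℕ} {V : Type*} [MulAction G V]
    (φ : ι × V → ZMod p) : Prop :=
  ∀ r ∈ R, ∀ v x, lab f (addLab φ) r (v, x) = (v, x)

/-- uniform locality -/
def Loc (f : FreeGroup ι →* G) (R : Set (FreeGroup ι)) (T : Set G) : Prop :=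
  ∀ r ∈ R, ∀ (V : Type u) [MulAction G V] (X : Type) (θ θ' : ι → V → Equiv.Perm X) (v : V),
      (∀ i, ∀ t ∈ T, θ i (t • v) = θ' i (t • v)) → ∀ x, lab f θ r (v, x) = lab f θ' r (v, x)

theorem exists_loc (f : FreeGroup ι →* G) (R : Set (FreeGroup ι)) (hR : R.Finite) :
    ∃ T : Set G, T.Finite ∧ Loc f R T := by
  choose T hT h using fun r => lab_local f r
  refine ⟨⋃ r ∈ R, T r, hR.biUnion fun r _ => hT r, ?_⟩
  intro r hr V _ X θ θ' v hv
  exact h r V X θ θ' v fun i t ht => hv i t (Set.mem_biUnion hr ht)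

/-- bad vertices -/
def badV (H : Subgroup G) (T : Set G) (q : G ⧸ H → ℕ) : Set (G ⧸ H) :=
  {v | ∃ t ∈ T, q v ≠ q (t • v)}

/-- killed edges -/
def killed (f : FreeGroup ι →* G) (H : Subgroup G) (T : Set G) (q : G ⧸ H → ℕ) :
    Set (ι × (G ⧸ H)) :=
  crossing (gens f) H q ∪ {e | ∃ v ∈ badV H T q, ∃ t ∈ T, e.2 = t • v}

theorem killed_card [Finite ι] (f : FreeGroup ι →* G)
    (hs : Subgroup.closure (Set.range (gens f)) = ⊤) (T : Set G) (hT : T.Finite) :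
    ∃ C : ℕ, ∀ (H : Subgroup G) [Finite (G ⧸ H)] (q : G ⧸ H → ℕ),
      (killed f H T q).ncard ≤ C * (crossing (gens f) H q).ncard := by
  classical
  choose W hW using cross_word (gens f) hs
  lift T to Finset G using hT
  refine ⟨1 + Nat.card ι * (T.card * ∑ t ∈ T, W t), fun H _ q => ?_⟩
  have h1 : (badV H T q).ncard ≤ (∑ t ∈ T, W t) * (crossing (gens f) H q).ncard := by
    have : badV H T q = ⋃ t ∈ T, {v | q v ≠ q (t • v)} := by
      ext v; simp [badV]
    rw [this, Finset.sum_mul]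
    exact (Finset.set_ncard_biUnion_le _ _).trans (Finset.sum_le_sum fun t _ => hW t H q)
  have h2 : (⋃ t ∈ T, (fun v => t • v) '' badV H T q).ncard ≤ T.card * (badV H T q).ncard := by
    refine (Finset.set_ncard_biUnion_le _ _).trans ?_
    rw [← smul_eq_mul, ← Finset.sum_const]
    exact Finset.sum_le_sum fun t _ => Set.ncard_image_le (Set.toFinite _)
  have h3 : {e : ι × (G ⧸ H) | ∃ v ∈ badV H T q, ∃ t ∈ (T : Set G), e.2 = t • v} ⊆
      Set.univ ×ˢ (⋃ t ∈ T, (fun v => t • v) '' badV H T q) := by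
    rintro ⟨i, u⟩ ⟨v, hv, t, ht, rfl⟩
    refine ⟨trivial, ?_⟩
    simp only [Set.mem_iUnion]
    exact ⟨t, ht, v, hv, rfl⟩
  have h4 := Set.ncard_le_ncard h3 (Set.toFinite _)
  rw [Set.ncard_prod, Set.ncard_univ] at h4
  refine (Set.ncard_union_le _ _).trans ?_
  rw [add_mul, one_mul]
  refine Nat.add_le_add_left (h4.trans ?_) _
  calc Nat.card ι * (⋃ t ∈ T, (fun v => t • v) '' badV H T q).ncard
      ≤ Nat.card ι * (T.card * ((∑ t ∈ T, W t) * (crossing (gens f) H q).ncard)) := by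
        gcongr
        exact h2.trans (Nat.mul_le_mul_left _ h1)
    _ = _ := by ring

/-- being a coboundary on part `j` -/
def Cob (f : FreeGroup ι →* G) {p : ℕ} {H : Subgroup G} (q : G ⧸ H → ℕ)
    (φ : ι × (G ⧸ H) → ZMod p) (j : ℕ) : Prop :=
  ∃ g : G ⧸ H → ZMod p, ∀ i v, q v = j → q (gens f i • v) = j →
    φ (i, v) = g (gens f i • v) - g v

/-- cocycles vanishing on killed edges -/
def Zk (f : FreeGroup ι →* G) (R : Set (FreeGroup ι)) (p : ℕ) {H : Subgroup G} (T : Set G)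
    (q : G ⧸ H → ℕ) : Set (ι × (G ⧸ H) → ZMod p) :=
  {φ | Coc f R φ ∧ ∀ e ∈ killed f H T q, φ e = 0}

theorem addLab_zero {p : ℕ} {V : Type*} :
    addLab (ι := ι) (p := p) (fun _ : ι × V => 0) = fun _ _ => 1 := by
  funext i v
  ext x
  simp [addLab]

theorem coc_zero (f : FreeGroup ι →* G) (R : Set (FreeGroup ι)) (hR : ∀ r ∈ R, f r = 1) {p : ℕ}
    {V : Type*} [MulAction G V] : Coc f R (fun _ : ι × V => (0 : ZMod p)) := by
  intro r hr v x
  rw [addLab_zero, lab_one, hR r hr, one_smul]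

/-- carrying parts -/
def carry (f : FreeGroup ι →* G) (R : Set (FreeGroup ι)) (p : ℕ) {H : Subgroup G} (T : Set G)
    (q : G ⧸ H → ℕ) : Set ℕ := {j | ∃ φ ∈ Zk f R p T q, ¬ Cob f q φ j}

theorem merge (f : FreeGroup ι →* G) (R : Set (FreeGroup ι)) (hR : ∀ r ∈ R, f r = 1) (p : ℕ)
    {H : Subgroup G} (T : Set G) (hT : Loc f R T) (q : G ⧸ H → ℕ) :
    ∃ φ ∈ Zk f R p T q, (∀ j ∈ carry f R p T q, ¬ Cob f q φ j) ∧
      ∀ e, q e.2 ∉ carry f R p T q → φ e = 0 := by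
  classical
  have hex : ∀ j, ∃ φ ∈ Zk f R p T q, (j ∈ carry f R p T q → ¬ Cob f q φ j) ∧
      (j ∉ carry f R p T q → φ = fun _ => 0) := by
    intro j
    by_cases hj : j ∈ carry f R p T q
    · obtain ⟨φ, h1, h2⟩ := id hj
      exact ⟨φ, h1, fun _ => h2, fun h => absurd hj h⟩
    · exact ⟨fun _ => 0, ⟨coc_zero f R hR, fun _ _ => rfl⟩, fun h => absurd h hj, fun _ => rfl⟩
  choose Φ hZ h1 h2 using hex
  refine ⟨fun e => Φ (q e.2) e, ⟨?_, ?_⟩, ?_, ?_⟩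
  · intro r hr v x
    by_cases hv : v ∈ badV H T q
    · rw [hT r hr _ _ _ (addLab (fun _ => 0)) v, coc_zero f R hR r hr]
      intro i t ht
      simp only [addLab]
      rw [(hZ _).2]
      exact Or.inr ⟨v, hv, t, ht, rfl⟩
    · rw [hT r hr _ _ _ (addLab (Φ (q v))) v, (hZ (q v)).1 r hr]
      intro i t ht
      unfold addLab
      have : q v = q (t • v) := by
        by_contra h
        exact hv ⟨t, ht, h⟩
      simp only [this]
  · intro e he
    exact (hZ _).2 e he
  · intro j hj hc
    apply h1 j hj
    obtain ⟨g, hg⟩ := hc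
    refine ⟨g, fun i v hv hv' => ?_⟩
    rw [← hg i v hv hv']
    simp only [hv]
  · intro e he
    simp only [h2 _ he]

/-- the section cocycle -/
noncomputable def cs (H : Subgroup G) (g : G) (v : G ⧸ H) : H :=
  ⟨(g • v).out⁻¹ * g * v.out, by
    rw [mul_assoc, ← QuotientGroup.eq, QuotientGroup.out_eq']
    conv_lhs => rw [← QuotientGroup.out_eq' v]
    rfl⟩

theorem cs_mul (H : Subgroup G) (g h : G) (v : G ⧸ H) :
    cs H (g * h) v = cs H g (h • v) * cs H h v := by
  apply Subtype.ext
  simp only [cs, Subgroup.coe_mul, mul_smul]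
  group

theorem cs_one (H : Subgroup G) (v : G ⧸ H) : cs H 1 v = 1 := by
  apply Subtype.ext
  simp [cs]

/-- the cocycle attached to a homomorphism and a function -/
noncomputable def Psi (f : FreeGroup ι →* G) (p : ℕ) (H : Subgroup G) :
    ((Additive H →+ ZMod p) × (G ⧸ H → ZMod p)) →ₗ[ZMod p] (ι × (G ⧸ H) → ZMod p) where
  toFun m e := m.1 (Additive.ofMul (cs H (gens f e.1) e.2)) + (m.2 (gens f e.1 • e.2) - m.2 e.2)
  map_add' m m' := by
    funext e
    simp only [Prod.fst_add, Prod.snd_add, AddMonoidHom.add_apply, Pi.add_apply]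
    ring
  map_smul' a m := by
    funext e
    simp only [Prod.smul_fst, Prod.smul_snd, AddMonoidHom.smul_apply, Pi.smul_apply, smul_eq_mul,
      RingHom.id_apply]
    ring

theorem Psi_lab (f : FreeGroup ι →* G) (p : ℕ) (H : Subgroup G)
    (m : (Additive H →+ ZMod p) × (G ⧸ H → ZMod p)) (w : FreeGroup ι) :
    ∀ v x, lab f (addLab (Psi f p H m)) w (v, x) =
      (f w • v, x + (m.1 (Additive.ofMul (cs H (f w) v)) + (m.2 (f w • v) - m.2 v))) := by
  induction w using FreeGroup.induction_on with
  | C1 => intro v x; simp [cs_one]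
  | of i => intro v x; rw [lab_of]; rfl
  | inv_of i _ =>
    intro v x
    rw [lab_of_inv, map_inv]
    congr 1
    set g := f (FreeGroup.of i) with hg
    have h1 := cs_mul H g g⁻¹ v
    rw [mul_inv_cancel, cs_one] at h1
    have h2 : m.1 (Additive.ofMul (cs H g (g⁻¹ • v))) + m.1 (Additive.ofMul (cs H g⁻¹ v)) = 0 := by
      rw [← map_add, ← ofMul_mul, ← h1, ofMul_one, map_zero]
    rw [Equiv.symm_apply_eq]
    change x = x + _ + (m.1 (Additive.ofMul (cs H g (g⁻¹ • v))) + (m.2 (g • g⁻¹ • v) - m.2 (g⁻¹ • v)))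
    rw [smul_inv_smul]
    linear_combination -h2
  | mul a b ha hb =>
    intro v x
    rw [map_mul, Equiv.Perm.mul_apply, hb, ha, map_mul, mul_smul, cs_mul, ofMul_mul, map_add]
    congr 1
    ring

theorem Psi_coc (f : FreeGroup ι →* G) (p : ℕ) (H : Subgroup G) (R : Set (FreeGroup ι))
    (hR : ∀ r ∈ R, f r = 1) (m : (Additive H →+ ZMod p) × (G ⧸ H → ZMod p)) :
    Coc f R (Psi f p H m) := by
  intro r hr v x
  rw [Psi_lab, hR r hr]
  simp [cs_one]

theorem Psi_ker (f : FreeGroup ι →* G) (hf : Function.Surjective f) (p : ℕ) (H : Subgroup G)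
    (m : (Additive H →+ ZMod p) × (G ⧸ H → ZMod p)) (hm : Psi f p H m = 0)
    (h0 : m.2 (QuotientGroup.mk 1) = 0) : m = 0 := by
  have key : ∀ (g : G) v, m.1 (Additive.ofMul (cs H g v)) + (m.2 (g • v) - m.2 v) = 0 := by
    intro g v
    obtain ⟨w, rfl⟩ := hf g
    have h1 := Psi_lab f p H m w v 0
    rw [hm] at h1
    have h2 := lab_one f (X := ZMod p) w v 0
    rw [← addLab_zero] at h2
    have h3 := h1.symm.trans h2
    simpa using congrArg Prod.snd h3
  have hα : m.1 = 0 := by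
    ext h
    obtain ⟨h, rfl⟩ := Additive.ofMul.surjective h
    let v0 : G ⧸ H := QuotientGroup.mk 1
    have hv0 : v0.out ∈ H := by
      have : (QuotientGroup.mk v0.out : G ⧸ H) = QuotientGroup.mk 1 := QuotientGroup.out_eq' v0
      rw [QuotientGroup.eq] at this
      simpa using this
    have h1 : (h : G) • v0 = v0 := by
      change (QuotientGroup.mk ((h : G) * 1) : G ⧸ H) = QuotientGroup.mk 1
      rw [QuotientGroup.eq]
      simp
    have h2 := key h v0
    have h3 : cs H h v0 = (⟨_, hv0⟩ : H)⁻¹ * h * ⟨_, hv0⟩ := by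
      apply Subtype.ext
      simp only [cs, h1, Subgroup.coe_mul, InvMemClass.coe_inv]
    rw [h1, h3, sub_self, add_zero, ofMul_mul, ofMul_mul, ofMul_inv, map_add, map_add, map_neg] at h2
    change m.1 (Additive.ofMul h) = 0
    linear_combination h2
  apply Prod.ext hα
  funext v
  obtain ⟨g, rfl⟩ := QuotientGroup.mk_surjective v
  have h1 := key g (QuotientGroup.mk 1)
  rw [hα, h0, AddMonoidHom.zero_apply, zero_add, sub_zero] at h1
  change m.2 (QuotientGroup.mk (g * 1)) = 0 at h1
  simpa using h1

theorem lin_bound {k M N Q U : Type*} [Field k] [AddCommGroup M] [AddCommGroup N]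
    [AddCommGroup Q] [AddCommGroup U] [Module k M] [Module k N] [Module k Q] [Module k U]
    [Module.Finite k M] [Module.Finite k N] [Module.Finite k Q] [Module.Finite k U]
    (Ψ : M →ₗ[k] N) (res : M →ₗ[k] Q) (dq : U →ₗ[k] N) (ev : M →ₗ[k] k)
    (hsub : ∀ m, res m = 0 → Ψ m ∈ LinearMap.range dq)
    (hev : ∀ m, Ψ m = 0 → ev m = 0 → m = 0) :
    Module.finrank k M ≤ Module.finrank k Q + Module.finrank k U + 1 := by
  have h1 := LinearMap.finrank_range_add_finrank_ker res
  have h2 : Module.finrank k (LinearMap.range res) ≤ Module.finrank k Q := Submodule.finrank_le _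
  have h3 := LinearMap.finrank_range_add_finrank_ker (Ψ.domRestrict (LinearMap.ker res))
  have h4 : Module.finrank k (LinearMap.range (Ψ.domRestrict (LinearMap.ker res))) ≤
      Module.finrank k U := by
    have h5 : LinearMap.range (Ψ.domRestrict (LinearMap.ker res)) ≤ LinearMap.range dq := by
      rintro _ ⟨m, rfl⟩
      exact hsub m.1 m.2
    exact (Submodule.finrank_mono h5).trans (LinearMap.finrank_range_le dq)
  have h5 : Module.finrank k (LinearMap.ker (Ψ.domRestrict (LinearMap.ker res))) ≤ 1 := by
    have hinj : Function.Injective ((ev.domRestrict (LinearMap.ker res)).domRestrict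
        (LinearMap.ker (Ψ.domRestrict (LinearMap.ker res)))) := by
      rw [← LinearMap.ker_eq_bot, LinearMap.ker_eq_bot']
      intro m hm
      apply Subtype.ext
      apply Subtype.ext
      exact hev m.1.1 m.2 hm
    have := LinearMap.finrank_le_finrank_of_injective hinj
    rwa [Module.finrank_self] at this
  omega

theorem dim_bound [Finite ι] (f : FreeGroup ι →* G) (hf : Function.Surjective f) (p : ℕ)
    [Fact p.Prime] [Group.FG G] (H : Subgroup G) [Finite (G ⧸ H)] (R : Set (FreeGroup ι))
    (hR : ∀ r ∈ R, f r = 1) (T : Set G) (q : G ⧸ H → ℕ) :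
    D p H ≤ 1 + (killed f H T q).ncard +
      {e : ι × (G ⧸ H) | q e.2 ∈ carry f R p T q}.ncard := by
  classical
  have := Fintype.ofFinite ι
  have := Fintype.ofFinite (G ⧸ H)
  have hfin : Module.Finite (ZMod p) (Additive H →+ ZMod p) := by
    have : H.FiniteIndex := Subgroup.finiteIndex_of_finite_quotient
    have hFG : Group.FG H := inferInstance
    have := finite_hom p H
    exact Module.Finite.of_finite
  let M := (Additive H →+ ZMod p) × (G ⧸ H → ZMod p)
  let K : Set (ι × (G ⧸ H)) := killed f H T q ∪ {e | q e.2 ∈ carry f R p T q}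
  let res : M →ₗ[ZMod p] (K → ZMod p) := (LinearMap.funLeft (ZMod p) (ZMod p) Subtype.val) ∘ₗ
    Psi f p H
  let dq : (G ⧸ H → ZMod p) →ₗ[ZMod p] (ι × (G ⧸ H) → ZMod p) :=
    { toFun := fun g e => if q e.2 = q (gens f e.1 • e.2) then g (gens f e.1 • e.2) - g e.2 else 0
      map_add' := by
        intro g g'; funext e; simp only [Pi.add_apply]; split_ifs <;> ring
      map_smul' := by
        intro a g; funext e; simp only [Pi.smul_apply, smul_eq_mul, RingHom.id_apply]
        split_ifs <;> ring }
  have hsub : ∀ m : M, res m = 0 → Psi f p H m ∈ LinearMap.range dq := by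
    intro m hm
    have hm' : ∀ e ∈ K, Psi f p H m e = 0 := fun e he => congrFun hm ⟨e, he⟩
    have hZ : Psi f p H m ∈ Zk f R p T q :=
      ⟨Psi_coc f p H R hR m, fun e he => hm' e (Or.inl he)⟩
    have hcob : ∀ j, Cob f q (Psi f p H m) j := by
      intro j
      by_cases hj : j ∈ carry f R p T q
      · refine ⟨fun _ => 0, fun i v hv _ => ?_⟩
        rw [sub_zero]
        refine hm' _ (Or.inr ?_)
        simp only [Set.mem_ofPred_eq, hv]
        exact hj
      · by_contra hc
        exact hj ⟨_, hZ, hc⟩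
    choose g hg using hcob
    refine ⟨fun v => g (q v) v, ?_⟩
    funext ⟨i, v⟩
    change (if q v = q (gens f i • v) then _ else _) = _
    split_ifs with h
    · simp only [← h]
      exact (hg (q v) i v rfl h.symm).symm
    · exact (hm' _ (Or.inl (Or.inl h))).symm
  have hM : Module.finrank (ZMod p) M = D p H + Nat.card (G ⧸ H) := by
    rw [Module.finrank_prod, Module.finrank_fintype_fun_eq_card, Nat.card_eq_fintype_card]
    rfl
  have hKc : Module.finrank (ZMod p) (K → ZMod p) = K.ncard := by
    rw [Module.finrank_fintype_fun_eq_card, ← Nat.card_eq_fintype_card]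
    rfl
  have hV : Module.finrank (ZMod p) (G ⧸ H → ZMod p) = Nat.card (G ⧸ H) := by
    rw [Module.finrank_fintype_fun_eq_card, Nat.card_eq_fintype_card]
  let ev : M →ₗ[ZMod p] ZMod p :=
      { toFun := fun m => m.2 (QuotientGroup.mk 1)
        map_add' := fun _ _ => rfl
        map_smul' := fun _ _ => rfl }
  have h1 := lin_bound (Psi f p H) res dq ev hsub (fun m h h' => Psi_ker f hf p H m h h')
  rw [hKc, hV, hM] at h1
  have h6 : K.ncard ≤ _ := Set.ncard_union_le _ _
  omega

end
end Lack

namespace Lack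

section
universe u
variable {G : Type u} [Group G] {ι : Type} {Λ : Type} [Group Λ] {p : ℕ}

/-- the shear -/
def shear (b : ZMod p → Λ) : Equiv.Perm (ZMod p × Λ) where
  toFun x := (x.1, b x.1 * x.2)
  invFun x := (x.1, (b x.1)⁻¹ * x.2)
  left_inv x := by simp
  right_inv x := by simp

/-- the twisted translation -/
def twist (b : ZMod p → Λ) (a : ZMod p) : Equiv.Perm (ZMod p × Λ) :=
  shear b * ((Equiv.addRight a).prodCongr (Equiv.refl Λ)) * (shear b)⁻¹

theorem twist_shear (b : ZMod p → Λ) (a : ZMod p) (x : ZMod p × Λ) :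
    twist b a (shear b x) = shear b ((Equiv.addRight a).prodCongr (Equiv.refl Λ) x) := by
  simp [twist]

theorem twist_apply (b : ZMod p → Λ) (a t : ZMod p) (l : Λ) :
    twist b a (t, l) = (t + a, b (t + a) * (b t)⁻¹ * l) := by
  have : (t, l) = shear b (t, (b t)⁻¹ * l) := by simp [shear]
  rw [this, twist_shear]
  simp [shear, mul_assoc]

theorem twist_symm_apply (b : ZMod p → Λ) (a t : ZMod p) (l : Λ) :
    (twist b a).symm (t, l) = (t - a, b (t - a) * (b t)⁻¹ * l) := by
  rw [Equiv.symm_apply_eq, twist_apply]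
  simp [mul_assoc]

theorem twist_zero (b : ZMod p → Λ) : twist b 0 = 1 := by
  ext ⟨t, l⟩ <;> rw [twist_apply] <;> simp

/-- the labelling -/
def wlab {H : Subgroup G} (q : G ⧸ H → ℕ) (φ : ι × (G ⧸ H) → ZMod p) (b : ℕ → ZMod p → Λ) :
    ι → G ⧸ H → Equiv.Perm (ZMod p × Λ) := fun i v => twist (b (q v)) (φ (i, v))

theorem wlab_rel (f : FreeGroup ι →* G) (R : Set (FreeGroup ι)) (hR : ∀ r ∈ R, f r = 1)
    {H : Subgroup G} (T : Set G) (hT : Loc f R T) (q : G ⧸ H → ℕ) (φ : ι × (G ⧸ H) → ZMod p)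
    (hφ : φ ∈ Zk f R p T q) (b : ℕ → ZMod p → Λ) (r : FreeGroup ι) (hr : r ∈ R) :
    lab f (wlab q φ b) r = 1 := by
  ext1 ⟨v, x⟩
  rw [Equiv.Perm.one_apply]
  by_cases hv : v ∈ badV H T q
  · rw [hT r hr _ _ _ (fun _ _ => 1) v, lab_one, hR r hr, one_smul]
    intro i t ht
    simp only [wlab]
    rw [hφ.2, twist_zero]
    exact Or.inr ⟨v, hv, t, ht, rfl⟩
  · rw [hT r hr _ _ _ (fun i w => twist (b (q v)) (φ (i, w))) v]
    · obtain ⟨⟨t, l⟩, rfl⟩ := (shear (b (q v))).surjective x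
      rw [lab_conj f (fun i w => (addLab φ i w).prodCongr (Equiv.refl Λ)) _ (shear (b (q v)))
        (fun i w y => twist_shear _ _ _), lab_prod, hφ.1 r hr]
    · intro i t ht
      have : q v = q (t • v) := by
        by_contra h
        exact hv ⟨t, ht, h⟩
      simp only [wlab, this]

theorem wlab_form (f : FreeGroup ι →* G) {H : Subgroup G} (q : G ⧸ H → ℕ)
    (φ : ι × (G ⧸ H) → ZMod p) (b : ℕ → ZMod p → Λ) (w : FreeGroup ι) :
    ∃ (c : G ⧸ H → ZMod p) (d : G ⧸ H → ZMod p → Λ), ∀ v t l,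
      lab f (wlab q φ b) w (v, (t, l)) = (f w • v, (t + c v, d v t * l)) := by
  induction w using FreeGroup.induction_on with
  | C1 => exact ⟨fun _ => 0, fun _ _ => 1, by simp⟩
  | of i =>
    exact ⟨fun v => φ (i, v), fun v t => b (q v) (t + φ (i, v)) * (b (q v) t)⁻¹, fun v t l => by
      rw [lab_of, wlab, twist_apply]⟩
  | inv_of i _ =>
    refine ⟨fun v => - φ (i, (f (FreeGroup.of i))⁻¹ • v),
      fun v t => b (q ((f (FreeGroup.of i))⁻¹ • v)) (t + -φ (i, (f (FreeGroup.of i))⁻¹ • v)) *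
          (b (q ((f (FreeGroup.of i))⁻¹ • v)) t)⁻¹, fun v t l => ?_⟩
    rw [lab_of_inv, wlab, twist_symm_apply, sub_eq_add_neg, map_inv]
  | mul x y hx hy =>
    obtain ⟨c, d, h⟩ := hx
    obtain ⟨c', d', h'⟩ := hy
    refine ⟨fun v => c' v + c (f y • v), fun v t => d (f y • v) (t + c' v) * d' v t,
      fun v t l => ?_⟩
    rw [map_mul, Equiv.Perm.mul_apply, h', h, map_mul, mul_smul, mul_assoc, add_assoc]

theorem endgame [Fact p.Prime] {H : Subgroup G}
    (A : G →* Equiv.Perm ((G ⧸ H) × (ZMod p × Λ)))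
    (hA : ∀ g, ∃ (c : G ⧸ H → ZMod p) (d : G ⧸ H → ZMod p → Λ), ∀ v t l,
      A g (v, (t, l)) = (g • v, (t + c v, d v t * l)))
    (h1 : ∀ t, ∃ g, A g (QuotientGroup.mk 1, (0, 1)) = (QuotientGroup.mk 1, (t, 1)))
    (h2 : ∀ l, ∃ g, A g (QuotientGroup.mk 1, (0, 1)) = (QuotientGroup.mk 1, (0, l))) :
    ∃ H' : Subgroup G, Step p H H' ∧ ∃ ψ : H' →* Λ, Function.Surjective ψ := by
  choose c d hcd using hA
  set e : G ⧸ H := QuotientGroup.mk 1 with he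
  have hH : ∀ g : G, g • e = e ↔ g ∈ H := by
    intro g
    change (QuotientGroup.mk (g * 1) : G ⧸ H) = QuotientGroup.mk 1 ↔ _
    rw [QuotientGroup.eq]
    simp
  let τ : H →* Multiplicative (ZMod p) :=
    { toFun := fun h => Multiplicative.ofAdd (c h e)
      map_one' := by
        have := hcd 1 e 0 1
        rw [map_one, Equiv.Perm.one_apply] at this
        have := congrArg (fun z => z.2.1) this
        simp only [zero_add] at this
        change Multiplicative.ofAdd (c 1 e) = _
        rw [← this]; rfl
      map_mul' := by
        intro g h
        have e1 := hcd ((g : G) * h) e 0 1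
        rw [map_mul, Equiv.Perm.mul_apply, hcd, hcd, (hH h).2 h.2] at e1
        have := congrArg (fun z => z.2.1) e1
        simp only [zero_add] at this
        change Multiplicative.ofAdd (c ((g : G) * h) e) = _
        rw [← this, add_comm]; rfl }
  have hτs : Function.Surjective τ := by
    intro t
    obtain ⟨g, hg⟩ := h1 t.toAdd
    rw [hcd] at hg
    have hg1 : g • e = e := congrArg (fun z => z.1) hg
    have hg2 := congrArg (fun z => z.2.1) hg
    simp only [zero_add] at hg2
    refine ⟨⟨g, (hH g).1 hg1⟩, ?_⟩
    change Multiplicative.ofAdd (c g e) = t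
    rw [hg2]; rfl
  have hmem : ∀ g : G, g ∈ τ.ker.map H.subtype ↔ g • e = e ∧ c g e = 0 := by
    intro g
    constructor
    · rintro ⟨h, hh, rfl⟩
      exact ⟨(hH h).2 h.2, hh⟩
    · rintro ⟨h1, h2⟩
      exact ⟨⟨g, (hH g).1 h1⟩, h2, rfl⟩
  refine ⟨τ.ker.map H.subtype, ⟨Subgroup.map_subtype_le _, ?_, ?_⟩, ?_⟩
  · rw [Subgroup.relIndex, Subgroup.subgroupOf,
      Subgroup.comap_map_eq_self_of_injective H.subtype_injective, Subgroup.index_ker,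
      MonoidHom.range_eq_top.2 hτs, Subgroup.card_top]
    exact Nat.card_zmod p
  · rintro g hg _ ⟨x, hx, rfl⟩
    exact ⟨⟨g, hg⟩ * x * ⟨g, hg⟩⁻¹, (inferInstance : τ.ker.Normal).conj_mem x hx _, rfl⟩
  · refine ⟨{ toFun := fun h => d h e 0, map_one' := ?_, map_mul' := ?_ }, ?_⟩
    · have := hcd 1 e 0 1
      rw [map_one, Equiv.Perm.one_apply] at this
      have := congrArg (fun z => z.2.2) this
      simp only [mul_one] at this
      exact this.symm
    · intro g h
      obtain ⟨hh1, hh2⟩ := (hmem h).1 h.2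
      have e1 := hcd ((g : G) * h) e 0 1
      rw [map_mul, Equiv.Perm.mul_apply, hcd, hcd, hh1, hh2, add_zero] at e1
      have := congrArg (fun z => z.2.2) e1
      simp only [mul_one] at this
      exact this.symm
    · intro l
      obtain ⟨g, hg⟩ := h2 l
      rw [hcd] at hg
      have hg1 : g • e = e := congrArg (fun z => z.1) hg
      have hg2 := congrArg (fun z => z.2.1) hg
      have hg3 := congrArg (fun z => z.2.2) hg
      simp only [zero_add, mul_one] at hg2 hg3
      exact ⟨⟨g, (hmem g).2 ⟨hg1, hg2⟩⟩, hg3⟩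

theorem big [Fact p.Prime] (f : FreeGroup ι →* G) (hf : Function.Surjective f)
    (R : Set (FreeGroup ι)) (hker : f.ker = Subgroup.normalClosure R)
    (hs : Subgroup.closure (Set.range (gens f)) = ⊤)
    {H : Subgroup G} (T : Set G) (hT : Loc f R T) (q : G ⧸ H → ℕ)
    (hconn : ∀ S : G ⧸ H → G ⧸ H → Prop, Equivalence S →
        (∀ i v, q v = q (gens f i • v) → S v (gens f i • v)) → ∀ u v, q u = q v → S u v)
    (φ : ι × (G ⧸ H) → ZMod p)
    (hφ : φ ∈ Zk f R p T q) (J : Set ℕ) (hJ : ∀ j ∈ J, ¬ Cob f q φ j)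
    (hJ0 : ∀ e, q e.2 ∉ J → φ e = 0) (gen : ℕ → Λ)
    (hgen : Subgroup.closure (gen '' J) = ⊤) (j₀ : ℕ) (hj₀ : j₀ ∈ J) (hgen₀ : gen j₀ = 1) :
    ∃ H' : Subgroup G, Step p H H' ∧ ∃ ψ : H' →* Λ, Function.Surjective ψ := by
  classical
  have hR : ∀ r ∈ R, f r = 1 := by
    intro r hr
    rw [← MonoidHom.mem_ker, hker]
    exact Subgroup.subset_normalClosure hr
  let b : ℕ → ZMod p → Λ := fun j t => if t = 1 then gen j else 1
  have hle : f.ker ≤ (lab f (wlab q φ b)).ker := by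
    rw [hker]
    refine Subgroup.normalClosure_le_normal ?_
    intro r hr
    exact wlab_rel f R hR T hT q φ hφ b r hr
  obtain ⟨A, hAf⟩ : ∃ A : G →* Equiv.Perm ((G ⧸ H) × (ZMod p × Λ)),
      ∀ w, A (f w) = lab f (wlab q φ b) w :=
    ⟨f.liftOfSurjective hf ⟨_, hle⟩, fun w => MonoidHom.liftOfRightInverse_comp_apply _ _ _ _ _⟩
  have hA : ∀ g, ∃ (c : G ⧸ H → ZMod p) (d : G ⧸ H → ZMod p → Λ), ∀ v t l,
      A g (v, (t, l)) = (g • v, (t + c v, d v t * l)) := by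
    intro g
    obtain ⟨w, rfl⟩ := hf g
    rw [hAf]
    exact wlab_form f q φ b w
  have hstep : ∀ i v t l, A (gens f i) (v, (t, l)) = (gens f i • v,
      (t + φ (i, v), b (q v) (t + φ (i, v)) * (b (q v) t)⁻¹ * l)) := by
    intro i v t l
    rw [gens, hAf, lab_of, wlab, twist_apply]
  let Re : (G ⧸ H) × (ZMod p × Λ) → (G ⧸ H) × (ZMod p × Λ) → Prop := fun x y => ∃ g, A g x = y
  have hRe : Equivalence Re :=
    { refl := fun x => ⟨1, by simp⟩
      symm := by
        rintro x y ⟨g, rfl⟩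
        exact ⟨g⁻¹, by simp⟩
      trans := by
        rintro x y z ⟨g, rfl⟩ ⟨h, rfl⟩
        exact ⟨h * g, by simp⟩ }
  -- inside a carrying part
  have hin : ∀ j ∈ J, ∀ l u v t t', q u = j → q v = j →
      Re (u, (t, b j t * l)) (v, (t', b j t' * l)) := by
    intro j hj l u v t t' hu hv
    let Q : G ⧸ H → G ⧸ H → ZMod p → Prop := fun x y a =>
      ∀ t, Re (x, (t, b j t * l)) (y, (t + a, b j (t + a) * l))
    have hQe : ∀ i x, q x = j → Q x (gens f i • x) (φ (i, x)) := by
      intro i x hx t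
      refine ⟨gens f i, ?_⟩
      rw [hstep, hx]
      simp
    have hQt : ∀ x y z a c, Q x y a → Q y z c → Q x z (a + c) := by
      intro x y z a c h1 h2 t
      have := hRe.trans (h1 t) (h2 (t + a))
      rwa [add_assoc] at this
    have hQs : ∀ x y a, Q x y a → Q y x (-a) := by
      intro x y a h t
      have := hRe.symm (h (t + -a))
      rwa [neg_add_cancel_right] at this
    have hQr : ∀ x, Q x x 0 := by
      intro x t
      rw [add_zero]
      exact hRe.refl _
    have hQc : ∀ x y, q x = j → q y = j → ∃ a, Q x y a := by
      intro x y hx hy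
      have := hconn (fun x y => (q x = q y) ∧ (q x = j → ∃ a, Q x y a))
        { refl := fun x => ⟨rfl, fun _ => ⟨0, hQr x⟩⟩
          symm := by
            rintro x y ⟨h1, h2⟩
            refine ⟨h1.symm, fun h => ?_⟩
            obtain ⟨a, ha⟩ := h2 (h1.trans h)
            exact ⟨_, hQs _ _ _ ha⟩
          trans := by
            rintro x y z ⟨h1, h2⟩ ⟨h3, h4⟩
            refine ⟨h1.trans h3, fun h => ?_⟩
            obtain ⟨a, ha⟩ := h2 h
            obtain ⟨c, hc⟩ := h4 (h1.symm.trans h)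
            exact ⟨_, hQt _ _ _ _ _ ha hc⟩ }
        (fun i v hv => ⟨hv, fun h => ⟨_, hQe i v h⟩⟩) x y (hx.trans hy.symm)
      exact this.2 hx
    let N : AddSubgroup (ZMod p) :=
      { carrier := {a | Q u u a}
        zero_mem' := hQr u
        add_mem' := fun {a c} ha hc => hQt _ _ _ _ _ ha hc
        neg_mem' := fun {a} ha => hQs _ _ _ ha }
    have hN : N = ⊤ := by
      by_contra hN
      have : Fact (Nat.card (ZMod p)).Prime := by
        rw [Nat.card_zmod]; infer_instance
      have hbot : N = ⊥ := (N.eq_bot_or_eq_top_of_prime_card).resolve_right hN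
      apply hJ j hj
      choose! g hg using hQc u
      refine ⟨g, fun i v hv hv' => ?_⟩
      have h1 := hQt _ _ _ _ _ (hg v hu hv) (hQe i v hv)
      have h2 := hQt _ _ _ _ _ h1 (hQs _ _ _ (hg _ hu hv'))
      have h3 : g v + φ (i, v) + -g (gens f i • v) ∈ N := h2
      rw [hbot, AddSubgroup.mem_bot] at h3
      linear_combination h3
    obtain ⟨a, ha⟩ := hQc u v hu hv
    have h4 : t' - t - a ∈ N := by rw [hN]; trivial
    have h5 := hQt _ _ _ _ _ h4 ha t
    rw [show t + (t' - t - a + a) = t' by ring] at h5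
    exact h5
  -- moving along edges
  have hedge : ∀ i v t l, Re (v, (t, l)) (gens f i • v, (t, l)) := by
    intro i v t l
    by_cases hv : q v ∈ J ∧ q v = q (gens f i • v)
    · have := hin (q v) hv.1 ((b (q v) t)⁻¹ * l) v (gens f i • v) t t rfl hv.2.symm
      rwa [mul_inv_cancel_left] at this
    · have h0 : φ (i, v) = 0 := by
        by_cases hv1 : q v ∈ J
        · refine hφ.2 _ (Or.inl ?_)
          exact fun h => hv ⟨hv1, h⟩
        · exact hJ0 _ hv1
      refine ⟨gens f i, ?_⟩
      rw [hstep, h0]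
      simp
  have hmove : ∀ g : G, ∀ v t l, Re (v, (t, l)) (g • v, (t, l)) := by
    intro g
    have hg : g ∈ Subgroup.closure (Set.range (gens f)) := by rw [hs]; trivial
    induction hg using Subgroup.closure_induction with
    | mem x hx =>
      obtain ⟨i, rfl⟩ := hx
      exact hedge i
    | one => intro v t l; rw [one_smul]; exact hRe.refl _
    | mul x y _ _ hx hy =>
      intro v t l
      rw [mul_smul]
      exact hRe.trans (hy v t l) (hx _ t l)
    | inv x _ hx =>
      intro v t l
      have := hx (x⁻¹ • v) t l
      rw [smul_inv_smul] at this
      exact hRe.symm this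
  have hany : ∀ u v t l, Re (u, (t, l)) (v, (t, l)) := by
    intro u v t l
    obtain ⟨g, rfl⟩ := MulAction.exists_smul_eq G u v
    exact hmove g u t l
  have hpart : ∀ j ∈ J, ∃ v, q v = j := by
    intro j hj
    by_contra hcon
    push Not at hcon
    exact hJ j hj ⟨fun _ => 0, fun i v hv => absurd hv (hcon v)⟩
  set e : G ⧸ H := QuotientGroup.mk 1 with he
  have hjump : ∀ j ∈ J, ∀ t t' l, Re (e, (t, b j t * l)) (e, (t', b j t' * l)) := by
    intro j hj t t' l
    obtain ⟨v, hv⟩ := hpart j hj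
    exact hRe.trans (hany e v _ _) (hRe.trans (hin j hj l v v t t' hv hv) (hany v e _ _))
  have hfree : ∀ t t' l, Re (e, (t, l)) (e, (t', l)) := by
    intro t t' l
    have := hjump j₀ hj₀ t t' l
    have hb : ∀ t, b j₀ t = 1 := by
      intro t; simp only [b, hgen₀]; split_ifs <;> rfl
    rwa [hb, hb, one_mul] at this
  have hgenl : ∀ j ∈ J, ∀ l, Re (e, (0, l)) (e, (0, gen j * l)) := by
    intro j hj l
    have := hjump j hj 0 1 l
    have hb0 : b j 0 = 1 := by simp [b]
    have hb1 : b j 1 = gen j := by simp [b]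
    rw [hb0, hb1, one_mul] at this
    exact hRe.trans this (hfree _ _ _)
  have hall : ∀ k : Λ, ∀ l, Re (e, (0, l)) (e, (0, k * l)) := by
    intro k
    have hk : k ∈ Subgroup.closure (gen '' J) := by rw [hgen]; trivial
    induction hk using Subgroup.closure_induction with
    | mem x hx =>
      obtain ⟨j, hj, rfl⟩ := hx
      exact hgenl j hj
    | one => intro l; rw [one_mul]; exact hRe.refl _
    | mul x y _ _ hx hy =>
      intro l
      rw [mul_assoc]
      exact hRe.trans (hy l) (hx _)
    | inv x _ hx =>
      intro l
      have := hx (x⁻¹ * l)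
      rw [mul_inv_cancel_left] at this
      exact hRe.symm this
  refine endgame A hA (fun t => hfree 0 t 1) (fun l => ?_)
  have := hall l 1
  rwa [mul_one] at this

end
end Lack

namespace Lack

section
universe u
variable {G : Type u} [Group G] {ι : Type} {Λ : Type} [Group Λ] {p : ℕ}

theorem quotient_onto [hp : Fact p.Prime] [Group.FG G] [Finite ι] (f : FreeGroup ι →* G)
    (hf : Function.Surjective f)
    (R : Set (FreeGroup ι)) (hRf : R.Finite) (hker : f.ker = Subgroup.normalClosure R)
    (hs : Subgroup.closure (Set.range (gens f)) = ⊤) (c : ℝ) (hc : 0 < c)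
    (K : ℕ → Subgroup G)
    (hK : ∀ i, PS p ⊤ (K i) ∧ Good p c (K i) ∧ Step p (K i) (K (i + 1)))
    (hno : ∀ δ : ℝ, 0 < δ → ∃ i, ¬ Expand (fun j (y : G ⧸ K i) => gens f j • y) δ)
    {κ : Type} [Finite κ] (s : κ → Λ) (hsΛ : Subgroup.closure (Set.range s) = ⊤) :
    ∃ H' : Subgroup G, PS p ⊤ H' ∧ ∃ ψ : H' →* Λ, Function.Surjective ψ := by
  classical
  have hR : ∀ r ∈ R, f r = 1 := by
    intro r hr
    rw [← MonoidHom.mem_ker, hker]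
    exact Subgroup.subset_normalClosure hr
  obtain ⟨T, hTf, hT⟩ := exists_loc f R hRf
  obtain ⟨C, hC⟩ := killed_card f hs T hTf
  set m : ℕ := Nat.card (Option κ) with hm
  have hm0 : 0 < m := Nat.card_pos
  set k : ℕ := Nat.card ι with hk
  have hm0' : (0 : ℝ) < m := by exact_mod_cast hm0
  set ρ : ℝ := c / (4 * (k + 1) * m) with hρ
  have hρ0 : 0 < ρ := by positivity
  set ε : ℝ := c / (4 * (C + 1)) with hε
  have hε0 : 0 < ε := by positivity
  have hfin : ∀ i, Finite (G ⧸ K i) := fun i => by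
    have := finite_of_PS (hK i).1
    infer_instance
  obtain ⟨l, hl⟩ := partition (gens f) hs (fun i => (hK i).2.2) hfin hno ρ ε hρ0 hε0
  obtain ⟨N, hN⟩ := exists_nat_gt (4 / c)
  obtain ⟨H, hKH, hNH, hD⟩ := (hK l).2.1 N
  have hPH : PS p ⊤ H := Relation.ReflTransGen.trans (hK l).1 hKH
  have hFI := finite_of_PS hPH
  have hHfin : Finite (G ⧸ H) := inferInstance
  obtain ⟨q, hq1, hq2, hq3⟩ := components (gens f) H ρ ε (hl H hKH.le hHfin)
  have hdim := dim_bound f hf p H R hR T q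
  set J := carry f R p T q with hJ
  obtain ⟨φ, hφ, hφ1, hφ2⟩ := merge f R hR p T hT q
  have hJr : J ⊆ Set.range q := by
    intro j hj
    by_contra hcon
    exact hφ1 j hj ⟨fun _ => 0, fun i v hv => absurd ⟨v, hv⟩ hcon⟩
  have hJf : J.Finite := (Set.finite_range q).subset hJr
  set n : ℝ := (Nat.card (G ⧸ H) : ℝ) with hn
  have hn4 : 4 < c * n := by
    have h1 : (N : ℝ) ≤ n := by
      have : N ≤ Nat.card (G ⧸ H) := hNH
      rw [hn]
      exact_mod_cast this
    have h2 : 4 / c < n := hN.trans_le h1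
    rw [div_lt_iff₀ hc] at h2
    linarith
  have hn0 : 0 < n := by
    by_contra h
    push Not at h
    nlinarith
  have hcard : m ≤ J.ncard := by
    by_contra hlt
    push Not at hlt
    have hE : ({e : ι × (G ⧸ H) | q e.2 ∈ J}.ncard : ℝ) ≤ k * (J.ncard * (ρ * n)) := by
      have h1 : {e : ι × (G ⧸ H) | q e.2 ∈ J} =
          Set.univ ×ˢ (⋃ j ∈ hJf.toFinset, {v | q v = j}) := by
        ext ⟨i, v⟩
        simp
      rw [h1, Set.ncard_prod, Set.ncard_univ]
      push_cast
      have h2 : ((⋃ j ∈ hJf.toFinset, {v | q v = j}).ncard : ℝ) ≤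
          ∑ j ∈ hJf.toFinset, (({v | q v = j}.ncard : ℕ) : ℝ) := by
        exact_mod_cast Finset.set_ncard_biUnion_le hJf.toFinset fun j => {v | q v = j}
      have h3 : ∑ j ∈ hJf.toFinset, (({v | q v = j}.ncard : ℕ) : ℝ) ≤ J.ncard * (ρ * n) := by
        rw [Set.ncard_eq_toFinset_card J hJf, ← nsmul_eq_mul, ← Finset.sum_const]
        exact Finset.sum_le_sum fun j _ => hq1 j
      exact mul_le_mul_of_nonneg_left (h2.trans h3) (by positivity)
    have hE2 : (k : ℝ) * (J.ncard * (ρ * n)) ≤ c * n / 4 := by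
      have hJm : (J.ncard : ℝ) ≤ m := by exact_mod_cast hlt.le
      calc (k : ℝ) * (J.ncard * (ρ * n)) ≤ (k + 1) * (m * (ρ * n)) := by
            gcongr
            linarith
        _ = c * n / 4 := by
            rw [hρ]; field_simp
    have hkill : ((killed f H T q).ncard : ℝ) ≤ c * n / 4 := by
      have h1 : ((killed f H T q).ncard : ℝ) ≤ C * (crossing (gens f) H q).ncard := by
        exact_mod_cast hC H q
      calc ((killed f H T q).ncard : ℝ) ≤ C * (ε * n) := by
            refine h1.trans ?_
            gcongr
        _ ≤ (C + 1) * (ε * n) := by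
            gcongr
            linarith
        _ = c * n / 4 := by
            rw [hε]; field_simp
    have hdim' : (D p H : ℝ) ≤ 1 + (killed f H T q).ncard +
        {e : ι × (G ⧸ H) | q e.2 ∈ J}.ncard := by exact_mod_cast hdim
    have hD' : c * n ≤ D p H := hD
    linarith
  have : Finite J := hJf
  have := Fintype.ofFinite J
  have := Fintype.ofFinite (Option κ)
  obtain ⟨e⟩ : Nonempty (Option κ ↪ J) := by
    apply Function.Embedding.nonempty_of_card_le
    rw [← Nat.card_eq_fintype_card, ← Nat.card_eq_fintype_card]
    exact hcard
  have he : Function.Injective (fun x => (e x : ℕ)) := Subtype.val_injective.comp e.injective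
  let gen : ℕ → Λ := Function.extend (fun x => (e x : ℕ)) (fun x => x.elim 1 s) (fun _ => 1)
  have hgen : ∀ x, gen (e x) = x.elim 1 s := fun x => he.extend_apply _ _ x
  obtain ⟨H', hH', ψ, hψ⟩ := big f hf R hker hs T hT q hq3 φ hφ J hφ1 hφ2 gen
    (by
      rw [eq_top_iff, ← hsΛ]
      refine Subgroup.closure_mono ?_
      rintro _ ⟨x, rfl⟩
      exact ⟨e (some x), (e (some x)).2, hgen (some x)⟩)
    (e none) (e none).2 (hgen none)
  exact ⟨H', Relation.ReflTransGen.tail hPH hH', ψ, hψ⟩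

theorem finish [hp : Fact p.Prime] (hG : IsFinitelyPresented G)
    (h : 0 < Filter.limsup
      (fun n : ℕ => Real.log (subnormalCount G (p ^ n)) / (p : ℝ) ^ n) Filter.atTop) :
    ∃ Gs : ℕ → Subgroup G,
      (∀ i, Gs (i + 1) < Gs i) ∧ (∀ i, IsSubnormal (Gs i)) ∧
      (∀ i, ∃ k : ℕ, (Gs i).index = p ^ k) ∧ PropertyTau G Gs := by
  obtain ⟨n, R, f, hf, hker⟩ := hG
  have hFG : Group.FG G := Group.fg_of_surjective hf
  have hs : Subgroup.closure (Set.range (gens f)) = ⊤ := by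
    have h1 : Set.range (gens f) = f '' Set.range FreeGroup.of := by
      rw [← Set.range_comp]; rfl
    rw [h1, ← MonoidHom.map_closure, FreeGroup.closure_range_of, ← MonoidHom.range_eq_map,
      MonoidHom.range_eq_top.2 hf]
  obtain ⟨c, hc, hgood⟩ := growth h
  obtain ⟨K, hK0, hK⟩ := chain (p := p) (c := c) hgood
  have hKlt : ∀ i, K (i + 1) < K i := by
    intro i
    refine lt_of_le_of_ne (hK i).2.2.1 fun heq => ?_
    have := (hK i).2.2.2.1
    rw [heq, Subgroup.relIndex_self] at this
    exact hp.out.one_lt.ne this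
  by_cases hexp : ∃ δ : ℝ, 0 < δ ∧ ∀ i, Expand (fun j (y : G ⧸ K (i + 1)) => gens f j • y) δ
  · obtain ⟨δ, hδ, hE⟩ := hexp
    refine ⟨fun i => K (i + 1), fun i => hKlt _, fun i => (hK _).1.subnormal,
      fun i => (hK _).1.index, ?_⟩
    refine tau_of_expand (gens f) hs _ (fun i => ?_) (fun i => ((hKlt i).trans_le le_top).ne) δ hδ hE
    have := finite_of_PS (hK (i + 1)).1
    infer_instance
  · push Not at hexp
    obtain ⟨L, _, κ, _, s, N, hsL, hNn, hNlt, hNidx, hNE⟩ := exists_tau_group p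
    obtain ⟨H', hH', ψ, hψ⟩ := quotient_onto f hf (R : Set (FreeGroup (Fin n))) R.finite_toSet hker
      hs c hc K hK (fun δ hδ => by
        obtain ⟨i, hi⟩ := hexp δ hδ
        exact ⟨i + 1, hi⟩) s hsL
    have := finite_of_PS hH'
    have hNfin : ∀ i, Finite (L ⧸ N (i + 1)) := by
      intro i
      obtain ⟨k, hk⟩ := hNidx (i + 1)
      have : (N (i + 1)).FiniteIndex := ⟨by rw [hk]; exact pow_ne_zero _ hp.out.ne_zero⟩
      infer_instance
    obtain ⟨δ, hδ, hE⟩ := transfer (gens f) hs H' ψ hψ s (fun i => N (i + 1)) hNfin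
      (fun i => hNE (i + 1))
    have hlt : ∀ i, ((N (i + 1)).comap ψ).map H'.subtype < ((N i).comap ψ).map H'.subtype := by
      intro i
      refine lt_of_le_of_ne (Subgroup.map_mono (Subgroup.comap_mono (hNlt i).le)) fun heq => ?_
      have h1 := Subgroup.map_injective H'.subtype_injective heq
      have h2 := Subgroup.comap_injective hψ h1
      exact (hNlt i).ne h2
    have hPS : ∀ i, PS p ⊤ (((N i).comap ψ).map H'.subtype) := by
      intro i
      obtain ⟨k, hk⟩ := hNidx i
      refine Relation.ReflTransGen.trans hH' (PS_of_normal k _ _ (Subgroup.map_subtype_le _) ?_ ?_)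
      · rintro g hg _ ⟨x, hx, rfl⟩
        have hn := (hNn i).comap ψ
        exact ⟨⟨g, hg⟩ * x * ⟨g, hg⟩⁻¹, hn.conj_mem x hx _, rfl⟩
      · rw [Subgroup.relIndex, Subgroup.subgroupOf,
          Subgroup.comap_map_eq_self_of_injective H'.subtype_injective,
          Subgroup.index_comap_of_surjective _ hψ, hk]
    exact ⟨fun i => ((N (i + 1)).comap ψ).map H'.subtype, fun i => hlt _,
      fun i => (hPS _).subnormal, fun i => (hPS _).index,
      tau_of_expand (gens f) hs _ (fun i => (hE i).1)
        (fun i => ((hlt i).trans_le le_top).ne) δ hδ (fun i => (hE i).2)⟩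

end
end Lack

/-- **Corollary 1.8** (reformulated via Theorem 8.1): if a finitely presented group `G`
satisfies `limsup (log a_{p^n}^{⊳⊳}(G))/p^n > 0` (equivalently, its pro-`p` completion has
exponential subgroup growth), then `G` has an infinite strictly nested sequence of subnormal
subgroups, each of `p`-power index, with Property (τ). -/
theorem statement12 {G : Type*} [Group G] (hG : IsFinitelyPresented G) (p : ℕ) (hp : p.Prime)
    (h : 0 < Filter.limsup
      (fun n : ℕ => Real.log (subnormalCount G (p ^ n)) / (p : ℝ) ^ n) Filter.atTop) :
    ∃ Gs : ℕ → Subgroup G,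
      (∀ i, Gs (i + 1) < Gs i) ∧ (∀ i, IsSubnormal (Gs i)) ∧
      (∀ i, ∃ k : ℕ, (Gs i).index = p ^ k) ∧ PropertyTau G Gs := by
  haveI : Fact p.Prime := ⟨hp⟩
  exact Lack.finish hG h
end

section
/- Let p be a prime and let L = (ℤ/pℤ) ≀ ℤ be the generalised lamplighter group, with canonical projection φ : L → ℤ. For i ≥ 1 set G_i = φ⁻¹(p^i ℤ). Then {G_i} is a strictly nested sequence of normal subgroups of L with [L : G_i] = p^i, such that: (i) L does not have Property (τ) with respect to {G_i}; and (ii) {G_i} has linear growth of mod p homology (indeed d_p(G_i) ≥ [L : G_i] for every i). Moreover, L is not large. -/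
open scoped TensorProduct

/-- The shift automorphism of `⊕_{k ∈ ℤ} ℤ/pℤ`, shifting the index set one to the right. -/
noncomputable def lampShift (p : ℕ) :
    MulAut (Multiplicative (ℤ →₀ ZMod p)) :=
  AddEquiv.toMultiplicative
    (Finsupp.domCongr (M := ZMod p) (Equiv.addLeft (1 : ℤ)))

/-- The generalised lamplighter group `(ℤ/pℤ) ≀ ℤ`, as the semidirect product
`(⊕_{k ∈ ℤ} ℤ/pℤ) ⋊ ℤ` where `1 ∈ ℤ` acts by shifting the index set one to the right. -/
noncomputable abbrev Lamp (p : ℕ) :=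
  SemidirectProduct (Multiplicative (ℤ →₀ ZMod p)) (Multiplicative ℤ)
    (zpowersHom _ (lampShift p))

/-- The canonical projection of the lamplighter group onto `ℤ`. -/
noncomputable def lampProj (p : ℕ) : Lamp p →* Multiplicative ℤ :=
  SemidirectProduct.rightHom

/-- `G_i = φ⁻¹(p^{i+1} ℤ)` (indexed so that `lampSubgroup p i` is the `G_{i+1}` of the
paper, `i : ℕ`). -/
noncomputable def lampSubgroup (p : ℕ) (i : ℕ) : Subgroup (Lamp p) :=
  Subgroup.comap (lampProj p)
    (Subgroup.zpowers (Multiplicative.ofAdd ((p : ℤ) ^ (i + 1))))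

theorem lampShift_zpow (p : ℕ) (k : ℤ) (f : Multiplicative (ℤ →₀ ZMod p)) :
    Multiplicative.toAdd ((lampShift p ^ k) f) =
      Finsupp.mapDomain (fun j => k + j) (Multiplicative.toAdd f) := by
  have h1 : ∀ f : Multiplicative (ℤ →₀ ZMod p), Multiplicative.toAdd (lampShift p f) =
      Finsupp.mapDomain (fun j => 1 + j) (Multiplicative.toAdd f) := by
    intro f
    change Finsupp.equivMapDomain (Equiv.addLeft (1 : ℤ)) (Multiplicative.toAdd f) = _
    rw [Finsupp.equivMapDomain_eq_mapDomain]
    rfl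
  have h2 : ∀ f : Multiplicative (ℤ →₀ ZMod p), Multiplicative.toAdd ((lampShift p)⁻¹ f) =
      Finsupp.mapDomain (fun j => -1 + j) (Multiplicative.toAdd f) := by
    intro f
    have h := h1 ((lampShift p)⁻¹ f)
    rw [MulAut.apply_inv_self] at h
    rw [h, ← Finsupp.mapDomain_comp]
    have : (fun j : ℤ => -1 + j) ∘ (fun j : ℤ => 1 + j) = id := by
      ext j; simp
    rw [this, Finsupp.mapDomain_id]
  induction k using Int.induction_on generalizing f with
  | zero =>
    simp only [zpow_zero, MulAut.one_apply, zero_add]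
    exact Finsupp.mapDomain_id.symm
  | succ n ih =>
    rw [zpow_add_one, MulAut.mul_apply, ih, h1, ← Finsupp.mapDomain_comp]
    congr 1; ext j; simp [add_assoc]
  | pred n ih =>
    rw [zpow_sub_one, MulAut.mul_apply, ih, h2, ← Finsupp.mapDomain_comp]
    congr 1; ext j; simp [sub_eq_add_neg, add_assoc]

theorem lampAct (p : ℕ) (k : Multiplicative ℤ) (f : Multiplicative (ℤ →₀ ZMod p)) :
    Multiplicative.toAdd ((zpowersHom _ (lampShift p)) k f) =
      Finsupp.mapDomain (fun j => Multiplicative.toAdd k + j) (Multiplicative.toAdd f) := by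
  rw [zpowersHom_apply]; exact lampShift_zpow p _ f

theorem mem_lampSubgroup (p i : ℕ) (x : Lamp p) :
    x ∈ lampSubgroup p i ↔ ((p : ℤ) ^ (i + 1)) ∣ Multiplicative.toAdd x.right := by
  rw [lampSubgroup, Subgroup.mem_comap, Subgroup.mem_zpowers_iff]
  constructor
  · rintro ⟨k, hk⟩
    refine ⟨k, ?_⟩
    have := congrArg Multiplicative.toAdd hk
    rw [toAdd_zpow, toAdd_ofAdd] at this
    change _ = Multiplicative.toAdd x.right at this
    rw [← this, smul_eq_mul, mul_comm]
  · rintro ⟨k, hk⟩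
    refine ⟨k, ?_⟩
    apply Multiplicative.toAdd.injective
    rw [toAdd_zpow, toAdd_ofAdd]
    change _ = Multiplicative.toAdd x.right
    rw [hk, smul_eq_mul, mul_comm]

theorem lampSubgroup_normal (p i : ℕ) : (lampSubgroup p i).Normal :=
  Subgroup.Normal.comap inferInstance _

theorem lampSubgroup_index (p i : ℕ) : (lampSubgroup p i).index = p ^ (i + 1) := by
  have hs : Function.Surjective (lampProj p) := SemidirectProduct.rightHom_surjective
  rw [lampSubgroup, Subgroup.index_comap_of_surjective _ hs]
  have := Int.index_zmultiples ((p : ℤ) ^ (i + 1))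
  rw [Int.natAbs_pow, Int.natAbs_natCast] at this
  exact this

theorem lampSubgroup_lt (p : ℕ) (hp : p.Prime) (i : ℕ) :
    lampSubgroup p (i + 1) < lampSubgroup p i := by
  refine lt_of_le_of_ne ?_ ?_
  · intro x hx
    rw [mem_lampSubgroup] at *
    exact (pow_dvd_pow _ (by omega)).trans hx
  · intro h
    have := congrArg Subgroup.index h
    rw [lampSubgroup_index, lampSubgroup_index] at this
    have := Nat.pow_right_injective hp.two_le this
    omega

theorem lamp_fg (p : ℕ) : Group.FG (Lamp p) := by
  rw [Group.fg_iff]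
  set S : Set (Lamp p) := {SemidirectProduct.inl (Multiplicative.ofAdd (Finsupp.single 0 1)),
    SemidirectProduct.inr (Multiplicative.ofAdd 1)} with hS
  refine ⟨S, ?_, by simp [hS]⟩
  rw [eq_top_iff]
  have hr : ∀ k : Multiplicative ℤ, (SemidirectProduct.inr k : Lamp p) ∈ Subgroup.closure S := by
    intro k
    have : k = (Multiplicative.ofAdd (1 : ℤ)) ^ (Multiplicative.toAdd k) := by
      apply Multiplicative.toAdd.injective
      simp [toAdd_zpow]
    rw [this, map_zpow]
    exact Subgroup.zpow_mem _ (Subgroup.subset_closure (by simp [hS])) _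
  have hl : ∀ f : ℤ →₀ ZMod p,
      (SemidirectProduct.inl (Multiplicative.ofAdd f) : Lamp p) ∈ Subgroup.closure S := by
    intro f
    induction f using Finsupp.induction_linear with
    | zero => rw [ofAdd_zero, map_one]; exact Subgroup.one_mem _
    | add f g hf hg => rw [ofAdd_add, map_mul]; exact Subgroup.mul_mem _ hf hg
    | single a b =>
      have e1 : (Multiplicative.ofAdd (Finsupp.single a b) : Multiplicative (ℤ →₀ ZMod p)) =
          (zpowersHom _ (lampShift p)) (Multiplicative.ofAdd a)
            ((Multiplicative.ofAdd (Finsupp.single 0 1)) ^ (b.cast : ℤ)) := by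
        apply Multiplicative.toAdd.injective
        rw [lampAct, toAdd_zpow, toAdd_ofAdd, toAdd_ofAdd, toAdd_ofAdd, Finsupp.smul_single,
          Finsupp.mapDomain_single]
        simp
      rw [e1, SemidirectProduct.inl_aut, map_zpow]
      exact Subgroup.mul_mem _ (Subgroup.mul_mem _ (hr _)
        (Subgroup.zpow_mem _ (Subgroup.subset_closure (by simp [hS])) _)) (hr _)
  intro x _
  rw [← SemidirectProduct.inl_left_mul_inr_right x]
  exact Subgroup.mul_mem _ (hl (Multiplicative.toAdd x.left)) (hr _)

/-- sum the lamps over residue classes -/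
noncomputable def lampFold (p i : ℕ) :
    ↥(lampSubgroup p i) →* Multiplicative (ZMod (p ^ (i + 1)) →₀ ZMod p) :=
  MonoidHom.mk' (fun x => Multiplicative.ofAdd
    (Finsupp.mapDomain (fun j : ℤ => (j : ZMod (p ^ (i + 1))))
      (Multiplicative.toAdd x.1.left))) (by
    intro x y
    rw [← ofAdd_add]
    congr 1
    rw [Subgroup.coe_mul, SemidirectProduct.mul_left, toAdd_mul, lampAct,
      Finsupp.mapDomain_add, ← Finsupp.mapDomain_comp]
    congr 2
    ext j
    have h := (mem_lampSubgroup p i x.1).1 x.2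
    have h2 := (ZMod.intCast_zmod_eq_zero_iff_dvd (Multiplicative.toAdd x.1.right)
      (p ^ (i + 1))).2 (by exact_mod_cast h)
    simp [h2])

theorem lampFold_surjective (p i : ℕ) : Function.Surjective (lampFold p i) := by
  intro w
  obtain ⟨f, hf⟩ := Finsupp.mapDomain_surjective (M := ZMod p)
    (ZMod.intCast_surjective (n := p ^ (i + 1))) (Multiplicative.toAdd w)
  refine ⟨⟨SemidirectProduct.inl (Multiplicative.ofAdd f), ?_⟩, ?_⟩
  · rw [mem_lampSubgroup]; simp
  · exact congrArg Multiplicative.ofAdd hf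

theorem lamp_dp (p : ℕ) (hp : p.Prime) (i : ℕ) :
    (lampSubgroup p i).index ≤ dp p ↥(lampSubgroup p i) := by
  have : Fact p.Prime := ⟨hp⟩
  have := lamp_fg p
  have : (lampSubgroup p i).FiniteIndex :=
    ⟨by rw [lampSubgroup_index]; exact pow_ne_zero _ hp.ne_zero⟩
  have : Group.FG ↥(lampSubgroup p i) := inferInstance
  have : Group.FG (Abelianization ↥(lampSubgroup p i)) :=
    QuotientGroup.fg (commutator ↥(lampSubgroup p i))
  have : Module.Finite ℤ (Additive (Abelianization ↥(lampSubgroup p i))) :=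
    Module.Finite.iff_addGroup_fg.2 inferInstance
  have : NeZero (p ^ (i + 1)) := ⟨pow_ne_zero _ hp.ne_zero⟩
  let g : Additive (Abelianization ↥(lampSubgroup p i)) →+ (ZMod (p ^ (i + 1)) →₀ ZMod p) :=
    MonoidHom.toAdditiveLeft (Abelianization.lift (lampFold p i))
  let F := LinearMap.liftBaseChange (ZMod p) g.toIntLinearMap
  have hF : Function.Surjective F := by
    intro w
    obtain ⟨x, hx⟩ := lampFold_surjective p i (Multiplicative.ofAdd w)
    refine ⟨1 ⊗ₜ Additive.ofMul (Abelianization.of x), ?_⟩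
    rw [LinearMap.liftBaseChange_tmul, one_smul]
    change Multiplicative.toAdd (lampFold p i x) = w
    rw [hx]; rfl
  have := LinearMap.finrank_le_finrank_of_surjective hF
  rw [Module.finrank_finsupp_self, ZMod.card] at this
  rw [lampSubgroup_index]
  exact this

theorem lamp_linear (p : ℕ) (hp : p.Prime) : LinearGrowthModP p (lampSubgroup p) := by
  refine ⟨1, one_pos, fun i => ?_⟩
  have h := lamp_dp p hp i
  have h0 : 0 < (lampSubgroup p i).index := by
    rw [lampSubgroup_index]; exact pow_pos hp.pos _
  rw [le_div_iff₀ (by exact_mod_cast h0), one_mul]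
  exact_mod_cast h

theorem lamp_not_large (p : ℕ) : ¬ IsLarge (Lamp p) := by
  rintro ⟨H, -, f, hf⟩
  have : Group.IsSolvable (Lamp p) :=
    Group.isSolvable_of_ker_le_range
      (SemidirectProduct.inl : Multiplicative (ℤ →₀ ZMod p) →* Lamp p)
      (SemidirectProduct.rightHom : Lamp p →* Multiplicative ℤ)
      SemidirectProduct.range_inl_eq_ker_rightHom.ge
  have : Group.IsSolvable (FreeGroup (Fin 2)) := Group.isSolvable_of_surjective hf
  let q : FreeGroup (Fin 2) →* Equiv.Perm (Fin 5) :=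
    FreeGroup.lift ![finRotate 5, Equiv.swap 0 (finRotate 5 0)]
  have hq : Function.Surjective q := by
    rw [← MonoidHom.range_eq_top, eq_top_iff,
      ← Equiv.Perm.closure_cycle_adjacent_swap (σ := finRotate 5) isCycle_finRotate
        support_finRotate 0, Subgroup.closure_le]
    rintro x (rfl | rfl)
    · exact ⟨FreeGroup.of 0, by simp [q]⟩
    · exact ⟨FreeGroup.of 1, by simp [q]⟩
  exact Equiv.Perm.not_isSolvable_fin_5 (Group.isSolvable_of_surjective hq)

/-- the coset of `t ^ j` -/
noncomputable def lampPt (p i : ℕ) (j : ℤ) : Lamp p ⧸ lampSubgroup p i :=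
  QuotientGroup.mk (SemidirectProduct.inr (Multiplicative.ofAdd j))

theorem lampPt_smul (p i : ℕ) (s : Lamp p) (j : ℤ) :
    s • lampPt p i j = lampPt p i (Multiplicative.toAdd s.right + j) := by
  change (QuotientGroup.mk (s * SemidirectProduct.inr (Multiplicative.ofAdd j)) :
    Lamp p ⧸ lampSubgroup p i) = QuotientGroup.mk _
  rw [QuotientGroup.eq, mem_lampSubgroup]
  simp

theorem lampPt_eq (p i : ℕ) (j k : ℤ) :
    lampPt p i j = lampPt p i k ↔ ((p : ℤ) ^ (i + 1)) ∣ k - j := by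
  rw [lampPt, lampPt, QuotientGroup.eq, mem_lampSubgroup]
  simp [sub_eq_add_neg, add_comm]

theorem lamp_not_tau (p : ℕ) (hp : p.Prime) : ¬ PropertyTau (Lamp p) (lampSubgroup p) := by
  rintro ⟨S, -, ε, hε, h⟩
  classical
  obtain ⟨K, hK⟩ : ∃ K : ℕ, ∀ s ∈ S, (Multiplicative.toAdd s.right).natAbs ≤ K :=
    ⟨S.sup fun s => (Multiplicative.toAdd s.right).natAbs, fun s hs =>
      Finset.le_sup (f := fun s : Lamp p => (Multiplicative.toAdd s.right).natAbs) hs⟩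
  set C : ℕ := S.card * (2 * (2 * K + 1)) with hC
  -- choose i
  obtain ⟨m₀, hm₀⟩ := exists_nat_gt ((C : ℝ) / ε)
  set i := 2 * (m₀ + 1) with hi
  set n := p ^ (i + 1) with hn
  have hin : i + 1 < n := Nat.lt_pow_self hp.one_lt
  set m := n / 2 with hm
  have hmm : m₀ < m := by omega
  have hm0 : 0 < m := by omega
  have hnz : ((p : ℤ) ^ (i + 1)) = (n : ℤ) := by rw [hn]; push_cast; rfl
  let A : Finset (Lamp p ⧸ lampSubgroup p i) := (Finset.Ico (0 : ℤ) m).image (lampPt p i)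
  have hAcard : A.card = m := by
    rw [Finset.card_image_of_injOn]
    · simp
    · intro a ha b hb hab
      rw [lampPt_eq, hnz] at hab
      simp only [Finset.coe_Ico, Set.mem_Ico] at ha hb
      have := Int.eq_zero_of_abs_lt_dvd hab (by rw [abs_lt]; omega)
      omega
  have hcardA : Nat.card (A : Set (Lamp p ⧸ lampSubgroup p i)) = m := by
    rw [← hAcard]; simp
  let B : Finset (Lamp p × (Lamp p ⧸ lampSubgroup p i)) :=
    (S ×ˢ (Finset.Icc (-(K : ℤ)) K ∪ Finset.Icc ((m : ℤ) - K) (m + K))).image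
      (fun e => (e.1, lampPt p i e.2))
  have hB : B.card ≤ C := by
    refine Finset.card_image_le.trans ?_
    rw [Finset.card_product, hC]
    refine Nat.mul_le_mul_left _ ((Finset.card_union_le _ _).trans ?_)
    simp only [Int.card_Icc]
    omega
  have hsub : schreierBoundary (Lamp p) (S : Set (Lamp p)) (lampSubgroup p i)
      (A : Set (Lamp p ⧸ lampSubgroup p i)) ⊆ (B : Set _) := by
    rintro ⟨s, v⟩ ⟨hs, hne⟩
    have hs : s ∈ S := hs
    have hks := hK s hs
    have key : ∃ j : ℤ, v = lampPt p i j ∧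
        (j ∈ Finset.Icc (-(K : ℤ)) K ∪ Finset.Icc ((m : ℤ) - K) (m + K)) := by
      have hmem : ∀ j : ℤ, 0 ≤ j → j < m → lampPt p i j ∈ A := fun j h0 h1 =>
        Finset.mem_image_of_mem _ (by simp [h0, h1])
      simp only [Finset.mem_coe, ne_eq, eq_iff_iff] at hne
      simp only [Finset.mem_union, Finset.mem_Icc]
      by_cases hv : v ∈ A
      · have hsv : s • v ∉ A := fun h => hne ⟨fun _ => h, fun _ => hv⟩
        obtain ⟨j, hj, rfl⟩ := Finset.mem_image.1 hv
        rw [Finset.mem_Ico] at hj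
        rw [lampPt_smul] at hsv
        have : ¬ (0 ≤ Multiplicative.toAdd s.right + j ∧ Multiplicative.toAdd s.right + j < m) :=
          fun h => hsv (hmem _ h.1 h.2)
        exact ⟨j, rfl, by omega⟩
      · have hsv : s • v ∈ A := by
          by_contra h
          exact hne ⟨fun h' => absurd h' hv, fun h' => absurd h' h⟩
        obtain ⟨j, hj, hjv⟩ := Finset.mem_image.1 hsv
        rw [Finset.mem_Ico] at hj
        have hv' : v = lampPt p i (j - Multiplicative.toAdd s.right) := by
          apply MulAction.injective s
          change s • v = s • _
          rw [← hjv, lampPt_smul]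
          congr 1; ring
        rw [hv'] at hv
        have : ¬ (0 ≤ j - Multiplicative.toAdd s.right ∧ j - Multiplicative.toAdd s.right < m) :=
          fun h => hv (hmem _ h.1 h.2)
        exact ⟨_, hv', by omega⟩
    obtain ⟨j, rfl, hj⟩ := key
    exact Finset.mem_coe.2 (Finset.mem_image.2 ⟨(s, j), Finset.mem_product.2 ⟨hs, hj⟩, rfl⟩)
  have hbd : Nat.card (schreierBoundary (Lamp p) (S : Set (Lamp p)) (lampSubgroup p i)
      (A : Set (Lamp p ⧸ lampSubgroup p i))) ≤ C := by
    refine le_trans (Nat.card_mono B.finite_toSet hsub) ?_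
    simpa using hB
  have hch : cheeger (Lamp p) (S : Set (Lamp p)) (lampSubgroup p i) ≤ (C : ℝ) / m := by
    refine le_trans (csInf_le ⟨0, ?_⟩ ⟨(A : Set _), ?_, ?_, rfl⟩) ?_
    · rintro r ⟨A', -, -, rfl⟩
      positivity
    · rw [Finset.coe_nonempty, ← Finset.card_pos, hAcard]; exact hm0
    · rw [hcardA]
      have : Nat.card (Lamp p ⧸ lampSubgroup p i) = n := lampSubgroup_index p i
      rw [this]
      exact_mod_cast (by omega : 2 * m ≤ n)
    · rw [hcardA]
      gcongr
  have h1 := (h i).trans hch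
  have hmpos : (0 : ℝ) < m := by exact_mod_cast hm0
  rw [le_div_iff₀ hmpos] at h1
  rw [div_lt_iff₀ hε] at hm₀
  have : (m₀ : ℝ) < m := by exact_mod_cast hmm
  nlinarith

/-- **Proposition 7.1**: the subgroups `G_i = φ⁻¹(p^i ℤ)` of the generalised lamplighter
group `L = (ℤ/pℤ) ≀ ℤ` form a strictly nested sequence of normal subgroups of index `p^i`,
with respect to which `L` does not have Property (τ), which have linear growth of mod `p`
homology (indeed `d_p(G_i) ≥ [L : G_i]`); yet `L` is not large. -/
theorem statement13 (p : ℕ) (hp : p.Prime) :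
    (∀ i : ℕ, lampSubgroup p (i + 1) < lampSubgroup p i) ∧
    (∀ i : ℕ, (lampSubgroup p i).Normal) ∧
    (∀ i : ℕ, (lampSubgroup p i).index = p ^ (i + 1)) ∧
    ¬ PropertyTau (Lamp p) (lampSubgroup p) ∧
    (∀ i : ℕ, (lampSubgroup p i).index ≤ dp p ↥(lampSubgroup p i)) ∧
    LinearGrowthModP p (lampSubgroup p) ∧
    ¬ IsLarge (Lamp p) := by
  exact ⟨lampSubgroup_lt p hp, lampSubgroup_normal p, lampSubgroup_index p, lamp_not_tau p hp,
    lamp_dp p hp, lamp_linear p hp, lamp_not_large p⟩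
end
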